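/- Let T and U be computable consistent extensions of PA and n ≥ 1. The following are equivalent: (1) (T,U) is a C_n-pair; (2) there is a Σ_n sentence in HCons(Π_n,T) ∩ HCons(Π_n,U) \ (Th(T) ∪ Th(U)); (3) there exist sentences φ and ψ such that φ ∈ HCons(Π_n,T) ∩ HCons(Π_n,U), ψ is a Σ_n sentence, PA + φ ⊢ ψ, T ⊬ ψ, and U ⊬ ψ; (4) HCons(Π_n,T) ∩ HCons(Π_n,U) \ (Th(T) ∪ Th(U)) ≠ ∅. -/

import Mathlib

open FirstOrder Language
open scoped FirstOrder

namespace Guaspari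

/-- The first-order language of arithmetic: a constant `0`, a unary function `S`,
binary functions `+` (coded `false`) and `·` (coded `true`), and a binary relation `≤`. -/
def LA : FirstOrder.Language :=
  ⟨fun n => match n with | 0 => Unit | 1 => Unit | 2 => Bool | _ => Empty,
   fun n => match n with | 2 => Unit | _ => Empty⟩

/-- Sentences of the language of arithmetic. -/
abbrev Snt : Type := LA.Sentence

/-- Theories (sets of sentences) in the language of arithmetic. -/
abbrev Thy : Type := LA.Theory

/-- The term `0`. -/
def zeroT {α : Type} {n : ℕ} : LA.Term (α ⊕ Fin n) :=
  Constants.term (show LA.Constants from Unit.unit)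

/-- The term `S t`. -/
def succT {α : Type} {n : ℕ} (t : LA.Term (α ⊕ Fin n)) : LA.Term (α ⊕ Fin n) :=
  Functions.apply₁ (show LA.Functions 1 from Unit.unit) t

/-- The term `t + u`. -/
def addT {α : Type} {n : ℕ} (t u : LA.Term (α ⊕ Fin n)) : LA.Term (α ⊕ Fin n) :=
  Functions.apply₂ (show LA.Functions 2 from false) t u

/-- The term `t * u`. -/
def mulT {α : Type} {n : ℕ} (t u : LA.Term (α ⊕ Fin n)) : LA.Term (α ⊕ Fin n) :=
  Functions.apply₂ (show LA.Functions 2 from true) t u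

/-- The atomic formula `t ≤ u`. -/
def leF {α : Type} {n : ℕ} (t u : LA.Term (α ⊕ Fin n)) : LA.BoundedFormula α n :=
  Relations.boundedFormula₂ (show LA.Relations 2 from Unit.unit) t u

/-- The `i`-th (de Bruijn-indexed) bound variable as a term. -/
def vT {m : ℕ} (i : Fin m) : LA.Term (Empty ⊕ Fin m) := Term.var (Sum.inr i)

/-- The induction axiom for the formula `φ(x₀,…,x_{k-1}, x_k)` with induction on `x_k`,
universally closed over the parameters `x₀,…,x_{k-1}`. -/
def indAxiom {k : ℕ} (φ : LA.BoundedFormula Empty (k + 1)) : Snt :=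
  let base := ∀' ((vT (Fin.last k) =' zeroT) ⟹ φ)
  let step := ∀' (φ ⟹
    ∀' ((vT (Fin.last (k + 1)) =' succT (vT (Fin.castSucc (Fin.last k)))) ⟹ φ.liftAt 1 k))
  ((base ⊓ step) ⟹ ∀' φ).alls

/-- The axioms of Peano arithmetic `PA`: the basic axioms for `0`, `S`, `+`, `·`, `≤`,
together with the full induction scheme. -/
def PAAx : Thy :=
  {∀' ∼(succT (vT 0) =' zeroT),
   ∀' ∀' ((succT (vT 0) =' succT (vT 1)) ⟹ (vT 0 =' vT 1)),
   ∀' (addT (vT 0) zeroT =' vT 0),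
   ∀' ∀' (addT (vT 0) (succT (vT 1)) =' succT (addT (vT 0) (vT 1))),
   ∀' (mulT (vT 0) zeroT =' zeroT),
   ∀' ∀' (mulT (vT 0) (succT (vT 1)) =' addT (mulT (vT 0) (vT 1)) (vT 0)),
   ∀' ∀' (leF (vT 0) (vT 1) ⇔ ∃' (addT (vT 2) (vT 0) =' vT 1))} ∪
  {φ | ∃ (k : ℕ) (ψ : LA.BoundedFormula Empty (k + 1)), φ = indAxiom ψ}

/-- `Prv T φ`: the sentence `φ` is provable from the theory `T` (equivalently, by the
Gödel completeness theorem, `φ` holds in every model of `T`). -/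
def Prv (T : Thy) (φ : Snt) : Prop := T ⊨ᵇ φ

/-- `Th T`: the set of sentences provable from `T`. -/
def Th (T : Thy) : Set Snt := {φ | Prv T φ}

/-- `Con T`: the theory `T` is consistent. -/
def Con (T : Thy) : Prop := ¬ Prv T ⊥

/-- The theory `T + φ`. -/
def add (T : Thy) (φ : Snt) : Thy := insert φ T

/-- `T` is an extension of `PA`. -/
def ExtPA (T : Thy) : Prop := ∀ φ ∈ PAAx, Prv T φ

/-- `V` is a subtheory of `T` (containing `PA`, as assumed throughout the paper). -/
def SubThy (V T : Thy) : Prop := ExtPA V ∧ ∀ φ, Prv V φ → Prv T φ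

/-- Δ₀ (bounded) formulas. -/
inductive IsDelta0 : ∀ {m : ℕ}, LA.BoundedFormula Empty m → Prop
  | falsum {m : ℕ} : IsDelta0 (⊥ : LA.BoundedFormula Empty m)
  | equal {m : ℕ} (t u : LA.Term (Empty ⊕ Fin m)) : IsDelta0 (t =' u)
  | le {m : ℕ} (t u : LA.Term (Empty ⊕ Fin m)) : IsDelta0 (leF t u)
  | imp {m : ℕ} {φ ψ : LA.BoundedFormula Empty m} :
      IsDelta0 φ → IsDelta0 ψ → IsDelta0 (φ ⟹ ψ)
  | ball {m : ℕ} (t : LA.Term (Empty ⊕ Fin m)) {φ : LA.BoundedFormula Empty (m + 1)} :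
      IsDelta0 φ →
      IsDelta0 (∀' (leF (vT (Fin.last m)) (t.relabel (Sum.map id Fin.castSucc)) ⟹ φ))
  | bex {m : ℕ} (t : LA.Term (Empty ⊕ Fin m)) {φ : LA.BoundedFormula Empty (m + 1)} :
      IsDelta0 φ →
      IsDelta0 (∃' (leF (vT (Fin.last m)) (t.relabel (Sum.map id Fin.castSucc)) ⊓ φ))

mutual
  /-- `Σ_k` formulas (cumulatively: every `Π_k` formula is `Σ_{k+1}`). -/
  inductive IsSigmaFml : ℕ → ∀ {m : ℕ}, LA.BoundedFormula Empty m → Prop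
    | ofDelta0 {m : ℕ} {φ : LA.BoundedFormula Empty m} : IsDelta0 φ → IsSigmaFml 0 φ
    | ofPi {k : ℕ} {m : ℕ} {φ : LA.BoundedFormula Empty m} :
        IsPiFml k φ → IsSigmaFml (k + 1) φ
    | ex {k : ℕ} {m : ℕ} {φ : LA.BoundedFormula Empty (m + 1)} :
        IsSigmaFml (k + 1) φ → IsSigmaFml (k + 1) (∃' φ)
  /-- `Π_k` formulas (cumulatively: every `Σ_k` formula is `Π_{k+1}`). -/
  inductive IsPiFml : ℕ → ∀ {m : ℕ}, LA.BoundedFormula Empty m → Prop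
    | ofDelta0 {m : ℕ} {φ : LA.BoundedFormula Empty m} : IsDelta0 φ → IsPiFml 0 φ
    | ofSigma {k : ℕ} {m : ℕ} {φ : LA.BoundedFormula Empty m} :
        IsSigmaFml k φ → IsPiFml (k + 1) φ
    | all {k : ℕ} {m : ℕ} {φ : LA.BoundedFormula Empty (m + 1)} :
        IsPiFml (k + 1) φ → IsPiFml (k + 1) (∀' φ)
end

/-- The set of `Σ_k` sentences. -/
def SigmaS (k : ℕ) : Set Snt := {φ | IsSigmaFml k φ}

/-- The set of `Π_k` sentences. -/
def PiS (k : ℕ) : Set Snt := {φ | IsPiFml k φ}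

/-- The set of `Σ_k ∧ Π_k` sentences, i.e. sentences of the form `σ ∧ π` with
`σ` a `Σ_k` sentence and `π` a `Π_k` sentence. -/
def SigAndPiS (k : ℕ) : Set Snt :=
  {φ | ∃ σ ∈ SigmaS k, ∃ π ∈ PiS k, φ = σ ⊓ π}

/-- `B(Σ_k)` sentences: Boolean combinations of `Σ_k` sentences. -/
inductive IsBoolSigma (k : ℕ) : Snt → Prop
  | base {φ : Snt} : φ ∈ SigmaS k → IsBoolSigma k φ
  | not {φ : Snt} : IsBoolSigma k φ → IsBoolSigma k (∼φ)
  | imp {φ ψ : Snt} : IsBoolSigma k φ → IsBoolSigma k ψ → IsBoolSigma k (φ ⟹ ψ)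
  | inf {φ ψ : Snt} : IsBoolSigma k φ → IsBoolSigma k ψ → IsBoolSigma k (φ ⊓ ψ)
  | sup {φ ψ : Snt} : IsBoolSigma k φ → IsBoolSigma k ψ → IsBoolSigma k (φ ⊔ ψ)

/-- The set of `B(Σ_k)` sentences. -/
def BSigmaS (k : ℕ) : Set Snt := {φ | IsBoolSigma k φ}

/-- The set of `Γ` sentences provable in `T`, `Th_Γ(T)`. -/
def ThIn (Γ : Set Snt) (T : Thy) : Set Snt := Γ ∩ Th T

instance (i : ℕ) : Encodable (LA.Functions i) :=
  match i with
  | 0 => inferInstanceAs (Encodable Unit)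
  | 1 => inferInstanceAs (Encodable Unit)
  | 2 => inferInstanceAs (Encodable Bool)
  | (_ + 3) => inferInstanceAs (Encodable Empty)

instance (i : ℕ) : Encodable (LA.Relations i) :=
  match i with
  | 0 => inferInstanceAs (Encodable Empty)
  | 1 => inferInstanceAs (Encodable Empty)
  | 2 => inferInstanceAs (Encodable Unit)
  | (_ + 3) => inferInstanceAs (Encodable Empty)

/-- A Gödel numbering of sentences, via Mathlib's encoding of bounded formulas. -/
def gnum (φ : Snt) : ℕ :=
  Encodable.encode
    (show List ((Σ k, LA.Term (Empty ⊕ Fin k)) ⊕ ((Σ n, LA.Relations n) ⊕ ℕ)) from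
      BoundedFormula.encoding.encode (⟨0, φ⟩ : Σ n, LA.BoundedFormula Empty n))

/-- The (axiom set of the) theory `T` is computable. -/
def CompThy (T : Thy) : Prop :=
  ComputablePred (fun m : ℕ => ∃ φ ∈ T, gnum φ = m)

/-- `T` is a computable consistent extension of `PA`. -/
def GoodThy (T : Thy) : Prop := CompThy T ∧ Con T ∧ ExtPA T

/-- `φ` is `Γ`-conservative over `T` for a class of sentences `Γ`:
every `Γ` sentence provable in `T + φ` is provable in `T`. -/
def ConsIn (Γ : Set Snt) (T : Thy) (φ : Snt) : Prop :=
  ∀ γ ∈ Γ, Prv (add T φ) γ → Prv T γ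

/-- `φ` is hereditarily `Γ`-conservative over `T`: `Γ`-conservative over every
subtheory of `T` (containing `PA`). -/
def HConsIn (Γ : Set Snt) (T : Thy) (φ : Snt) : Prop :=
  ∀ V : Thy, SubThy V T → ConsIn Γ V φ

/-- `φ` is `Σ_k↓Π_k`-conservative over `V`. -/
def SPCons (k : ℕ) (V : Thy) (φ : Snt) : Prop :=
  ∀ σ ∈ SigmaS k, ∀ π ∈ PiS k, Prv (add V φ) (σ ⊓ π) → Prv V (σ ⊔ π)

/-- `φ` is hereditarily `Σ_k↓Π_k`-conservative over `T`. -/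
def HSPCons (k : ℕ) (T : Thy) (φ : Snt) : Prop :=
  ∀ V : Thy, SubThy V T → SPCons k V φ

/-- The theory `S` is `Σ_k↓Π_k`-conservative over `PA`. -/
def ThySPConsPA (k : ℕ) (S : Thy) : Prop :=
  ∀ σ ∈ SigmaS k, ∀ π ∈ PiS k, Prv S (σ ⊓ π) → Prv PAAx (σ ⊔ π)

/-- `δ` is a `Δ_k(S)` sentence: `S`-provably equivalent to both a `Σ_k` sentence
and a `Π_k` sentence. -/
def IsDeltaIn (k : ℕ) (S : Thy) (δ : Snt) : Prop :=
  (∃ σ ∈ SigmaS k, Prv S (δ ⇔ σ)) ∧ ∃ π ∈ PiS k, Prv S (δ ⇔ π)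

/-- `φ` is `Δ_k(S)`-conservative over `V`. -/
def DeltaConsRel (k : ℕ) (S V : Thy) (φ : Snt) : Prop :=
  ∀ δ : Snt, IsDeltaIn k S δ → Prv (add V φ) δ → Prv V δ

/-- `φ` is `Δ_k`-conservative over `T`, i.e. `Δ_k(Th(T))`-conservative over `T`. -/
def DeltaCons (k : ℕ) (T : Thy) (φ : Snt) : Prop := DeltaConsRel k (Th T) T φ

/-- `φ` is hereditarily `Δ_k`-conservative over `T`. -/
def HDeltaCons (k : ℕ) (T : Thy) (φ : Snt) : Prop :=
  ∀ V : Thy, SubThy V T → DeltaConsRel k (Th V) V φ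

/-- `φ` is doubly `Π_k`-conservative over `T`: `φ` is `Π_k`-conservative and `¬φ` is
`Σ_k`-conservative over `T`. -/
def DCons (k : ℕ) (T : Thy) (φ : Snt) : Prop :=
  ConsIn (PiS k) T φ ∧ ConsIn (SigmaS k) T (∼φ)

/-- `φ` is hereditarily doubly `Π_k`-conservative over `T`. -/
def HDCons (k : ℕ) (T : Thy) (φ : Snt) : Prop :=
  ∀ V : Thy, SubThy V T → DCons k V φ

/-- `(T,U)` is a `B_n`-pair. -/
def Bpair (n : ℕ) (T U : Thy) : Prop :=
  (¬ ThIn (PiS n) T ⊆ Th U ∨ Con (T ∪ ThIn (PiS n) U)) ∧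
  (¬ ThIn (PiS n) U ⊆ Th T ∨ Con (U ∪ ThIn (PiS n) T))

/-- `(T,U)` is a `C_n`-pair. -/
def Cpair (n : ℕ) (T U : Thy) : Prop :=
  Con (T ∪ ThIn (PiS n) U) ∧ Con (U ∪ ThIn (PiS n) T)

/-- `(T,U)` is a `C⁻_n`-pair. -/
def Cmpair (n : ℕ) (T U : Thy) : Prop :=
  Con (T ∪ ThIn (PiS n) U) ∨ Con (U ∪ ThIn (PiS n) T)

/-- `(T,U)` is a `C^∧_n`-pair. -/
def Capair (n : ℕ) (T U : Thy) : Prop :=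
  Con (T ∪ ThIn (SigAndPiS n) U) ∧ Con (U ∪ ThIn (SigAndPiS n) T)

/-- `(T,U)` is a `C^B_n`-pair. -/
def CBpair (n : ℕ) (T U : Thy) : Prop :=
  Con (T ∪ ThIn (BSigmaS n) U)



/-! ### Models of PA -/

/-- A (bundled) model of `PA`. -/
structure PAM where
  carrier : Type
  [str : LA.Structure carrier]
  mod : carrier ⊨ PAAx

instance : CoeSort PAM Type := ⟨PAM.carrier⟩
instance (M : PAM) : LA.Structure M := M.str

def PAM.z (M : PAM) : M := Structure.funMap (show LA.Functions 0 from Unit.unit) ![]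
def PAM.s (M : PAM) (x : M) : M := Structure.funMap (show LA.Functions 1 from Unit.unit) ![x]
def PAM.a (M : PAM) (x y : M) : M := Structure.funMap (show LA.Functions 2 from false) ![x, y]
def PAM.m (M : PAM) (x y : M) : M := Structure.funMap (show LA.Functions 2 from true) ![x, y]
def PAM.l (M : PAM) (x y : M) : Prop :=
  Structure.RelMap (show LA.Relations 2 from Unit.unit) ![x, y]

instance (M : PAM) : Nonempty M := ⟨M.z⟩

section realize
variable {M : PAM} {α : Type} {n : ℕ}

@[simp] theorem realize_zeroT (w : α ⊕ Fin n → M) : (zeroT : LA.Term (α ⊕ Fin n)).realize w = M.z := by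
  simp only [zeroT, Constants.term, Term.realize, PAM.z]
  congr 1
  exact Subsingleton.elim _ _

@[simp] theorem realize_succT (w : α ⊕ Fin n → M) (t : LA.Term (α ⊕ Fin n)) :
    (succT t).realize w = M.s (t.realize w) := by
  exact Term.realize_functions_apply₁

@[simp] theorem realize_addT (w : α ⊕ Fin n → M) (t u : LA.Term (α ⊕ Fin n)) :
    (addT t u).realize w = M.a (t.realize w) (u.realize w) := by
  exact Term.realize_functions_apply₂

@[simp] theorem realize_mulT (w : α ⊕ Fin n → M) (t u : LA.Term (α ⊕ Fin n)) :
    (mulT t u).realize w = M.m (t.realize w) (u.realize w) := by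
  exact Term.realize_functions_apply₂

@[simp] theorem realize_leF (v : α → M) (xs : Fin n → M) (t u : LA.Term (α ⊕ Fin n)) :
    (leF t u).Realize v xs ↔ M.l (t.realize (Sum.elim v xs)) (u.realize (Sum.elim v xs)) := by
  exact BoundedFormula.realize_rel₂

@[simp] theorem realize_vT (w : Empty ⊕ Fin n → M) (i : Fin n) :
    (vT i).realize w = w (Sum.inr i) := by
  simp only [vT, Term.realize]
end realize

/-! ### Uniformly definable terms and relations -/

def DT (n : ℕ) (t : ∀ M : PAM, (Fin n → M) → M) : Prop :=
  ∃ τ : LA.Term (Empty ⊕ Fin n), ∀ (M : PAM) (v : Fin n → M),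
    τ.realize (Sum.elim default v) = t M v

def Df (n : ℕ) (R : ∀ M : PAM, (Fin n → M) → Prop) : Prop :=
  ∃ φ : LA.BoundedFormula Empty n, ∀ (M : PAM) (v : Fin n → M), φ.Realize default v ↔ R M v

def D0 (n : ℕ) (R : ∀ M : PAM, (Fin n → M) → Prop) : Prop :=
  ∃ φ : LA.BoundedFormula Empty n, IsDelta0 φ ∧
    ∀ (M : PAM) (v : Fin n → M), φ.Realize default v ↔ R M v

theorem D0.df {n} {R} (h : D0 n R) : Df n R := by
  obtain ⟨φ, _, h⟩ := h; exact ⟨φ, h⟩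

theorem DT.var {n} (i : Fin n) : DT n (fun _ v => v i) := ⟨vT i, fun M v => by simp⟩

theorem DT.z' {n} : DT n (fun M _ => M.z) := ⟨zeroT, fun M v => by simp⟩
theorem DT.s' {n} {t} (h : DT n t) : DT n (fun M v => M.s (t M v)) := by
  obtain ⟨τ, h⟩ := h; exact ⟨succT τ, fun M v => by simp [h]⟩
theorem DT.a' {n} {t u} (h : DT n t) (k : DT n u) : DT n (fun M v => M.a (t M v) (u M v)) := by
  obtain ⟨τ, h⟩ := h; obtain ⟨σ, k⟩ := k; exact ⟨addT τ σ, fun M v => by simp [h, k]⟩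
theorem DT.m' {n} {t u} (h : DT n t) (k : DT n u) : DT n (fun M v => M.m (t M v) (u M v)) := by
  obtain ⟨τ, h⟩ := h; obtain ⟨σ, k⟩ := k; exact ⟨mulT τ σ, fun M v => by simp [h, k]⟩

theorem realize_wk {M : PAM} {n : ℕ} (τ : LA.Term (Empty ⊕ Fin n)) (v : Fin (n + 1) → M) :
    (τ.relabel (Sum.map id Fin.castSucc)).realize (Sum.elim (default : Empty → M) v) =
      τ.realize (Sum.elim default (fun i => v i.castSucc)) := by
  rw [Term.realize_relabel]
  congr 1
  funext x
  rcases x with x | x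
  · exact x.elim
  · rfl

theorem DT.wk {n} {t} (h : DT n t) : DT (n + 1) (fun M v => t M (fun i => v i.castSucc)) := by
  obtain ⟨τ, h⟩ := h
  exact ⟨τ.relabel (Sum.map id Fin.castSucc), fun M v => by rw [realize_wk, h]⟩

theorem Df.imp {n} {A B} (h : Df n A) (k : Df n B) : Df n (fun M v => A M v → B M v) := by
  obtain ⟨φ, h⟩ := h; obtain ⟨ψ, k⟩ := k
  exact ⟨φ ⟹ ψ, fun M v => by simp [h, k]⟩
theorem Df.fls {n} : Df n (fun _ _ => False) := ⟨⊥, fun M v => by simp⟩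
theorem Df.congr {n} {A B} (h : Df n A) (e : ∀ M v, A M v ↔ B M v) : Df n B := by
  obtain ⟨φ, h⟩ := h; exact ⟨φ, fun M v => (h M v).trans (e M v)⟩
theorem Df.not {n} {A} (h : Df n A) : Df n (fun M v => ¬ A M v) := h.imp Df.fls
theorem Df.or {n} {A B} (h : Df n A) (k : Df n B) : Df n (fun M v => A M v ∨ B M v) :=
  (h.not.imp k).congr (fun _ _ => by tauto)
theorem Df.and {n} {A B} (h : Df n A) (k : Df n B) : Df n (fun M v => A M v ∧ B M v) :=
  (h.imp k.not).not.congr (fun _ _ => by tauto)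
theorem Df.iff {n} {A B} (h : Df n A) (k : Df n B) : Df n (fun M v => A M v ↔ B M v) :=
  ((h.imp k).and (k.imp h)).congr (fun _ _ => by tauto)
theorem Df.eq {n} {t u} (h : DT n t) (k : DT n u) : Df n (fun M v => t M v = u M v) := by
  obtain ⟨τ, h⟩ := h; obtain ⟨σ, k⟩ := k
  exact ⟨τ =' σ, fun M v => by simp [h, k]⟩
theorem Df.l' {n} {t u} (h : DT n t) (k : DT n u) : Df n (fun M v => M.l (t M v) (u M v)) := by
  obtain ⟨τ, h⟩ := h; obtain ⟨σ, k⟩ := k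
  exact ⟨leF τ σ, fun M v => by simp [h, k]⟩

theorem snoc_cs {M : Type} {n : ℕ} (v : Fin n → M) (x : M) :
    (fun i : Fin n => (Fin.snoc v x : Fin (n + 1) → M) i.castSucc) = v := by
  funext i; simp

theorem Df.all {n} {R : ∀ M : PAM, (Fin n → M) → M → Prop}
    (h : Df (n + 1) (fun M v => R M (fun i => v i.castSucc) (v (Fin.last n)))) :
    Df n (fun M v => ∀ x, R M v x) := by
  obtain ⟨φ, h⟩ := h
  exact ⟨∀' φ, fun M v => by simp [h]⟩
theorem Df.ex {n} {R : ∀ M : PAM, (Fin n → M) → M → Prop}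
    (h : Df (n + 1) (fun M v => R M (fun i => v i.castSucc) (v (Fin.last n)))) :
    Df n (fun M v => ∃ x, R M v x) := by
  obtain ⟨φ, h⟩ := h
  exact ⟨∃' φ, fun M v => by simp [h]⟩

/-! ### PA axioms in a model -/
section ax
variable (M : PAM)

theorem PAM.ax {φ : Snt} (h : φ ∈ PAAx) : M ⊨ φ := M.mod.realize_of_mem φ h

theorem PAM.s_ne (x : M) : M.s x ≠ M.z := by
  have := M.ax (φ := ∀' ∼(succT (vT 0) =' zeroT)) (by simp [PAAx])
  simp [Sentence.Realize, Formula.Realize, Fin.snoc] at this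
  exact this x

theorem PAM.s_inj (x y : M) (h : M.s x = M.s y) : x = y := by
  have := M.ax (φ := ∀' ∀' ((succT (vT 0) =' succT (vT 1)) ⟹ (vT 0 =' vT 1))) (by simp [PAAx])
  simp [Sentence.Realize, Formula.Realize, Fin.snoc] at this
  exact this x y h
theorem PAM.a_z (x : M) : M.a x M.z = x := by
  have := M.ax (φ := ∀' (addT (vT 0) zeroT =' vT 0)) (by simp [PAAx])
  simp [Sentence.Realize, Formula.Realize, Fin.snoc] at this
  exact this x
theorem PAM.a_s (x y : M) : M.a x (M.s y) = M.s (M.a x y) := by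
  have := M.ax (φ := ∀' ∀' (addT (vT 0) (succT (vT 1)) =' succT (addT (vT 0) (vT 1)))) (by simp [PAAx])
  simp [Sentence.Realize, Formula.Realize, Fin.snoc] at this
  exact this x y
theorem PAM.m_z (x : M) : M.m x M.z = M.z := by
  have := M.ax (φ := ∀' (mulT (vT 0) zeroT =' zeroT)) (by simp [PAAx])
  simp [Sentence.Realize, Formula.Realize, Fin.snoc] at this
  exact this x
theorem PAM.m_s (x y : M) : M.m x (M.s y) = M.a (M.m x y) x := by
  have := M.ax (φ := ∀' ∀' (mulT (vT 0) (succT (vT 1)) =' addT (mulT (vT 0) (vT 1)) (vT 0))) (by simp [PAAx])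
  simp [Sentence.Realize, Formula.Realize, Fin.snoc] at this
  exact this x y
theorem PAM.l_iff (x y : M) : M.l x y ↔ ∃ w, M.a w x = y := by
  have := M.ax (φ := ∀' ∀' (leF (vT 0) (vT 1) ⇔ ∃' (addT (vT 2) (vT 0) =' vT 1))) (by simp [PAAx])
  simp [Sentence.Realize, Formula.Realize, Fin.snoc] at this
  exact this x y

theorem PAM.ind' {k} (φ : LA.BoundedFormula Empty (k + 1)) (p : Fin k → M)
    (h0 : φ.Realize default (Fin.snoc p M.z : Fin (k + 1) → M))
    (hs : ∀ x, φ.Realize default (Fin.snoc p x : Fin (k + 1) → M) →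
      φ.Realize default (Fin.snoc p (M.s x) : Fin (k + 1) → M)) (x : M) :
    φ.Realize default (Fin.snoc p x : Fin (k + 1) → M) := by
  have := M.ax (φ := indAxiom φ) (Or.inr ⟨k, φ, rfl⟩)
  simp only [indAxiom, Sentence.Realize, BoundedFormula.realize_alls] at this
  have := this p
  simp only [BoundedFormula.realize_imp, BoundedFormula.realize_inf, BoundedFormula.realize_all,
    BoundedFormula.realize_bdEqual, realize_vT, realize_zeroT, realize_succT, Sum.elim_inr,
    Fin.snoc_last, Fin.snoc_castSucc] at this
  refine this ⟨?_, ?_⟩ x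
  · rintro x rfl; exact h0
  · rintro x hx y rfl
    rw [BoundedFormula.realize_liftAt (by omega)]
    convert hs x hx using 1
    funext i
    simp only [Function.comp]
    refine Fin.lastCases ?_ (fun j => ?_) i
    · simp [Fin.snoc]
    · simp [Fin.snoc]

theorem PAM.ind0 {k} {P : ∀ M : PAM, (Fin k → M) → M → Prop} (p : Fin k → M)
    (h : Df (k + 1) (fun M v => P M (fun i => v i.castSucc) (v (Fin.last k))))
    (h0 : P M p M.z) (hs : ∀ x, P M p x → P M p (M.s x)) (x : M) : P M p x := by
  obtain ⟨φ, h⟩ := h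
  have key : ∀ x, φ.Realize default (Fin.snoc p x : Fin (k + 1) → M) ↔ P M p x := by
    intro x; rw [h]; simp
  rw [← key]
  exact M.ind' φ p ((key _).2 h0) (fun x hx => (key _).2 (hs x ((key _).1 hx))) x

theorem PAM.z_a (x : M) : M.a M.z x = x := by
  refine M.ind0 (k := 0) (P := fun M v x => M.a M.z x = x) ![] ?_ ?_ ?_ x
  · exact Df.eq (DT.z'.a' (.var _)) (.var _)
  · exact M.a_z _
  · intro x hx; rw [M.a_s, hx]
theorem PAM.s_a (x y : M) : M.a (M.s x) y = M.s (M.a x y) := by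
  refine M.ind0 (P := fun M v y => M.a (M.s (v 0)) y = M.s (M.a (v 0) y)) ![x] ?_ ?_ ?_ y
  · exact Df.eq (.a' (.s' (.var _)) (.var _)) (.s' (.a' (.var _) (.var _)))
  · simp [M.a_z]
  · intro x hx; rw [M.a_s, hx, M.a_s]
theorem PAM.a_comm (x y : M) : M.a x y = M.a y x := by
  refine M.ind0 (P := fun M v y => M.a (v 0) y = M.a y (v 0)) ![x] ?_ ?_ ?_ y
  · exact Df.eq ((.a' (.var _) (.var _))) ((.a' (.var _) (.var _)))
  · simp [M.a_z, M.z_a]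
  · intro x hx; rw [M.a_s, hx, M.s_a]
theorem PAM.a_assoc (x y z : M) : M.a (M.a x y) z = M.a x (M.a y z) := by
  refine M.ind0 (P := fun M v z => M.a (M.a (v 0) (v 1)) z = M.a (v 0) (M.a (v 1) z)) ![x, y] ?_ ?_ ?_ z
  · exact Df.eq (.a' (.a' (.var _) (.var _)) (.var _)) (.a' (.var _) (.a' (.var _) (.var _)))
  · simp [M.a_z]
  · intro x hx; rw [M.a_s, hx, M.a_s, M.a_s]
theorem PAM.z_m (x : M) : M.m M.z x = M.z := by
  refine M.ind0 (k := 0) (P := fun M v x => M.m M.z x = M.z) ![] ?_ ?_ ?_ x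
  · exact Df.eq (DT.z'.m' (.var _)) DT.z'
  · exact M.m_z _
  · intro x hx; rw [M.m_s, hx, M.a_z]
theorem PAM.s_m (x y : M) : M.m (M.s x) y = M.a (M.m x y) y := by
  refine M.ind0 (P := fun M v y => M.m (M.s (v 0)) y = M.a (M.m (v 0) y) y) ![x] ?_ ?_ ?_ y
  · exact Df.eq (.m' (.s' (.var _)) (.var _)) (.a' (.m' (.var _) (.var _)) (.var _))
  · simp [M.a_z, M.m_z]
  · intro x hx
    rw [M.m_s, hx, M.m_s, M.a_s, M.a_s, M.a_assoc, M.a_assoc, M.a_comm x]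
theorem PAM.m_comm (x y : M) : M.m x y = M.m y x := by
  refine M.ind0 (P := fun M v y => M.m (v 0) y = M.m y (v 0)) ![x] ?_ ?_ ?_ y
  · exact Df.eq ((.m' (.var _) (.var _))) ((.m' (.var _) (.var _)))
  · simp [M.m_z, M.z_m]
  · intro x hx; rw [M.m_s, hx, M.s_m]
theorem PAM.m_add (x y z : M) : M.m x (M.a y z) = M.a (M.m x y) (M.m x z) := by
  refine M.ind0 (P := fun M v z => M.m (v 0) (M.a (v 1) z) = M.a (M.m (v 0) (v 1)) (M.m (v 0) z)) ![x, y] ?_ ?_ ?_ z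
  · exact Df.eq (.m' (.var _) (.a' (.var _) (.var _))) (.a' (.m' (.var _) (.var _)) (.m' (.var _) (.var _)))
  · simp [M.a_z, M.m_z]
  · intro x hx; rw [M.a_s, M.m_s, hx, M.m_s, M.a_assoc]
theorem PAM.m_assoc (x y z : M) : M.m (M.m x y) z = M.m x (M.m y z) := by
  refine M.ind0 (P := fun M v z => M.m (M.m (v 0) (v 1)) z = M.m (v 0) (M.m (v 1) z)) ![x, y] ?_ ?_ ?_ z
  · exact Df.eq (.m' (.m' (.var _) (.var _)) (.var _)) (.m' (.var _) (.m' (.var _) (.var _)))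
  · simp [M.m_z]
  · intro x hx; rw [M.m_s, hx, M.m_s, M.m_add]
theorem PAM.a_cancel (x y z : M) : M.a x z = M.a y z → x = y := by
  refine M.ind0 (P := fun M v z => M.a (v 0) z = M.a (v 1) z → v 0 = v 1) ![x, y] ?_ ?_ ?_ z
  · exact .imp (Df.eq (.a' (.var _) (.var _)) (.a' (.var _) (.var _))) (.eq (.var _) (.var _))
  · simp [M.a_z]
  · intro x hx h; rw [M.a_s, M.a_s] at h; exact hx (M.s_inj _ _ h)
theorem PAM.z_or_s (x : M) : x = M.z ∨ ∃ y, x = M.s y := by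
  refine M.ind0 (k := 0) (P := fun M v x => x = M.z ∨ ∃ y, x = M.s y) ![] ?_ ?_ ?_ x
  · exact .or (.eq (.var _) .z') (.ex (.eq (.var _) (.s' (.var _))))
  · exact Or.inl rfl
  · intro x _; exact Or.inr ⟨x, rfl⟩
theorem PAM.l_total (x y : M) : M.l x y ∨ M.l y x := by
  refine M.ind0 (P := fun M v y => M.l (v 0) y ∨ M.l y (v 0)) ![x] ?_ ?_ ?_ y
  · exact .or (.l' (.var _) (.var _)) (.l' (.var _) (.var _))
  · right; rw [M.l_iff]; exact ⟨x, M.a_z x⟩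
  · intro y h
    rcases h with h | h
    · left; rw [M.l_iff] at *; obtain ⟨w, h⟩ := h; exact ⟨M.s w, by rw [M.s_a, h]⟩
    · rw [M.l_iff] at h; obtain ⟨w, h⟩ := h
      rcases M.z_or_s w with rfl | ⟨w, rfl⟩
      · left; rw [M.l_iff]; rw [M.z_a] at h; exact ⟨M.s M.z, by rw [M.s_a, M.z_a, h]⟩
      · right; rw [M.l_iff]; exact ⟨w, by rw [M.a_s, ← M.s_a]; exact h⟩
theorem PAM.a_eq_z (x y : M) (h : M.a x y = M.z) : y = M.z := by
  rcases M.z_or_s y with rfl | ⟨w, rfl⟩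
  · rfl
  · rw [M.a_s] at h; exact absurd h (M.s_ne _)
theorem PAM.l_antisymm (x y : M) (h : M.l x y) (k : M.l y x) : x = y := by
  rw [M.l_iff] at h k
  obtain ⟨w, rfl⟩ := h
  obtain ⟨w', k⟩ := k
  rw [← M.a_assoc] at k
  have := M.a_cancel (M.a w' w) M.z x (by rw [k, M.z_a])
  have := M.a_eq_z _ _ this
  rw [this, M.z_a]
end ax

instance (M : PAM) : Zero M := ⟨M.z⟩
instance (M : PAM) : One M := ⟨M.s M.z⟩
instance (M : PAM) : Add M := ⟨M.a⟩
instance (M : PAM) : Mul M := ⟨M.m⟩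
instance (M : PAM) : LE M := ⟨M.l⟩

theorem PAM.z_eq (M : PAM) : M.z = 0 := rfl
theorem PAM.a_eq (M : PAM) (x y) : M.a x y = x + y := rfl
theorem PAM.m_eq (M : PAM) (x y) : M.m x y = x * y := rfl
theorem PAM.l_eq (M : PAM) (x y) : M.l x y ↔ x ≤ y := Iff.rfl
theorem PAM.s_eq (M : PAM) (x) : M.s x = x + 1 := by
  change _ = M.a x (M.s M.z); rw [M.a_s, M.a_z]

instance instCSM (M : PAM) : CommSemiring M where
  add_assoc := M.a_assoc
  zero_add := M.z_a
  add_zero := M.a_z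
  add_comm := M.a_comm
  left_distrib := M.m_add
  right_distrib x y z := by
    change M.m (M.a x y) z = M.a (M.m x z) (M.m y z)
    rw [M.m_comm, M.m_add, M.m_comm z x, M.m_comm z y]
  zero_mul := M.z_m
  mul_zero := M.m_z
  mul_assoc := M.m_assoc
  one_mul x := by change M.m (M.s M.z) x = x; rw [M.s_m, M.z_m, M.z_a]
  mul_one x := by change M.m x (M.s M.z) = x; rw [M.m_s, M.m_z, M.z_a]
  mul_comm := M.m_comm
  nsmul := nsmulRec

theorem PAM.le_iff {M : PAM} (x y : M) : x ≤ y ↔ ∃ w, w + x = y := M.l_iff x y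

noncomputable instance instLOM (M : PAM) : LinearOrder M where
  le_refl x := (PAM.le_iff x x).2 ⟨0, zero_add x⟩
  le_trans x y z h k := by
    rw [PAM.le_iff] at *
    obtain ⟨w, rfl⟩ := h; obtain ⟨w', rfl⟩ := k
    exact ⟨w' + w, by ring⟩
  le_antisymm := M.l_antisymm
  le_total := M.l_total
  toDecidableLE := Classical.decRel _

theorem PAM.add_cancel {M : PAM} {x y z : M} (h : x + z = y + z) : x = y := M.a_cancel x y z h

instance instCOM (M : PAM) : CanonicallyOrderedAdd M where
  exists_add_of_le {a b} h := by
    obtain ⟨w, h⟩ := (PAM.le_iff a b).1 h; exact ⟨w, by rw [← h, add_comm]⟩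
  le_add_self a b := (PAM.le_iff _ _).2 ⟨b, rfl⟩
  le_self_add a b := (PAM.le_iff _ _).2 ⟨b, add_comm _ _⟩

theorem PAM.lt_iff {M : PAM} (x y : M) : x < y ↔ x + 1 ≤ y := by
  constructor
  · intro h
    obtain ⟨w, rfl⟩ := (PAM.le_iff _ _).1 h.le
    rcases M.z_or_s w with rfl | ⟨w, rfl⟩
    · exact absurd h (by rw [M.z_eq, zero_add]; exact lt_irrefl _)
    · rw [M.s_eq]; exact (PAM.le_iff _ _).2 ⟨w, by ring⟩
  · intro h
    obtain ⟨w, rfl⟩ := (PAM.le_iff _ _).1 h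
    refine lt_of_le_of_ne ((PAM.le_iff _ _).2 ⟨w + 1, by ring⟩) ?_
    intro h
    have : (0 : M) = w + 1 := PAM.add_cancel (z := x) (by rw [zero_add]; exact h.trans (by ring))
    exact M.s_ne w (by rw [M.s_eq]; exact this.symm)

theorem PAM.pos_one {M : PAM} : (0 : M) < 1 := by rw [PAM.lt_iff, zero_add]

theorem PAM.add_le {M : PAM} {x y : M} (h : x ≤ y) (z : M) : z + x ≤ z + y := by
  obtain ⟨w, rfl⟩ := (PAM.le_iff _ _).1 h
  exact (PAM.le_iff _ _).2 ⟨w, by ring⟩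

instance instOCM (M : PAM) : IsOrderedCancelAddMonoid M where
  add_le_add_left a b h c := by rw [add_comm a, add_comm b]; exact PAM.add_le h c
  le_of_add_le_add_left a b c h := by
    obtain ⟨w, h⟩ := (PAM.le_iff _ _).1 h
    refine (PAM.le_iff _ _).2 ⟨w, PAM.add_cancel (z := a) ?_⟩
    rw [add_comm c, ← h]; ring

theorem PAM.mul_lt {M : PAM} (a b c : M) (h : a < b) (hc : 0 < c) : c * a < c * b := by
  rw [PAM.lt_iff] at *
  obtain ⟨w, rfl⟩ := (PAM.le_iff _ _).1 h
  rw [zero_add] at hc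
  calc c * a + 1 ≤ c * a + c := by gcongr
    _ ≤ c * w + (c * a + c) := le_add_self
    _ = _ := by ring

instance instSOM (M : PAM) : IsStrictOrderedRing M where
  exists_pair_ne := ⟨0, 1, PAM.pos_one.ne⟩
  zero_le_one := PAM.pos_one.le
  mul_lt_mul_of_pos_left a ha b c h := PAM.mul_lt _ _ _ h ha
  mul_lt_mul_of_pos_right a ha b c h := by
    simp only [mul_comm _ a]; exact PAM.mul_lt _ _ _ h ha

theorem PAM.lt_succ {M : PAM} (x y : M) : x < y + 1 ↔ x ≤ y := by
  rw [PAM.lt_iff]; exact add_le_add_iff_right 1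

theorem PAM.ind (M : PAM) {k} {P : ∀ M : PAM, (Fin k → M) → M → Prop} (p : Fin k → M)
    (h : Df (k + 1) (fun M v => P M (fun i => v i.castSucc) (v (Fin.last k))))
    (h0 : P M p 0) (hs : ∀ x, P M p x → P M p (x + 1)) (x : M) : P M p x :=
  M.ind0 p h h0 (fun x hx => by rw [M.s_eq]; exact hs x hx) x

theorem PAM.std {M : PAM} (n : ℕ) (x : M) (h : x ≤ (n : M)) : ∃ k ≤ n, x = (k : M) := by
  induction n with
  | zero => exact ⟨0, le_rfl, by simpa using h⟩
  | succ n ih =>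
    rcases lt_or_eq_of_le h with h | h
    · push_cast at h; rw [PAM.lt_succ] at h
      obtain ⟨k, hk, e⟩ := ih h; exact ⟨k, by omega, e⟩
    · exact ⟨n + 1, le_rfl, h⟩

/-! definability with the usual operations -/
theorem DT.zero {n} : DT n (fun _ _ => 0) := DT.z'
theorem DT.one {n} : DT n (fun _ _ => 1) := DT.s' DT.z'
theorem DT.add {n} {t u} (h : DT n t) (k : DT n u) : DT n (fun M v => t M v + u M v) := h.a' k
theorem DT.mul {n} {t u} (h : DT n t) (k : DT n u) : DT n (fun M v => t M v * u M v) := h.m' k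
theorem DT.num {n} (c : ℕ) : DT n (fun _ _ => (c : _)) := by
  induction c with
  | zero => simpa using DT.zero
  | succ c ih => simpa using ih.add DT.one
theorem Df.le {n} {t u} (h : DT n t) (k : DT n u) : Df n (fun M v => t M v ≤ u M v) := Df.l' h k
theorem Df.lt {n} {t u} (h : DT n t) (k : DT n u) : Df n (fun M v => t M v < u M v) :=
  (Df.le k h).not.congr (fun _ _ => not_le)

theorem D0.imp {n} {A B} (h : D0 n A) (k : D0 n B) : D0 n (fun M v => A M v → B M v) := by
  obtain ⟨φ, h', h⟩ := h; obtain ⟨ψ, k', k⟩ := k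
  exact ⟨φ ⟹ ψ, .imp h' k', fun M v => by simp [h, k]⟩
theorem D0.fls {n} : D0 n (fun _ _ => False) := ⟨⊥, .falsum, fun M v => by simp⟩
theorem D0.congr {n} {A B} (h : D0 n A) (e : ∀ M v, A M v ↔ B M v) : D0 n B := by
  obtain ⟨φ, h', h⟩ := h; exact ⟨φ, h', fun M v => (h M v).trans (e M v)⟩
theorem D0.not {n} {A} (h : D0 n A) : D0 n (fun M v => ¬ A M v) := h.imp D0.fls
theorem D0.or {n} {A B} (h : D0 n A) (k : D0 n B) : D0 n (fun M v => A M v ∨ B M v) :=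
  (h.not.imp k).congr (fun _ _ => by tauto)
theorem D0.and {n} {A B} (h : D0 n A) (k : D0 n B) : D0 n (fun M v => A M v ∧ B M v) :=
  (h.imp k.not).not.congr (fun _ _ => by tauto)
theorem D0.eq {n} {t u} (h : DT n t) (k : DT n u) : D0 n (fun M v => t M v = u M v) := by
  obtain ⟨τ, h⟩ := h; obtain ⟨σ, k⟩ := k
  exact ⟨τ =' σ, .equal _ _, fun M v => by simp [h, k]⟩
theorem D0.le {n} {t u} (h : DT n t) (k : DT n u) : D0 n (fun M v => t M v ≤ u M v) := by
  obtain ⟨τ, h⟩ := h; obtain ⟨σ, k⟩ := k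
  exact ⟨leF τ σ, .le _ _, fun M v => by simp [h, k, PAM.l_eq]⟩
theorem D0.lt {n} {t u} (h : DT n t) (k : DT n u) : D0 n (fun M v => t M v < u M v) :=
  (D0.le k h).not.congr (fun _ _ => not_le)
theorem D0.ball {n} {t} {R : ∀ M : PAM, (Fin n → M) → M → Prop} (ht : DT n t)
    (h : D0 (n + 1) (fun M v => R M (fun i => v i.castSucc) (v (Fin.last n)))) :
    D0 n (fun M v => ∀ x ≤ t M v, R M v x) := by
  obtain ⟨φ, h', h⟩ := h
  obtain ⟨τ, ht⟩ := ht
  refine ⟨_, .ball τ h', fun M v => ?_⟩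
  simp [h, realize_wk, ht, PAM.l_eq, -Term.realize_relabel]
theorem D0.bex {n} {t} {R : ∀ M : PAM, (Fin n → M) → M → Prop} (ht : DT n t)
    (h : D0 (n + 1) (fun M v => R M (fun i => v i.castSucc) (v (Fin.last n)))) :
    D0 n (fun M v => ∃ x ≤ t M v, R M v x) := by
  obtain ⟨φ, h', h⟩ := h
  obtain ⟨τ, ht⟩ := ht
  refine ⟨_, .bex τ h', fun M v => ?_⟩
  simp [h, realize_wk, ht, PAM.l_eq, -Term.realize_relabel]

/-! ### the standard model and absoluteness -/
@[reducible] def natStr : LA.Structure ℕ where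
  funMap {n} f x := match n, f, x with
    | 0, _, _ => 0
    | 1, _, x => x 0 + 1
    | 2, b, x => (match (b : Bool) with | false => x 0 + x 1 | true => x 0 * x 1)
  RelMap {n} f x := match n, f, x with
    | 2, _, x => x 0 ≤ x 1

section nat
attribute [local instance] natStr
variable {α : Type} {n : ℕ}

theorem nrealize_zeroT (w : α ⊕ Fin n → ℕ) : (zeroT : LA.Term (α ⊕ Fin n)).realize w = 0 := rfl
theorem nrealize_succT (w : α ⊕ Fin n → ℕ) (t : LA.Term (α ⊕ Fin n)) :
    (succT t).realize w = t.realize w + 1 := Term.realize_functions_apply₁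
theorem nrealize_addT (w : α ⊕ Fin n → ℕ) (t u : LA.Term (α ⊕ Fin n)) :
    (addT t u).realize w = t.realize w + u.realize w := Term.realize_functions_apply₂
theorem nrealize_mulT (w : α ⊕ Fin n → ℕ) (t u : LA.Term (α ⊕ Fin n)) :
    (mulT t u).realize w = t.realize w * u.realize w := Term.realize_functions_apply₂
theorem nrealize_leF (v : α → ℕ) (xs : Fin n → ℕ) (t u : LA.Term (α ⊕ Fin n)) :
    (leF t u).Realize v xs ↔ t.realize (Sum.elim v xs) ≤ u.realize (Sum.elim v xs) :=
  BoundedFormula.realize_rel₂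
theorem nrealize_vT (w : Empty ⊕ Fin n → ℕ) (i : Fin n) :
    (vT i).realize w = w (Sum.inr i) := by
  simp only [vT, Term.realize]

theorem nat_mod : ℕ ⊨ PAAx := by
  rw [Theory.model_iff]
  intro φ hφ
  rcases hφ with h | ⟨k, ψ, rfl⟩
  · simp only [Set.mem_insert_iff, Set.mem_singleton_iff] at h
    rcases h with rfl | rfl | rfl | rfl | rfl | rfl | rfl <;>
    simp [Sentence.Realize, Formula.Realize, Fin.snoc, nrealize_zeroT, nrealize_succT,
      nrealize_addT, nrealize_mulT, nrealize_leF, nrealize_vT, mul_add, add_assoc]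
    intro a b
    constructor
    · intro h; exact ⟨b - a, by omega⟩
    · rintro ⟨c, h⟩; omega
  · simp only [indAxiom, Sentence.Realize, BoundedFormula.realize_alls]
    intro p
    simp only [BoundedFormula.realize_imp, BoundedFormula.realize_inf, BoundedFormula.realize_all,
      BoundedFormula.realize_bdEqual, nrealize_vT, nrealize_zeroT, nrealize_succT, Sum.elim_inr,
      Fin.snoc_last, Fin.snoc_castSucc]
    rintro ⟨h0, hs⟩ x
    induction x with
    | zero => exact h0 0 rfl
    | succ x ih =>
      have := hs x ih (x + 1) rfl
      rw [BoundedFormula.realize_liftAt (by omega)] at this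
      convert this using 1
      funext i
      simp only [Function.comp]
      refine Fin.lastCases ?_ (fun j => ?_) i
      · simp [Fin.snoc]
      · simp [Fin.snoc]
end nat

@[reducible] def NN : PAM := @PAM.mk ℕ natStr nat_mod

theorem NN_z : NN.z = (0 : ℕ) := rfl
theorem NN_s (x : ℕ) : NN.s x = (x + 1 : ℕ) := rfl
theorem NN_a (x y : ℕ) : NN.a x y = (x + y : ℕ) := rfl
theorem NN_m (x y : ℕ) : NN.m x y = (x * y : ℕ) := rfl
theorem NN_l (x y : ℕ) : NN.l x y ↔ (x ≤ y : Prop) := Iff.rfl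

section nat2
attribute [local instance] natStr

theorem term_abs (M : PAM) {n} (t : LA.Term (Empty ⊕ Fin n)) (v : Fin n → ℕ) :
    t.realize (Sum.elim default (fun i => (v i : M)) : _ → M) =
      ((@Term.realize LA ℕ natStr _ (Sum.elim default v) t : ℕ) : M) := by
  induction t with
  | var x => rcases x with x | x; exact x.elim; rfl
  | @func l f ts ih =>
    match l, f, ts, ih with
    | 0, f, ts, ih =>
      have e : (Term.func f ts : LA.Term (Empty ⊕ Fin n)) = zeroT := by
        simp only [zeroT, Constants.term]; congr 1; exact Subsingleton.elim _ _
      rw [e, nrealize_zeroT, realize_zeroT]; exact Nat.cast_zero.symm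
    | 1, f, ts, ih =>
      have e : (Term.func f ts : LA.Term (Empty ⊕ Fin n)) = succT (ts 0) := by
        simp only [succT, Functions.apply₁]; congr 1
        funext i; fin_cases i; rfl
      rw [e, nrealize_succT, realize_succT, ih, PAM.s_eq]; push_cast; rfl
    | 2, false, ts, ih =>
      have e : (Term.func (show LA.Functions 2 from false) ts : LA.Term (Empty ⊕ Fin n)) = addT (ts 0) (ts 1) := by
        simp only [addT, Functions.apply₂]; congr 1
        funext i; fin_cases i <;> rfl
      rw [e, nrealize_addT, realize_addT, ih, ih, PAM.a_eq]; push_cast; rfl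
    | 2, true, ts, ih =>
      have e : (Term.func (show LA.Functions 2 from true) ts : LA.Term (Empty ⊕ Fin n)) = mulT (ts 0) (ts 1) := by
        simp only [mulT, Functions.apply₂]; congr 1
        funext i; fin_cases i <;> rfl
      rw [e, nrealize_mulT, realize_mulT, ih, ih, PAM.m_eq]; push_cast; rfl
    | (l + 3), f, ts, ih => exact f.elim

theorem cast_snoc (M : PAM) {n} (v : Fin n → ℕ) (x : ℕ) :
    (Fin.snoc (fun i => (v i : M)) (x : M) : Fin (n + 1) → M) =
      fun i => (((Fin.snoc v x : Fin (n + 1) → ℕ) i : ℕ) : M) := by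
  funext i
  refine Fin.lastCases ?_ (fun j => ?_) i <;> simp

theorem delta0_abs (M : PAM) {n} {φ : LA.BoundedFormula Empty n} (h : IsDelta0 φ) (v : Fin n → ℕ) :
    φ.Realize (M := M) default (fun i => (v i : M)) ↔
      @BoundedFormula.Realize LA ℕ natStr _ _ φ default v := by
  induction h with
  | falsum => exact Iff.rfl
  | equal t u =>
    rw [BoundedFormula.realize_bdEqual, term_abs, term_abs]
    exact Nat.cast_inj
  | le t u =>
    rw [realize_leF, nrealize_leF, term_abs, term_abs, PAM.l_eq, Nat.cast_le]
  | imp _ _ ih1 ih2 =>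
    rw [BoundedFormula.realize_imp, BoundedFormula.realize_imp, ih1, ih2]
  | ball t _ ih =>
    rw [BoundedFormula.realize_all, BoundedFormula.realize_all]
    have key : ∀ x : ℕ, (leF (vT (Fin.last _)) (t.relabel (Sum.map id Fin.castSucc))).Realize (M := M)
        default (Fin.snoc (fun i => (v i : M)) (x : M)) ↔ @BoundedFormula.Realize LA ℕ natStr _ _
          (leF (vT (Fin.last _)) (t.relabel (Sum.map id Fin.castSucc))) default (Fin.snoc v x) := by
      intro x
      rw [cast_snoc, realize_leF, nrealize_leF, term_abs, term_abs, PAM.l_eq, Nat.cast_le]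
    constructor
    · intro h x
      have := h x
      rw [BoundedFormula.realize_imp, key, cast_snoc, ih] at this
      exact this
    · intro h x
      rw [BoundedFormula.realize_imp]
      intro hx
      obtain ⟨k, rfl⟩ : ∃ k : ℕ, x = k := by
        have hx' := hx
        rw [realize_leF, realize_wk, snoc_cs, term_abs, PAM.l_eq] at hx'
        simp at hx'
        obtain ⟨k, _, e⟩ := PAM.std _ _ hx'; exact ⟨k, e⟩
      rw [key] at hx
      rw [cast_snoc, ih]
      exact h k hx
  | bex t _ ih =>
    rw [BoundedFormula.realize_ex, BoundedFormula.realize_ex]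
    have key : ∀ x : ℕ, (leF (vT (Fin.last _)) (t.relabel (Sum.map id Fin.castSucc))).Realize (M := M)
        default (Fin.snoc (fun i => (v i : M)) (x : M)) ↔ @BoundedFormula.Realize LA ℕ natStr _ _
          (leF (vT (Fin.last _)) (t.relabel (Sum.map id Fin.castSucc))) default (Fin.snoc v x) := by
      intro x
      rw [cast_snoc, realize_leF, nrealize_leF, term_abs, term_abs, PAM.l_eq, Nat.cast_le]
    constructor
    · rintro ⟨x, h⟩
      rw [BoundedFormula.realize_inf] at h
      obtain ⟨hx, h⟩ := h
      obtain ⟨k, rfl⟩ : ∃ k : ℕ, x = k := by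
        have hx' := hx
        rw [realize_leF, realize_wk, snoc_cs, term_abs, PAM.l_eq] at hx'
        simp at hx'
        obtain ⟨k, _, e⟩ := PAM.std _ _ hx'; exact ⟨k, e⟩
      refine ⟨k, ?_⟩
      rw [BoundedFormula.realize_inf]
      rw [key] at hx
      rw [cast_snoc, ih] at h
      exact ⟨hx, h⟩
    · rintro ⟨k, h⟩
      rw [BoundedFormula.realize_inf] at h
      refine ⟨k, ?_⟩
      rw [BoundedFormula.realize_inf, key, cast_snoc, ih]
      exact h

end nat2

theorem D0.abs {n} {R} (h : D0 n R) (M : PAM) (v : Fin n → ℕ) :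
    R M (fun i => (v i : M)) ↔ R NN v := by
  obtain ⟨φ, h', h⟩ := h
  rw [← h, ← h NN]
  have := delta0_abs M h' v
  rw [this]
  exact iff_of_eq (by congr 1; exact Subsingleton.elim _ _)

/-! ### Substitution in definable relations -/
theorem Df.subst {n m : ℕ} {R} (h : Df n R) {t : Fin n → ∀ M : PAM, (Fin m → M) → M}
    (ht : ∀ i, DT m (t i)) : Df m (fun M v => R M (fun i => t i M v)) := by
  obtain ⟨φ, h⟩ := h
  choose τ hτ using ht
  let ψ : LA.Formula (Empty ⊕ Fin m) := BoundedFormula.subst φ.toFormula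
    (Sum.elim (fun x : Empty => x.elim) τ)
  refine ⟨(BoundedFormula.relabel (id : Empty ⊕ Fin m → Empty ⊕ Fin m) ψ : LA.BoundedFormula Empty (m + 0)), ?_⟩
  intro M v
  have e1 := BoundedFormula.realize_relabel (M := M) (φ := ψ) (g := (id : Empty ⊕ Fin m → Empty ⊕ Fin m))
    (v := default) (xs := (v : Fin (m + 0) → M))
  refine e1.trans ?_
  rw [BoundedFormula.realize_subst]
  beta_reduce
  rw [← h]
  have e2 := BoundedFormula.realize_toFormula (M := M) φ
    (fun a => Term.realize (Sum.elim default (v ∘ Fin.castAdd 0) ∘ id) (Sum.elim (fun x : Empty => x.elim) τ a))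
  unfold Formula.Realize at e2
  convert e2 using 2
  funext i
  simp only [Function.comp, Sum.elim_inr]
  rw [← hτ]
  rfl

/-! ### pairing -/
section arith
variable {M : PAM}

theorem le_sq (x : M) : x ≤ x * x := by
  rcases eq_or_ne x 0 with rfl | h
  · simp
  · have : 1 ≤ x := by
      have := (PAM.lt_iff 0 x).1 (pos_iff_ne_zero.2 h); simpa using this
    calc x = x * 1 := by ring
      _ ≤ x * x := by gcongr

/-- pairing function -/
def pr (a b : M) : M := (a + b) * (a + b) + a

theorem le_pr_left (a b : M) : a ≤ pr a b := le_add_self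
theorem le_pr_right (a b : M) : b ≤ pr a b :=
  calc b ≤ a + b := le_add_self
    _ ≤ (a + b) * (a + b) := le_sq _
    _ ≤ _ := le_self_add

theorem pr_lt (a b c d : M) (h : a + b < c + d) : pr a b < pr c d := by
  rw [PAM.lt_iff] at h ⊢
  unfold pr
  calc (a + b) * (a + b) + a + 1 ≤ (a + b) * (a + b) + a + 1 + (a + b + b) := le_self_add
    _ = (a + b + 1) * (a + b + 1) := by ring
    _ ≤ (c + d) * (c + d) := by gcongr
    _ ≤ _ := le_self_add

theorem pr_inj {a b c d : M} : pr a b = pr c d ↔ a = c ∧ b = d := by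
  constructor
  · intro h
    rcases lt_trichotomy (a + b) (c + d) with h' | h' | h'
    · exact absurd h (pr_lt _ _ _ _ h').ne
    · unfold pr at h
      rw [h'] at h
      have := add_left_cancel h
      subst this
      exact ⟨rfl, add_left_cancel h'⟩
    · exact absurd h (pr_lt _ _ _ _ h').ne'
  · rintro ⟨rfl, rfl⟩; rfl

open Classical in
noncomputable def fst (s : M) : M := if h : ∃ a b, s = pr a b then h.choose else 0
open Classical in
noncomputable def snd (s : M) : M := if h : ∃ a b, s = pr a b then h.choose_spec.choose else 0

@[simp] theorem fst_pr (a b : M) : fst (pr a b) = a := by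
  have h : ∃ c d, pr a b = pr c d := ⟨a, b, rfl⟩
  unfold fst; rw [dif_pos h]
  exact (pr_inj.1 h.choose_spec.choose_spec).1.symm
@[simp] theorem snd_pr (a b : M) : snd (pr a b) = b := by
  have h : ∃ c d, pr a b = pr c d := ⟨a, b, rfl⟩
  unfold snd; rw [dif_pos h]
  exact (pr_inj.1 h.choose_spec.choose_spec).2.symm
theorem fst_of_not (s : M) (h : ¬ ∃ a b, s = pr a b) : fst s = 0 := by
  unfold fst; rw [dif_neg h]
theorem snd_of_not (s : M) (h : ¬ ∃ a b, s = pr a b) : snd s = 0 := by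
  unfold snd; rw [dif_neg h]
theorem fst_le (s : M) : fst s ≤ s := by
  by_cases h : ∃ a b, s = pr a b
  · obtain ⟨a, b, rfl⟩ := h; rw [fst_pr]; exact le_pr_left _ _
  · rw [fst_of_not s h]; exact zero_le
theorem snd_le (s : M) : snd s ≤ s := by
  by_cases h : ∃ a b, s = pr a b
  · obtain ⟨a, b, rfl⟩ := h; rw [snd_pr]; exact le_pr_right _ _
  · rw [snd_of_not s h]; exact zero_le

/-! ### coded sets -/
theorem dvd_of_add {d a b : M} (h : d ∣ a + b) (k : d ∣ a) : d ∣ b := by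
  obtain ⟨q, rfl⟩ := k
  obtain ⟨r, hr⟩ := h
  rcases le_total q r with h | h
  · obtain ⟨s, rfl⟩ := exists_add_of_le h
    exact ⟨s, by rw [mul_add] at hr; exact add_left_cancel hr⟩
  · obtain ⟨s, rfl⟩ := exists_add_of_le h
    have : d * r + (d * s + b) = d * r + 0 := by
      rw [add_zero, ← add_assoc, ← mul_add]; exact hr
    have := add_left_cancel this
    have := (add_eq_zero.1 this).2
    rw [this]; exact dvd_zero _

/-- membership in the coded set `(u,m,b)` -/
def Mem (u m b x : M) : Prop := x < b ∧ (1 + (x + 1) * m) ∣ u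

theorem exists_mult (M : PAM) (b : M) : ∃ m : M, 0 < m ∧ ∀ y, 0 < y → y ≤ b → y ∣ m := by
  refine M.ind (k := 0) (P := fun M v b => ∃ m : M, 0 < m ∧ ∀ y, 0 < y → y ≤ b → ∃ c, m = y * c)
    ![] ?_ ?_ ?_ b
  · exact .ex (.and (.lt .zero (.var _)) (.all (.imp (.lt .zero (.var _)) (.imp (.le (.var _) (.var _))
      (.ex (.eq (.var _) (.mul (.var _) (.var _))))))))
  · exact ⟨1, PAM.pos_one, fun y h h' => absurd h (not_lt.2 h')⟩
  · rintro b ⟨m, hm, h⟩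
    refine ⟨m * (b + 1), ?_, ?_⟩
    · exact mul_pos hm (lt_of_lt_of_le PAM.pos_one le_add_self)
    · intro y hy hy'
      rcases lt_or_eq_of_le hy' with h' | rfl
      · obtain ⟨c, hc⟩ := h y hy ((PAM.lt_succ _ _).1 h')
        exact ⟨c * (b + 1), by rw [hc]; ring⟩
      · exact ⟨m, by ring⟩

theorem cop_m {m j z : M} (h : (1 + (j + 1) * m) ∣ z * m) : (1 + (j + 1) * m) ∣ z := by
  have h1 : (1 + (j + 1) * m) ∣ z * m * (j + 1) := Dvd.dvd.mul_right h _
  have h2 : (1 + (j + 1) * m) ∣ z * m * (j + 1) + z := ⟨z, by ring⟩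
  exact dvd_of_add h2 h1

theorem cop {b m i j y : M} (hm : ∀ y, 0 < y → y ≤ b → y ∣ m) (hi : i < b) (hj : j < b)
    (hij : i ≠ j) (h : (1 + (j + 1) * m) ∣ y * (1 + (i + 1) * m)) : (1 + (j + 1) * m) ∣ y := by
  have key : ∃ d, 0 < d ∧ d ≤ b ∧ (1 + (j + 1) * m) ∣ y * (d * m) := by
    have h0 : (1 + (j + 1) * m) ∣ y * (1 + (j + 1) * m) := Dvd.intro_left _ rfl
    rcases lt_or_gt_of_ne hij with h' | h'
    · obtain ⟨d, rfl⟩ := exists_add_of_le h'.le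
      refine ⟨d, ?_, le_trans le_add_self hj.le, ?_⟩
      · rw [pos_iff_ne_zero]; rintro rfl; simp at h'
      · refine dvd_of_add (?_ : _ ∣ y * (1 + (i + 1) * m) + _) h
        convert h0 using 1; ring
    · obtain ⟨d, rfl⟩ := exists_add_of_le h'.le
      refine ⟨d, ?_, le_trans le_add_self hi.le, ?_⟩
      · rw [pos_iff_ne_zero]; rintro rfl; simp at h'
      · refine dvd_of_add (?_ : _ ∣ y * (1 + (j + 1) * m) + _) h0
        convert h using 1; ring
  obtain ⟨d, hd, hdb, hk⟩ := key
  obtain ⟨c, rfl⟩ := hm d hd hdb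
  have : (1 + (j + 1) * (d * c)) ∣ y * (d * c) * (d * c) := by
    have := Dvd.dvd.mul_right hk c
    convert this using 1
    ring
  exact cop_m (cop_m this)

end arith

theorem comprehension {k : ℕ} {P : ∀ M : PAM, (Fin k → M) → M → Prop}
    (hP : Df (k + 1) (fun M v => P M (fun i => v i.castSucc) (v (Fin.last k))))
    (M : PAM) (p : Fin k → M) (b : M) :
    ∃ u m, ∀ x, Mem u m b x ↔ x < b ∧ P M p x := by
  obtain ⟨m, hm0, hm⟩ := exists_mult M b
  have key : ∀ c : M, ∃ u, ∀ x, x < b → ((∃ q, u = (1 + (x + 1) * m) * q) ↔ x < c ∧ P M p x) := by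
    intro c
    let pp : Fin (k + 2) → M := Fin.snoc (Fin.snoc p m : Fin (k + 1) → M) b
    have e0 : ∀ i : Fin k, pp i.castSucc.castSucc = p i := by intro i; simp [pp]
    have e1 : pp (Fin.last k).castSucc = m := by simp [pp]
    have e2 : pp (Fin.last (k + 1)) = b := by simp [pp]
    have := M.ind (P := fun M (v : Fin (k + 2) → M) c => ∃ u, ∀ x, x < v (Fin.last (k + 1)) →
      ((∃ q, u = (1 + (x + 1) * v (Fin.last k).castSucc) * q) ↔
        x < c ∧ P M (fun i => v i.castSucc.castSucc) x)) pp ?_ ?_ ?_ c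
    · simp only [e0, e1, e2] at this
      exact this
    · refine .ex (.all (.imp (.lt (.var _) (.var _)) (.iff (.ex (.eq (.var _)
        (.mul (.add .one (.mul (.add (.var _) .one) (.var _))) (.var _)))) (.and (.lt (.var _) (.var _)) ?_))))
      have := hP.subst (m := k + 2 + 1 + 1 + 1) (t := Fin.snoc (α := fun _ => ∀ M : PAM, (Fin (k + 2 + 1 + 1 + 1) → M) → M)
        (fun i M v => v i.castSucc.castSucc.castSucc.castSucc.castSucc) (fun M v => v (Fin.last _))) ?_
      · simpa using this
      · intro i
        refine Fin.lastCases ?_ (fun j => ?_) i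
        · simpa using DT.var _
        · simpa using DT.var _
    · refine ⟨1, fun x hx => ⟨?_, fun h => absurd h.1 (by simp)⟩⟩
      simp only [e1]
      rintro ⟨q, hq⟩
      exfalso
      have h1 : q ≠ 0 := by rintro rfl; simp at hq
      have h2 : 1 ≤ q := by
        have := (PAM.lt_iff 0 q).1 (pos_iff_ne_zero.2 h1); simpa using this
      have h3 : (1 : M) < 1 + (x + 1) * m := by
        refine lt_add_of_pos_right _ (mul_pos ?_ hm0)
        exact lt_of_lt_of_le PAM.pos_one le_add_self
      have : (1 : M) < 1 := by
        calc (1 : M) < 1 + (x + 1) * m := h3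
          _ = (1 + (x + 1) * m) * 1 := by ring
          _ ≤ (1 + (x + 1) * m) * q := by gcongr
          _ = 1 := hq.symm
      exact lt_irrefl _ this
    · rintro c ⟨u, hu⟩
      simp only [e0, e1, e2] at hu ⊢
      by_cases hc : c < b ∧ P M p c
      · refine ⟨u * (1 + (c + 1) * m), fun x hx => ?_⟩
        by_cases hxc : x = c
        · subst hxc
          refine ⟨fun _ => ⟨(PAM.lt_succ _ _).2 le_rfl, hc.2⟩, fun _ => ⟨u, by ring⟩⟩
        · have : (∃ q, u * (1 + (c + 1) * m) = (1 + (x + 1) * m) * q) ↔ (∃ q, u = (1 + (x + 1) * m) * q) := by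
            constructor
            · intro h
              exact cop hm hc.1 hx (Ne.symm hxc) h
            · rintro ⟨q, rfl⟩; exact ⟨q * (1 + (c + 1) * m), by ring⟩
          rw [this, hu x hx, PAM.lt_succ, lt_iff_le_and_ne]
          tauto
      · refine ⟨u, fun x hx => ?_⟩
        rw [hu x hx, PAM.lt_succ]
        refine and_congr_left (fun hp => ?_)
        rw [le_iff_lt_or_eq]
        refine ⟨Or.inl, ?_⟩
        rintro (h | rfl)
        · exact h
        · exact absurd ⟨hx, hp⟩ hc
  obtain ⟨u, hu⟩ := key b
  refine ⟨u, m, fun x => ?_⟩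
  unfold Mem
  constructor
  · rintro ⟨h, h'⟩; exact (hu x h).1 h'
  · rintro ⟨h, h'⟩; exact ⟨h, (hu x h).2 ⟨h, h'⟩⟩

theorem DT.pr {n} {t u} (h : DT n t) (k : DT n u) : DT n (fun M v => pr (t M v) (u M v)) :=
  ((h.add k).mul (h.add k)).add h

theorem D0.isPr {n} {t} (h : DT n t) : D0 n (fun M v => ∃ a b, t M v = pr a b) := by
  refine (D0.bex (R := fun M v a => ∃ b ≤ t M v, t M v = Guaspari.pr a b) h
    (.bex h.wk (.eq h.wk.wk (.pr (.var _) (.var _))))).congr (fun M v => ?_)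
  constructor
  · rintro ⟨a, _, b, _, h⟩; exact ⟨a, b, h⟩
  · rintro ⟨a, b, h⟩
    exact ⟨a, by rw [h]; exact le_pr_left _ _, b, by rw [h]; exact le_pr_right _ _, h⟩

theorem D0.eqFst {n} {t u} (h : DT n t) (k : DT n u) : D0 n (fun M v => u M v = fst (t M v)) := by
  refine (D0.or (D0.bex (R := fun M v b => t M v = Guaspari.pr (u M v) b) h (.eq h.wk (.pr k.wk (.var _)))) (.and (.eq k .zero) (D0.isPr h).not)).congr
    (fun M v => ?_)
  constructor
  · rintro (⟨b, _, h⟩ | ⟨h, h'⟩)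
    · rw [h, fst_pr]
    · rw [h, fst_of_not _ h']
  · intro e
    by_cases h : ∃ a b, t M v = Guaspari.pr a b
    · obtain ⟨a, b, h⟩ := h
      left; refine ⟨b, by rw [h]; exact le_pr_right _ _, ?_⟩
      rw [e, h, fst_pr]
    · right; exact ⟨by rw [e, fst_of_not _ h], h⟩

theorem D0.eqSnd {n} {t u} (h : DT n t) (k : DT n u) : D0 n (fun M v => u M v = snd (t M v)) := by
  refine (D0.or (D0.bex (R := fun M v b => t M v = Guaspari.pr b (u M v)) h (.eq h.wk (.pr (.var _) k.wk))) (.and (.eq k .zero) (D0.isPr h).not)).congr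
    (fun M v => ?_)
  constructor
  · rintro (⟨b, _, h⟩ | ⟨h, h'⟩)
    · rw [h, snd_pr]
    · rw [h, snd_of_not _ h']
  · intro e
    by_cases h : ∃ a b, t M v = Guaspari.pr a b
    · obtain ⟨a, b, h⟩ := h
      left; refine ⟨a, by rw [h]; exact le_pr_left _ _, ?_⟩
      rw [e, h, snd_pr]
    · right; exact ⟨by rw [e, snd_of_not _ h], h⟩

/-- use the two components of `t` in a bounded formula -/
theorem D0.withFS {n} {t} (h : DT n t) {R : ∀ M : PAM, (Fin n → M) → M → M → Prop}
    (hR : D0 (n + 2) (fun M v => R M (fun i => v i.castSucc.castSucc) (v (Fin.last n).castSucc)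
      (v (Fin.last (n + 1))))) :
    D0 n (fun M v => R M v (fst (t M v)) (snd (t M v))) := by
  refine (D0.bex (R := fun M v a => ∃ b ≤ t M v, a = fst (t M v) ∧ b = snd (t M v) ∧ R M v a b) h
    (.bex h.wk (.and (.eqFst h.wk.wk (.var _)) (.and (.eqSnd h.wk.wk (.var _)) hR)))).congr (fun M v => ?_)
  constructor
  · rintro ⟨a, _, b, _, rfl, rfl, h⟩; exact h
  · intro h; exact ⟨_, fst_le _, _, snd_le _, rfl, rfl, h⟩

/-! ### the evaluation predicate -/
section ev
variable {M : PAM}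

/-- facts: program `e` on input `s` gives `y` -/
def Fc (e s y : M) : M := pr e (pr s y)

theorem Fc_inj {e s y e' s' y' : M} : Fc e s y = Fc e' s' y' ↔ e = e' ∧ s = s' ∧ y = y' := by
  unfold Fc; rw [pr_inj, pr_inj]
theorem Fc_1 (e s y : M) : e ≤ Fc e s y := le_pr_left _ _
theorem Fc_2 (e s y : M) : s ≤ Fc e s y := (le_pr_left _ _).trans (le_pr_right _ _)
theorem Fc_3 (e s y : M) : y ≤ Fc e s y := (le_pr_right _ _).trans (le_pr_right _ _)

/-- basic functions -/
def BaseR (k s y : M) : Prop :=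
  (k = (0 : ℕ) ∧ y = 0) ∨ (k = (1 : ℕ) ∧ y = s + 1) ∨ (k = (2 : ℕ) ∧ y = fst s) ∨
  (k = (3 : ℕ) ∧ y = snd s) ∨ (k = (4 : ℕ) ∧ y = fst s + snd s) ∨ (k = (5 : ℕ) ∧ y = fst s * snd s) ∨
  (k = (6 : ℕ) ∧ ((y = 1 ∧ fst s ≤ snd s) ∨ (y = 0 ∧ ¬ fst s ≤ snd s))) ∨
  (k = (7 : ℕ) ∧ ((y = 1 ∧ fst s = snd s) ∨ (y = 0 ∧ ¬ fst s = snd s))) ∨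
  (k = (8 : ℕ) ∧ ((y = 1 ∧ (fst s = 1 → snd s = 1)) ∨ (y = 0 ∧ ¬ (fst s = 1 → snd s = 1)))) ∨
  (k = (9 : ℕ) ∧ y = s)

def Rule (S : M → Prop) (e s y : M) : Prop :=
  (∃ k, e = pr (0 : ℕ) k ∧ BaseR k s y) ∨
  (∃ a b y1 y2, e = pr (1 : ℕ) (pr a b) ∧ S (Fc a s y1) ∧ S (Fc b s y2) ∧ y = pr y1 y2) ∨
  (∃ a b t, e = pr (2 : ℕ) (pr a b) ∧ S (Fc b s t) ∧ S (Fc a t y)) ∨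
  (∃ b, e = pr (3 : ℕ) b ∧ ((y = 1 ∧ ∀ x ≤ snd s, S (Fc b (pr (fst s) x) 1)) ∨
    (y = 0 ∧ ∃ x ≤ snd s, S (Fc b (pr (fst s) x) 0))))

theorem Rule.mono {S S' : M → Prop} (h : ∀ x, S x → S' x) {e s y : M} (r : Rule S e s y) :
    Rule S' e s y := by
  rcases r with r | ⟨a, b, y1, y2, h1, h2, h3, h4⟩ | ⟨a, b, t, h1, h2, h3⟩ | ⟨b, h1, h2⟩
  · exact Or.inl r
  · exact Or.inr (Or.inl ⟨a, b, y1, y2, h1, h _ h2, h _ h3, h4⟩)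
  · exact Or.inr (Or.inr (Or.inl ⟨a, b, t, h1, h _ h2, h _ h3⟩))
  · refine Or.inr (Or.inr (Or.inr ⟨b, h1, ?_⟩))
    rcases h2 with ⟨h2, h3⟩ | ⟨h2, x, hx, h3⟩
    · exact Or.inl ⟨h2, fun x hx => h _ (h3 x hx)⟩
    · exact Or.inr ⟨h2, x, hx, h _ h3⟩

/-- bounded version of `Rule` for a coded set -/
def RuleB (u m B e s y : M) : Prop :=
  (∃ k ≤ B, e = pr (0 : ℕ) k ∧ BaseR k s y) ∨
  (∃ a ≤ B, ∃ b ≤ B, ∃ y1 ≤ B, ∃ y2 ≤ B, e = pr (1 : ℕ) (pr a b) ∧ Mem u m B (Fc a s y1) ∧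
    Mem u m B (Fc b s y2) ∧ y = pr y1 y2) ∨
  (∃ a ≤ B, ∃ b ≤ B, ∃ t ≤ B, e = pr (2 : ℕ) (pr a b) ∧ Mem u m B (Fc b s t) ∧ Mem u m B (Fc a t y)) ∨
  (∃ b ≤ B, e = pr (3 : ℕ) b ∧ ((y = 1 ∧ ∀ x ≤ s, x ≤ snd s → Mem u m B (Fc b (pr (fst s) x) 1)) ∨
    (y = 0 ∧ ∃ x ≤ s, x ≤ snd s ∧ Mem u m B (Fc b (pr (fst s) x) 0))))

theorem ruleB_iff {u m B e s y : M} (h : Fc e s y ≤ B) : RuleB u m B e s y ↔ Rule (Mem u m B) e s y := by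
  have he := (Fc_1 e s y).trans h
  have hs := (Fc_2 e s y).trans h
  constructor
  · rintro (⟨k, _, r⟩ | ⟨a, _, b, _, y1, _, y2, _, r⟩ | ⟨a, _, b, _, t, _, r⟩ | ⟨b, _, r⟩)
    · exact Or.inl ⟨k, r⟩
    · exact Or.inr (Or.inl ⟨a, b, y1, y2, r⟩)
    · exact Or.inr (Or.inr (Or.inl ⟨a, b, t, r⟩))
    · refine Or.inr (Or.inr (Or.inr ⟨b, r.1, ?_⟩))
      rcases r.2 with ⟨h2, h3⟩ | ⟨h2, x, _, hx, h3⟩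
      · exact Or.inl ⟨h2, fun x hx => h3 x (hx.trans (snd_le _)) hx⟩
      · exact Or.inr ⟨h2, x, hx, h3⟩
  · rintro (⟨k, r⟩ | ⟨a, b, y1, y2, r⟩ | ⟨a, b, t, r⟩ | ⟨b, r⟩)
    · exact Or.inl ⟨k, (by rw [r.1] at he; exact (le_pr_right _ _).trans he), r⟩
    · refine Or.inr (Or.inl ⟨a, ?_, b, ?_, y1, ?_, y2, ?_, r⟩)
      · rw [r.1] at he; exact (le_pr_left _ _).trans ((le_pr_right _ _).trans he)
      · rw [r.1] at he; exact (le_pr_right _ _).trans ((le_pr_right _ _).trans he)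
      · exact (Fc_3 _ _ _).trans r.2.1.1.le
      · exact (Fc_3 _ _ _).trans r.2.2.1.1.le
    · refine Or.inr (Or.inr (Or.inl ⟨a, ?_, b, ?_, t, ?_, r⟩))
      · rw [r.1] at he; exact (le_pr_left _ _).trans ((le_pr_right _ _).trans he)
      · rw [r.1] at he; exact (le_pr_right _ _).trans ((le_pr_right _ _).trans he)
      · exact (Fc_3 _ _ _).trans r.2.1.1.le
    · refine Or.inr (Or.inr (Or.inr ⟨b, ?_, r.1, ?_⟩))
      · rw [r.1] at he; exact (le_pr_right _ _).trans he
      · rcases r.2 with ⟨h2, h3⟩ | ⟨h2, x, hx, h3⟩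
        · exact Or.inl ⟨h2, fun x _ hx => h3 x hx⟩
        · exact Or.inr ⟨h2, x, (hx.trans (snd_le _)), hx, h3⟩

def Just (u m B : M) : Prop := ∀ e s y, Mem u m B (Fc e s y) → Rule (Mem u m B) e s y

theorem just_iff (u m B : M) :
    Just u m B ↔ ∀ e ≤ B, ∀ s ≤ B, ∀ y ≤ B, Mem u m B (Fc e s y) → RuleB u m B e s y := by
  constructor
  · intro h e _ s _ y _ h'
    exact (ruleB_iff h'.1.le).2 (h e s y h')
  · intro h e s y h'
    refine (ruleB_iff h'.1.le).1 (h e ?_ s ?_ y ?_ h')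
    · exact (Fc_1 _ _ _).trans h'.1.le
    · exact (Fc_2 _ _ _).trans h'.1.le
    · exact (Fc_3 _ _ _).trans h'.1.le

def EvB (B z : M) : Prop := ∃ u m b, b ≤ B ∧ Just u m b ∧ Mem u m b z
def EvS (z : M) : Prop := ∃ u m b, Just u m b ∧ Mem u m b z

end ev

theorem DT.Fc {n} {t u w} (h : DT n t) (k : DT n u) (l : DT n w) :
    DT n (fun M v => Fc (t M v) (u M v) (w M v)) := h.pr (k.pr l)

theorem D0.mem {n} {t u w x} (h : DT n t) (k : DT n u) (l : DT n w) (hx : DT n x) :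
    D0 n (fun M v => Mem (t M v) (u M v) (w M v) (x M v)) := by
  refine (D0.and (.lt hx l) (.bex (R := fun M v q => t M v = (1 + (x M v + 1) * u M v) * q) h (.eq h.wk (.mul (.add .one (.mul (.add hx.wk .one) k.wk)) (.var _))))).congr
    (fun M v => ?_)
  unfold Mem
  refine and_congr_right (fun _ => ?_)
  constructor
  · rintro ⟨q, _, h⟩; exact ⟨q, h⟩
  · rintro ⟨q, h⟩
    refine ⟨q, ?_, h⟩
    rw [h]
    calc q = 1 * q := by ring
      _ ≤ _ := by gcongr; exact le_self_add

theorem D0.baseR {n} {k s y} (hk : DT n k) (hs : DT n s) (hy : DT n y) :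
    D0 n (fun M v => BaseR (k M v) (s M v) (y M v)) := by
  refine D0.withFS (R := fun M v a b => (k M v = (0 : ℕ) ∧ y M v = 0) ∨ (k M v = (1 : ℕ) ∧ y M v = s M v + 1) ∨ (k M v = (2 : ℕ) ∧ y M v = a) ∨
  (k M v = (3 : ℕ) ∧ y M v = b) ∨ (k M v = (4 : ℕ) ∧ y M v = a + b) ∨ (k M v = (5 : ℕ) ∧ y M v = a * b) ∨
  (k M v = (6 : ℕ) ∧ ((y M v = 1 ∧ a ≤ b) ∨ (y M v = 0 ∧ ¬ a ≤ b))) ∨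
  (k M v = (7 : ℕ) ∧ ((y M v = 1 ∧ a = b) ∨ (y M v = 0 ∧ ¬ a = b))) ∨
  (k M v = (8 : ℕ) ∧ ((y M v = 1 ∧ (a = 1 → b = 1)) ∨ (y M v = 0 ∧ ¬ (a = 1 → b = 1)))) ∨
  (k M v = (9 : ℕ) ∧ y M v = s M v)) hs ?_
  have hk := hk.wk.wk
  have hs := hs.wk.wk
  have hy := hy.wk.wk
  exact .or (.and (.eq hk (.num _)) (.eq hy .zero)) <|
   .or (.and (.eq hk (.num _)) (.eq hy (.add hs .one))) <|
   .or (.and (.eq hk (.num _)) (.eq hy (.var _))) <|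
   .or (.and (.eq hk (.num _)) (.eq hy (.var _))) <|
   .or (.and (.eq hk (.num _)) (.eq hy (.add (.var _) (.var _)))) <|
   .or (.and (.eq hk (.num _)) (.eq hy (.mul (.var _) (.var _)))) <|
   .or (.and (.eq hk (.num _)) (.or (.and (.eq hy .one) (.le (.var _) (.var _))) (.and (.eq hy .zero) (.not (.le (.var _) (.var _)))))) <|
   .or (.and (.eq hk (.num _)) (.or (.and (.eq hy .one) (.eq (.var _) (.var _))) (.and (.eq hy .zero) (.not (.eq (.var _) (.var _)))))) <|
   .or (.and (.eq hk (.num _)) (.or (.and (.eq hy .one) (.imp (.eq (.var _) .one) (.eq (.var _) .one))) (.and (.eq hy .zero) (.not (.imp (.eq (.var _) .one) (.eq (.var _) .one)))))) <|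
   .and (.eq hk (.num _)) (.eq hy hs)

theorem D0.ruleB {n} {u m B e s y} (hu : DT n u) (hm : DT n m) (hB : DT n B) (he : DT n e)
    (hs : DT n s) (hy : DT n y) :
    D0 n (fun M v => RuleB (u M v) (m M v) (B M v) (e M v) (s M v) (y M v)) := by
  refine .or ?_ (.or ?_ (.or ?_ ?_))
  · exact .bex hB (.and (.eq he.wk (.pr (.num _) (.var _))) (.baseR (.var _) hs.wk hy.wk))
  · exact .bex hB (.bex hB.wk (.bex hB.wk.wk (.bex hB.wk.wk.wk (.and (.eq he.wk.wk.wk.wk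
      (.pr (.num _) (.pr (.var _) (.var _)))) (.and
      (.mem hu.wk.wk.wk.wk hm.wk.wk.wk.wk hB.wk.wk.wk.wk (.Fc (.var _) hs.wk.wk.wk.wk (.var _)))
      (.and (.mem hu.wk.wk.wk.wk hm.wk.wk.wk.wk hB.wk.wk.wk.wk (.Fc (.var _) hs.wk.wk.wk.wk (.var _)))
      (.eq hy.wk.wk.wk.wk (.pr (.var _) (.var _)))))))))
  · exact .bex hB (.bex hB.wk (.bex hB.wk.wk (.and (.eq he.wk.wk.wk
      (.pr (.num _) (.pr (.var _) (.var _)))) (.and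
      (.mem hu.wk.wk.wk hm.wk.wk.wk hB.wk.wk.wk (.Fc (.var _) hs.wk.wk.wk (.var _)))
      (.mem hu.wk.wk.wk hm.wk.wk.wk hB.wk.wk.wk (.Fc (.var _) (.var _) hy.wk.wk.wk))))))
  · refine .bex hB (.and (.eq he.wk (.pr (.num _) (.var _))) ?_)
    have hu := hu.wk
    have hm := hm.wk
    have hB := hB.wk
    have hs := hs.wk
    have hy := hy.wk
    let s' := fun (M : PAM) (v : Fin (n + 1) → M) => s M (fun i => v i.castSucc)
    let u' := fun (M : PAM) (v : Fin (n + 1) → M) => u M (fun i => v i.castSucc)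
    let m' := fun (M : PAM) (v : Fin (n + 1) → M) => m M (fun i => v i.castSucc)
    let B' := fun (M : PAM) (v : Fin (n + 1) → M) => B M (fun i => v i.castSucc)
    let y' := fun (M : PAM) (v : Fin (n + 1) → M) => y M (fun i => v i.castSucc)
    refine D0.withFS (R := fun M v a b => ((y' M v = 1 ∧ ∀ x ≤ s' M v, x ≤ b →
      Mem (u' M v) (m' M v) (B' M v) (Guaspari.Fc (v (Fin.last n)) (Guaspari.pr a x) 1)) ∨
    (y' M v = 0 ∧ ∃ x ≤ s' M v, x ≤ b ∧ Mem (u' M v) (m' M v) (B' M v) (Guaspari.Fc (v (Fin.last n)) (Guaspari.pr a x) 0)))) hs ?_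
    refine .or (.and (.eq hy.wk.wk .one) (.ball hs.wk.wk (.imp (.le (.var _) (.var _)) ?_)))
      (.and (.eq hy.wk.wk .zero) (.bex hs.wk.wk (.and (.le (.var _) (.var _)) ?_)))
    · exact .mem hu.wk.wk.wk hm.wk.wk.wk hB.wk.wk.wk (.Fc (.var _) (.pr (.var _) (.var _)) .one)
    · exact .mem hu.wk.wk.wk hm.wk.wk.wk hB.wk.wk.wk (.Fc (.var _) (.pr (.var _) (.var _)) .zero)

theorem D0.just {n} {u m B} (hu : DT n u) (hm : DT n m) (hB : DT n B) :
    D0 n (fun M v => Just (u M v) (m M v) (B M v)) := by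
  refine D0.congr (A := fun M v => ∀ e ≤ B M v, ∀ s ≤ B M v, ∀ y ≤ B M v,
    Mem (u M v) (m M v) (B M v) (Guaspari.Fc e s y) → RuleB (u M v) (m M v) (B M v) e s y) ?_
    (fun M v => (just_iff _ _ _).symm)
  exact .ball hB (.ball hB.wk (.ball hB.wk.wk (.imp
    (.mem hu.wk.wk.wk hm.wk.wk.wk hB.wk.wk.wk (.Fc (.var _) (.var _) (.var _)))
    (.ruleB hu.wk.wk.wk hm.wk.wk.wk hB.wk.wk.wk (.var _) (.var _) (.var _)))))

theorem Df.evB {n} {B z} (hB : DT n B) (hz : DT n z) : Df n (fun M v => EvB (B M v) (z M v)) :=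
  .ex (.ex (.ex (.and (.le (.var _) hB.wk.wk.wk) (.and (D0.just (.var _) (.var _) (.var _)).df
    (D0.mem (.var _) (.var _) (.var _) hz.wk.wk.wk).df))))

section ev2
variable {M : PAM}

theorem EvB.mono {B B' z : M} (h : B ≤ B') (k : EvB B z) : EvB B' z := by
  obtain ⟨u, m, b, h1, h2⟩ := k; exact ⟨u, m, b, h1.trans h, h2⟩
theorem EvB.evS {B z : M} (k : EvB B z) : EvS z := by
  obtain ⟨u, m, b, h1, h2⟩ := k; exact ⟨u, m, b, h2⟩
theorem EvS.evB {z : M} (k : EvS z) : ∃ B, EvB B z := by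
  obtain ⟨u, m, b, h2⟩ := k; exact ⟨b, u, m, b, le_rfl, h2⟩
theorem EvB.rule {B e s y : M} (k : EvB B (Fc e s y)) : Rule (EvB B) e s y := by
  obtain ⟨u, m, b, h1, h2, h3⟩ := k
  exact (h2 e s y h3).mono (fun x hx => ⟨u, m, b, h1, h2, hx⟩)

theorem evS_of_ruleB {B e s y : M} (k : Rule (EvB B) e s y) : EvS (Fc e s y) := by
  obtain ⟨u, m, h⟩ := comprehension (P := fun M (v : Fin 2 → M) x => EvB (v 0) x ∨ x = v 1)
    (.or (.evB (.var _) (.var _)) (.eq (.var _) (.var _))) M ![B, Fc e s y] (max B (Fc e s y + 1))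
  simp only [Matrix.cons_val_zero, Matrix.cons_val_one] at h
  have hmem : ∀ x, EvB B x → Mem u m (max B (Fc e s y + 1)) x := by
    intro x hx
    refine (h x).2 ⟨?_, Or.inl hx⟩
    obtain ⟨u', m', b', h1, h2, h3⟩ := hx
    exact lt_of_lt_of_le h3.1 (h1.trans (le_max_left _ _))
  refine ⟨u, m, _, ?_, (h _).2 ⟨?_, Or.inr rfl⟩⟩
  · intro e' s' y' h'
    rcases ((h _).1 h').2 with h'' | h''
    · exact h''.rule.mono hmem
    · obtain ⟨rfl, rfl, rfl⟩ := Fc_inj.1 h''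
      exact k.mono hmem
  · exact lt_of_lt_of_le ((PAM.lt_succ _ _).2 le_rfl) (le_max_right _ _)

theorem evS_coll (b s y v : M) (h : ∀ x ≤ v, EvS (Fc b (pr s x) y)) :
    ∃ B, ∀ x ≤ v, EvB B (Fc b (pr s x) y) := by
  have := M.ind (P := fun M (p : Fin 4 → M) v => v ≤ p 3 → ∃ B, ∀ x, x ≤ v → EvB B (Fc (p 0) (pr (p 1) x) (p 2)))
    ![b, s, y, v] ?_ ?_ ?_ v
  · exact this le_rfl
  · exact .imp (.le (.var _) (.var _)) (.ex (.all (.imp (.le (.var _) (.var _)) (.evB (.var _) (.Fc (.var _) (.pr (.var _) (.var _)) (.var _))))))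
  · intro _
    obtain ⟨B, hB⟩ := (h 0 zero_le).evB
    refine ⟨B, fun x hx => ?_⟩
    obtain rfl : x = 0 := le_antisymm hx zero_le
    exact hB
  · intro w hw hw'
    obtain ⟨B, hB⟩ := hw (le_trans le_self_add hw')
    obtain ⟨B', hB'⟩ := (h (w + 1) hw').evB
    refine ⟨max B B', fun x hx => ?_⟩
    rcases lt_or_eq_of_le hx with hx | rfl
    · exact (hB x ((PAM.lt_succ _ _).1 hx)).mono (le_max_left _ _)
    · exact EvB.mono (le_max_right _ _) hB'

theorem evS_iff (e s y : M) : EvS (Fc e s y) ↔ Rule EvS e s y := by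
  constructor
  · intro h
    obtain ⟨B, h⟩ := h.evB
    exact h.rule.mono (fun x hx => hx.evS)
  · rintro (r | ⟨a, b, y1, y2, h1, h2, h3, h4⟩ | ⟨a, b, t, h1, h2, h3⟩ | ⟨b, h1, h2⟩)
    · exact evS_of_ruleB (B := 0) (Or.inl r)
    · obtain ⟨B, h2⟩ := h2.evB
      obtain ⟨B', h3⟩ := h3.evB
      exact evS_of_ruleB (B := max B B') (Or.inr (Or.inl ⟨a, b, y1, y2, h1, h2.mono (le_max_left _ _),
        h3.mono (le_max_right _ _), h4⟩))
    · obtain ⟨B, h2⟩ := h2.evB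
      obtain ⟨B', h3⟩ := h3.evB
      exact evS_of_ruleB (B := max B B') (Or.inr (Or.inr (Or.inl ⟨a, b, t, h1, h2.mono (le_max_left _ _),
        h3.mono (le_max_right _ _)⟩)))
    · rcases h2 with ⟨h2, h3⟩ | ⟨h2, x, hx, h3⟩
      · obtain ⟨B, hB⟩ := evS_coll _ _ _ _ h3
        exact evS_of_ruleB (Or.inr (Or.inr (Or.inr ⟨b, h1, Or.inl ⟨h2, hB⟩⟩)))
      · obtain ⟨B, h3⟩ := h3.evB
        exact evS_of_ruleB (Or.inr (Or.inr (Or.inr ⟨b, h1, Or.inr ⟨h2, x, hx, h3⟩⟩)))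
end ev2

/-! ### programs -/
def np (a b : ℕ) : ℕ := (a + b) * (a + b) + a
theorem np_cast (M : PAM) (a b : ℕ) : ((np a b : ℕ) : M) = pr (a : M) (b : M) := by
  unfold np pr; push_cast; rfl

def Fn (e : ℕ) (f : ∀ M : PAM, M → M) : Prop :=
  ∀ (M : PAM) (s y : M), EvS (Fc (e : M) s y) ↔ y = f M s
def Prog (f : ∀ M : PAM, M → M) : Prop := ∃ e, Fn e f
open Classical in
noncomputable def chi (A : ∀ M : PAM, M → Prop) : ∀ M : PAM, M → M := fun M s => if A M s then 1 else 0
def Dec (e : ℕ) (A : ∀ M : PAM, M → Prop) : Prop := Fn e (chi A)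
def Dc (A : ∀ M : PAM, M → Prop) : Prop := Prog (chi A)

theorem chi_1 {A : ∀ M : PAM, M → Prop} {M : PAM} {s : M} : (1 : M) = chi A M s ↔ A M s := by
  unfold chi; split_ifs with h
  · simp [h]
  · simp [h]
theorem chi_1' {A : ∀ M : PAM, M → Prop} {M : PAM} {s : M} : chi A M s = 1 ↔ A M s := by
  rw [eq_comm, chi_1]
theorem chi_0 {A : ∀ M : PAM, M → Prop} {M : PAM} {s : M} : (0 : M) = chi A M s ↔ ¬ A M s := by
  unfold chi; split_ifs with h
  · simp [h]
  · simp [h]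
theorem eq_chi {A : ∀ M : PAM, M → Prop} {M : PAM} {s y : M} :
    y = chi A M s ↔ (y = 1 ∧ A M s) ∨ (y = 0 ∧ ¬ A M s) := by
  unfold chi; split_ifs with h
  · simp [h]
  · simp [h]

theorem rule_k {M : PAM} (S : M → Prop) (k r : M) (s y : M) (j : ℕ) (hj : k = (j : M)) : Rule S (pr k r) s y ↔
    (j = 0 ∧ BaseR r s y) ∨
    (j = 1 ∧ ∃ a b y1 y2, r = pr a b ∧ S (Fc a s y1) ∧ S (Fc b s y2) ∧ y = pr y1 y2) ∨
    (j = 2 ∧ ∃ a b t, r = pr a b ∧ S (Fc b s t) ∧ S (Fc a t y)) ∨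
    (j = 3 ∧ ((y = 1 ∧ ∀ x ≤ snd s, S (Fc r (pr (fst s) x) 1)) ∨
      (y = 0 ∧ ∃ x ≤ snd s, S (Fc r (pr (fst s) x) 0)))) := by
  subst hj
  unfold Rule
  simp only [pr_inj, Nat.cast_inj]
  refine or_congr ?_ (or_congr ?_ (or_congr ?_ ?_))
  · constructor
    · rintro ⟨k, ⟨h, rfl⟩, h'⟩; exact ⟨h, h'⟩
    · rintro ⟨h, h'⟩; exact ⟨_, ⟨h, rfl⟩, h'⟩
  · constructor
    · rintro ⟨a, b, y1, y2, ⟨h, h'⟩, h''⟩; exact ⟨h, a, b, y1, y2, h', h''⟩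
    · rintro ⟨h, a, b, y1, y2, h', h''⟩; exact ⟨a, b, y1, y2, ⟨h, h'⟩, h''⟩
  · constructor
    · rintro ⟨a, b, y1, ⟨h, h'⟩, h''⟩; exact ⟨h, a, b, y1, h', h''⟩
    · rintro ⟨h, a, b, y1, h', h''⟩; exact ⟨a, b, y1, ⟨h, h'⟩, h''⟩
  · constructor
    · rintro ⟨k, ⟨h, rfl⟩, h'⟩; exact ⟨h, h'⟩
    · rintro ⟨h, h'⟩; exact ⟨_, ⟨h, rfl⟩, h'⟩

theorem Prog.base (k : ℕ) (f : ∀ M : PAM, M → M)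
    (h : ∀ (M : PAM) (s y : M), BaseR (k : M) s y ↔ y = f M s) : Prog f := by
  refine ⟨np 0 k, fun M s y => ?_⟩
  rw [evS_iff, np_cast, rule_k _ _ _ _ _ 0 rfl, ← h]
  simp

theorem Prog.zero : Prog (fun _ _ => 0) := .base 0 _ (fun M s y => by simp only [BaseR, Nat.cast_inj]; simp)
theorem Prog.succ : Prog (fun _ s => s + 1) := .base 1 _ (fun M s y => by simp only [BaseR, Nat.cast_inj]; simp)
theorem Prog.fst : Prog (fun _ s => fst s) := .base 2 _ (fun M s y => by simp only [BaseR, Nat.cast_inj]; simp)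
theorem Prog.snd : Prog (fun _ s => snd s) := .base 3 _ (fun M s y => by simp only [BaseR, Nat.cast_inj]; simp)
theorem Prog.add0 : Prog (fun _ s => Guaspari.fst s + Guaspari.snd s) :=
  .base 4 _ (fun M s y => by simp only [BaseR, Nat.cast_inj]; simp)
theorem Prog.mul0 : Prog (fun _ s => Guaspari.fst s * Guaspari.snd s) :=
  .base 5 _ (fun M s y => by simp only [BaseR, Nat.cast_inj]; simp)
theorem Dc.le0 : Dc (fun _ s => fst s ≤ snd s) :=
  .base 6 _ (fun M s y => by rw [eq_chi]; simp only [BaseR, Nat.cast_inj]; simp)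
theorem Dc.eq0 : Dc (fun _ s => fst s = snd s) :=
  .base 7 _ (fun M s y => by rw [eq_chi]; simp only [BaseR, Nat.cast_inj]; simp)
theorem Dc.imp0 : Dc (fun _ s => fst s = 1 → snd s = 1) :=
  .base 8 _ (fun M s y => by rw [eq_chi]; simp only [BaseR, Nat.cast_inj]; simp)
theorem Prog.id : Prog (fun _ s => s) := .base 9 _ (fun M s y => by simp only [BaseR, Nat.cast_inj]; simp)

theorem Prog.pr {f g} (hf : Prog f) (hg : Prog g) : Prog (fun M s => pr (f M s) (g M s)) := by
  obtain ⟨a, ha⟩ := hf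
  obtain ⟨b, hb⟩ := hg
  refine ⟨np 1 (np a b), fun M s y => ?_⟩
  rw [evS_iff, np_cast, rule_k _ _ _ _ _ 1 rfl, np_cast]
  simp only [pr_inj]
  constructor
  · rintro (⟨h, _⟩ | ⟨-, a', b', y1, y2, ⟨rfl, rfl⟩, h1, h2, rfl⟩ | ⟨h, _⟩ | ⟨h, _⟩)
    · omega
    · rw [(ha M _ _).1 h1, (hb M _ _).1 h2]
    · omega
    · omega
  · rintro rfl
    exact Or.inr (Or.inl ⟨trivial, _, _, _, _, ⟨rfl, rfl⟩, (ha M _ _).2 rfl, (hb M _ _).2 rfl, rfl⟩)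

theorem Prog.comp {f g} (hf : Prog f) (hg : Prog g) : Prog (fun M s => f M (g M s)) := by
  obtain ⟨a, ha⟩ := hf
  obtain ⟨b, hb⟩ := hg
  refine ⟨np 2 (np a b), fun M s y => ?_⟩
  rw [evS_iff, np_cast, rule_k _ _ _ _ _ 2 rfl, np_cast]
  simp only [pr_inj]
  constructor
  · rintro (⟨h, _⟩ | ⟨h, _⟩ | ⟨-, a', b', t, ⟨rfl, rfl⟩, h1, h2⟩ | ⟨h, _⟩)
    · omega
    · omega
    · rw [(ha M _ _).1 h2, (hb M _ _).1 h1]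
    · omega
  · rintro rfl
    exact Or.inr (Or.inr (Or.inl ⟨trivial, _, _, _, ⟨rfl, rfl⟩, (hb M _ _).2 rfl, (ha M _ _).2 rfl⟩))

theorem Dc.congr {A B} (h : Dc A) (e : ∀ M s, A M s ↔ B M s) : Dc B := by
  have : A = B := by funext M s; exact propext (e M s)
  rwa [← this]
theorem Prog.congr {A B} (h : Prog A) (e : ∀ M s, A M s = B M s) : Prog B := by
  have : A = B := by funext M s; exact e M s
  rwa [← this]
theorem Dc.comp {A g} (hA : Dc A) (hg : Prog g) : Dc (fun M s => A M (g M s)) :=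
  Prog.comp (f := chi A) hA hg

theorem Dc.ball {A} (hA : Dc A) : Dc (fun M s => ∀ x ≤ snd s, A M (pr (fst s) x)) := by
  obtain ⟨a, ha⟩ := hA
  refine ⟨np 3 a, fun M s y => ?_⟩
  rw [evS_iff, np_cast, rule_k _ _ _ _ _ 3 rfl, eq_chi]
  simp only [ha M, chi_1, chi_0]
  simp

theorem Prog.add {f g} (hf : Prog f) (hg : Prog g) : Prog (fun M s => f M s + g M s) :=
  (Prog.add0.comp (hf.pr hg)).congr (by simp)
theorem Prog.mul {f g} (hf : Prog f) (hg : Prog g) : Prog (fun M s => f M s * g M s) :=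
  (Prog.mul0.comp (hf.pr hg)).congr (by simp)
theorem Dc.le {f g} (hf : Prog f) (hg : Prog g) : Dc (fun M s => f M s ≤ g M s) :=
  (Dc.le0.comp (hf.pr hg)).congr (by simp)
theorem Dc.eq {f g} (hf : Prog f) (hg : Prog g) : Dc (fun M s => f M s = g M s) :=
  (Dc.eq0.comp (hf.pr hg)).congr (by simp)
theorem Dc.imp {A B} (hA : Dc A) (hB : Dc B) : Dc (fun M s => A M s → B M s) :=
  (Dc.imp0.comp (Prog.pr hA hB)).congr (by simp [chi_1'])
theorem Dc.fls : Dc (fun _ _ => False) :=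
  (Dc.eq Prog.zero (Prog.succ.comp Prog.zero)).congr (by simp)
theorem Dc.not {A} (hA : Dc A) : Dc (fun M s => ¬ A M s) := hA.imp .fls
theorem Dc.bal {A f} (hA : Dc A) (hf : Prog f) : Dc (fun M s => ∀ x ≤ f M s, A M (pr s x)) :=
  (Dc.comp (.ball hA) (Prog.pr .id hf)).congr (by simp)

/-! ### environments and Δ₀ formulas -/
def env {M : PAM} : ∀ {n : ℕ}, (Fin n → M) → M
  | 0, _ => 0
  | n + 1, v => pr (env (fun i : Fin n => v i.castSucc)) (v (Fin.last n))

theorem env_snoc {M : PAM} {n} (v : Fin n → M) (x : M) :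
    env (Fin.snoc v x : Fin (n + 1) → M) = pr (env v) x := by
  rw [env, snoc_cs, Fin.snoc_last]

theorem Prog.var : ∀ {n} (i : Fin n), ∃ g, Prog g ∧ ∀ (M : PAM) (v : Fin n → M), g M (env v) = v i
  | 0, i => i.elim0
  | n + 1, i => by
    refine Fin.lastCases ?_ (fun j => ?_) i
    · exact ⟨_, Prog.snd, fun M v => by rw [env, snd_pr]⟩
    · obtain ⟨g, hg, h⟩ := Prog.var j
      exact ⟨_, hg.comp Prog.fst, fun M v => by rw [env, fst_pr, h]⟩

theorem term_cases {n} (P : LA.Term (Empty ⊕ Fin n) → Prop) (hv : ∀ i, P (vT i)) (hz : P zeroT)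
    (hs : ∀ t, P t → P (succT t)) (ha : ∀ t u, P t → P u → P (addT t u))
    (hm : ∀ t u, P t → P u → P (mulT t u)) (t) : P t := by
  induction t with
  | var x => rcases x with x | x; exact x.elim; exact hv x
  | @func l f ts ih =>
    match l, f, ts, ih with
    | 0, f, ts, ih =>
      have e : (Term.func f ts : LA.Term (Empty ⊕ Fin n)) = zeroT := by
        simp only [zeroT, Constants.term]; congr 1; exact Subsingleton.elim _ _
      rw [e]; exact hz
    | 1, f, ts, ih =>
      have e : (Term.func f ts : LA.Term (Empty ⊕ Fin n)) = succT (ts 0) := by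
        simp only [succT, Functions.apply₁]; congr 1
        funext i; fin_cases i; rfl
      rw [e]; exact hs _ (ih _)
    | 2, false, ts, ih =>
      have e : (Term.func (show LA.Functions 2 from false) ts : LA.Term (Empty ⊕ Fin n)) = addT (ts 0) (ts 1) := by
        simp only [addT, Functions.apply₂]; congr 1
        funext i; fin_cases i <;> rfl
      exact e ▸ ha _ _ (ih _) (ih _)
    | 2, true, ts, ih =>
      have e : (Term.func (show LA.Functions 2 from true) ts : LA.Term (Empty ⊕ Fin n)) = mulT (ts 0) (ts 1) := by
        simp only [mulT, Functions.apply₂]; congr 1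
        funext i; fin_cases i <;> rfl
      exact e ▸ hm _ _ (ih _) (ih _)
    | (l + 3), f, ts, ih => exact f.elim

theorem Prog.term {n} (t : LA.Term (Empty ⊕ Fin n)) :
    ∃ g, Prog g ∧ ∀ (M : PAM) (v : Fin n → M), g M (env v) = t.realize (Sum.elim default v) := by
  refine term_cases (fun t => ∃ g, Prog g ∧ ∀ (M : PAM) (v : Fin n → M), g M (env v) = t.realize (Sum.elim default v)) ?_ ?_ ?_ ?_ ?_ t
  · intro i; obtain ⟨g, h, k⟩ := Prog.var i; exact ⟨g, h, fun M v => by rw [k, realize_vT]; rfl⟩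
  · exact ⟨_, Prog.zero, fun M v => by rw [realize_zeroT]; rfl⟩
  · rintro t ⟨g, h, k⟩; exact ⟨_, Prog.succ.comp h, fun M v => by rw [realize_succT, k, PAM.s_eq]⟩
  · rintro t u ⟨g, h, k⟩ ⟨g', h', k'⟩
    exact ⟨_, h.add h', fun M v => by rw [realize_addT, k, k', PAM.a_eq]⟩
  · rintro t u ⟨g, h, k⟩ ⟨g', h', k'⟩
    exact ⟨_, h.mul h', fun M v => by rw [realize_mulT, k, k', PAM.m_eq]⟩

theorem Dc.delta0 {n} {φ : LA.BoundedFormula Empty n} (h : IsDelta0 φ) :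
    ∃ A, Dc A ∧ ∀ (M : PAM) (v : Fin n → M), φ.Realize default v ↔ A M (env v) := by
  induction h with
  | falsum => exact ⟨_, Dc.fls, fun M v => Iff.rfl⟩
  | equal t u =>
    obtain ⟨g, h, k⟩ := Prog.term t
    obtain ⟨g', h', k'⟩ := Prog.term u
    exact ⟨_, Dc.eq h h', fun M v => by rw [k, k']; exact BoundedFormula.realize_bdEqual _ _⟩
  | le t u =>
    obtain ⟨g, h, k⟩ := Prog.term t
    obtain ⟨g', h', k'⟩ := Prog.term u
    exact ⟨_, Dc.le h h', fun M v => by rw [k, k', realize_leF, PAM.l_eq]⟩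
  | imp _ _ ih1 ih2 =>
    obtain ⟨g, h, k⟩ := ih1
    obtain ⟨g', h', k'⟩ := ih2
    exact ⟨_, Dc.imp h h', fun M v => by rw [BoundedFormula.realize_imp, k, k']⟩
  | ball t _ ih =>
    obtain ⟨g, h, k⟩ := Prog.term t
    obtain ⟨A, hA, kA⟩ := ih
    refine ⟨_, Dc.bal hA h, fun M v => ?_⟩
    simp [kA, realize_wk, ← k, PAM.l_eq, -Term.realize_relabel, env_snoc]
  | bex t _ ih =>
    obtain ⟨g, h, k⟩ := Prog.term t
    obtain ⟨A, hA, kA⟩ := ih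
    refine ⟨_, (Dc.bal hA.not h).not, fun M v => ?_⟩
    simp [kA, realize_wk, ← k, PAM.l_eq, -Term.realize_relabel, env_snoc]

/-! ### partial truth, semantically -/
mutual
def sg : ℕ → ∀ M : PAM, (M → Prop) → M → Prop
  | 0, _, A, s => A s
  | k + 1, M, A, s => ∃ z, pg k M A (pr s z)
def pg : ℕ → ∀ M : PAM, (M → Prop) → M → Prop
  | 0, _, A, s => A s
  | k + 1, M, A, s => ∀ z, sg k M A (pr s z)
end

noncomputable def lift (g : ∀ M : PAM, M → M) : ∀ M : PAM, M → M := fun M t => pr (g M (fst t)) (snd t)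
theorem lift_pr (g : ∀ M : PAM, M → M) (M : PAM) (s z : M) : lift g M (pr s z) = pr (g M s) z := by
  simp [lift]

theorem sat_subst (k : ℕ) : ∀ g, Prog g → ∃ g', Prog g' ∧ ∀ (M : PAM) (A : M → Prop) (s : M),
    (sg k M (fun t => A (g' M t)) s ↔ sg k M A (g M s)) ∧
    (pg k M (fun t => A (g' M t)) s ↔ pg k M A (g M s)) := by
  induction k with
  | zero => intro g hg; exact ⟨g, hg, fun M A s => by simp [sg, pg]⟩
  | succ k ih =>
    intro g hg
    obtain ⟨g', hg', h⟩ := ih (lift g) ((hg.comp .fst).pr .snd)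
    refine ⟨g', hg', fun M A s => ?_⟩
    simp only [sg, pg, h, lift_pr, and_self]

theorem sat_not (k : ℕ) : ∀ (M : PAM) (A : M → Prop) (s : M),
    (¬ sg k M A s ↔ pg k M (fun t => ¬ A t) s) ∧ (¬ pg k M A s ↔ sg k M (fun t => ¬ A t) s) := by
  induction k with
  | zero => intro M A s; simp [sg, pg]
  | succ k ih =>
    intro M A s
    simp only [sg, pg, not_exists, not_forall, ih, and_self]

theorem sat_ofPi {k} {A} (hA : Dc A) : ∃ A', Dc A' ∧ ∀ (M : PAM) (s : M),
    (sg (k + 1) M (A' M) s ↔ pg k M (A M) s) ∧ (pg (k + 1) M (A' M) s ↔ sg k M (A M) s) := by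
  obtain ⟨g', hg', h⟩ := sat_subst k _ Prog.fst
  refine ⟨_, hA.comp hg', fun M s => ?_⟩
  simp [sg, pg, h]

theorem sat_ex {k} {A} (hA : Dc A) : ∃ A', Dc A' ∧ ∀ (M : PAM) (s : M),
    (sg (k + 1) M (A' M) s ↔ ∃ x, sg (k + 1) M (A M) (pr s x)) ∧
    (pg (k + 1) M (A' M) s ↔ ∀ x, pg (k + 1) M (A M) (pr s x)) := by
  obtain ⟨g', hg', h⟩ := sat_subst k _
    (Prog.pr (Prog.pr .fst (Prog.fst.comp .snd)) (Prog.snd.comp .snd))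
  refine ⟨_, hA.comp hg', fun M s => ?_⟩
  simp only [sg, pg, h, fst_pr, snd_pr]
  constructor
  · constructor
    · rintro ⟨z, hz⟩; exact ⟨_, _, hz⟩
    · rintro ⟨x, y, hz⟩; exact ⟨pr x y, by simpa using hz⟩
  · constructor
    · intro hz x y; simpa using hz (pr x y)
    · intro hz x; exact hz _ _

mutual
theorem sigma_rep : ∀ {k m : ℕ} {φ : LA.BoundedFormula Empty m}, IsSigmaFml k φ →
    ∃ A, Dc A ∧ ∀ (M : PAM) (v : Fin m → M), φ.Realize default v ↔ sg k M (A M) (env v)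
  | _, _, _, .ofDelta0 h => by
    obtain ⟨A, hA, h⟩ := Dc.delta0 h
    exact ⟨A, hA, fun M v => by rw [h, sg]⟩
  | _, _, _, .ofPi h => by
    obtain ⟨A, hA, h⟩ := pi_rep h
    obtain ⟨A', hA', h'⟩ := sat_ofPi hA
    exact ⟨A', hA', fun M v => by rw [h, (h' _ _).1]⟩
  | _, _, _, .ex h => by
    obtain ⟨A, hA, h⟩ := sigma_rep h
    obtain ⟨A', hA', h'⟩ := sat_ex hA
    exact ⟨A', hA', fun M v => by rw [BoundedFormula.realize_ex, (h' _ _).1]; simp only [h, env_snoc]⟩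
theorem pi_rep : ∀ {k m : ℕ} {φ : LA.BoundedFormula Empty m}, IsPiFml k φ →
    ∃ A, Dc A ∧ ∀ (M : PAM) (v : Fin m → M), φ.Realize default v ↔ pg k M (A M) (env v)
  | _, _, _, .ofDelta0 h => by
    obtain ⟨A, hA, h⟩ := Dc.delta0 h
    exact ⟨A, hA, fun M v => by rw [h, pg]⟩
  | _, _, _, .ofSigma h => by
    obtain ⟨A, hA, h⟩ := sigma_rep h
    obtain ⟨A', hA', h'⟩ := sat_ofPi hA
    exact ⟨A', hA', fun M v => by rw [h, (h' _ _).2]⟩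
  | _, _, _, .all h => by
    obtain ⟨A, hA, h⟩ := pi_rep h
    obtain ⟨A', hA', h'⟩ := sat_ex hA
    exact ⟨A', hA', fun M v => by rw [BoundedFormula.realize_all, (h' _ _).2]; simp only [h, env_snoc]⟩
end

/-! ### partial truth, syntactically -/
mutual
def SgE : ℕ → ∀ M : PAM, M → M → Prop
  | 0, _, e, s => ¬ EvS (Fc e s 0)
  | k + 1, M, e, s => ∃ z, PgE k M e (pr s z)
def PgE : ℕ → ∀ M : PAM, M → M → Prop
  | 0, _, e, s => EvS (Fc e s 1)
  | k + 1, M, e, s => ∀ z, SgE k M e (pr s z)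
end

theorem sgE_iff {e : ℕ} {A} (h : Dec e A) (k : ℕ) : ∀ (M : PAM) (s : M),
    (SgE k M e s ↔ sg k M (A M) s) ∧ (PgE k M e s ↔ pg k M (A M) s) := by
  induction k with
  | zero =>
    intro M s
    simp only [SgE, PgE, sg, pg, h M]
    rw [chi_0, chi_1]; simp
  | succ k ih => intro M s; simp only [SgE, PgE, sg, pg, ih, and_self]

def SG (k n : ℕ) (R : ∀ M : PAM, (Fin n → M) → Prop) : Prop :=
  ∃ φ : LA.BoundedFormula Empty n, IsSigmaFml k φ ∧
    ∀ (M : PAM) (v : Fin n → M), φ.Realize default v ↔ R M v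
def PG (k n : ℕ) (R : ∀ M : PAM, (Fin n → M) → Prop) : Prop :=
  ∃ φ : LA.BoundedFormula Empty n, IsPiFml k φ ∧
    ∀ (M : PAM) (v : Fin n → M), φ.Realize default v ↔ R M v

theorem SG.congr {k n} {A B} (h : SG k n A) (e : ∀ M v, A M v ↔ B M v) : SG k n B := by
  obtain ⟨φ, h', h⟩ := h; exact ⟨φ, h', fun M v => (h M v).trans (e M v)⟩
theorem PG.congr {k n} {A B} (h : PG k n A) (e : ∀ M v, A M v ↔ B M v) : PG k n B := by
  obtain ⟨φ, h', h⟩ := h; exact ⟨φ, h', fun M v => (h M v).trans (e M v)⟩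
theorem SG.d0 {n} {A} (h : D0 n A) : SG 1 n A := by
  obtain ⟨φ, h', h⟩ := h; exact ⟨φ, .ofPi (.ofDelta0 h'), h⟩
theorem PG.d0 {n} {A} (h : D0 n A) : PG 1 n A := by
  obtain ⟨φ, h', h⟩ := h; exact ⟨φ, .ofSigma (.ofDelta0 h'), h⟩
theorem SG.pi {k n} {A} (h : PG k n A) : SG (k + 1) n A := by
  obtain ⟨φ, h', h⟩ := h; exact ⟨φ, .ofPi h', h⟩
theorem PG.sig {k n} {A} (h : SG k n A) : PG (k + 1) n A := by
  obtain ⟨φ, h', h⟩ := h; exact ⟨φ, .ofSigma h', h⟩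
theorem SG.ex {k n} {R : ∀ M : PAM, (Fin n → M) → M → Prop}
    (h : SG (k + 1) (n + 1) (fun M v => R M (fun i => v i.castSucc) (v (Fin.last n)))) :
    SG (k + 1) n (fun M v => ∃ x, R M v x) := by
  obtain ⟨φ, h', h⟩ := h
  exact ⟨∃' φ, .ex h', fun M v => by simp [h]⟩
theorem PG.all {k n} {R : ∀ M : PAM, (Fin n → M) → M → Prop}
    (h : PG (k + 1) (n + 1) (fun M v => R M (fun i => v i.castSucc) (v (Fin.last n)))) :
    PG (k + 1) n (fun M v => ∀ x, R M v x) := by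
  obtain ⟨φ, h', h⟩ := h
  exact ⟨∀' φ, .all h', fun M v => by simp [h]⟩

theorem DT.substT {n m} (τ : LA.Term (Empty ⊕ Fin n)) {t : Fin n → ∀ M : PAM, (Fin m → M) → M}
    (ht : ∀ i, DT m (t i)) : DT m (fun M v => τ.realize (Sum.elim default (fun i => t i M v))) := by
  refine term_cases (fun τ => DT m (fun M v => τ.realize (Sum.elim default (fun i => t i M v)))) ?_ ?_ ?_ ?_ ?_ τ
  · intro i; simpa using ht i
  · simpa using DT.z'
  · intro t h; simpa using h.s'
  · intro t u h h'; simpa using h.a' h'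
  · intro t u h h'; simpa using h.m' h'

theorem delta0_subst {n} {φ : LA.BoundedFormula Empty n} (h : IsDelta0 φ) :
    ∀ {m} {t : Fin n → ∀ M : PAM, (Fin m → M) → M} (_ : ∀ i, DT m (t i)),
    D0 m (fun M v => φ.Realize default (fun i => t i M v)) := by
  induction h with
  | falsum => intro m t ht; exact D0.fls
  | equal a b =>
    intro m t ht
    exact (D0.eq (DT.substT a ht) (DT.substT b ht)).congr
      (fun M v => (BoundedFormula.realize_bdEqual _ _).symm)
  | le a b =>
    intro m t ht
    exact (D0.le (DT.substT a ht) (DT.substT b ht)).congr (fun M v => by rw [realize_leF, PAM.l_eq])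
  | imp _ _ ih1 ih2 =>
    intro m t ht
    exact (D0.imp (ih1 ht) (ih2 ht)).congr (fun M v => by rw [BoundedFormula.realize_imp])
  | @ball n a φ _ ih =>
    intro m t ht
    have key : ∀ i, DT (m + 1) ((Fin.snoc (α := fun _ => ∀ M : PAM, (Fin (m + 1) → M) → M)
        (fun (i : Fin n) (M : PAM) (v : Fin (m + 1) → M) => t i M (fun j => v j.castSucc)) (fun M v => v (Fin.last m))) i) := by
      intro i
      refine Fin.lastCases ?_ (fun j => ?_) i
      · simpa using DT.var _
      · simpa using (ht j).wk
    have ih := ih key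
    refine (D0.ball (R := fun M v x => φ.Realize default (Fin.snoc (fun i => t i M v) x : Fin (n + 1) → M))
      (DT.substT a ht) (ih.congr (fun M v => ?_))).congr (fun M v => ?_)
    · refine iff_of_eq (congrArg _ ?_)
      funext i
      refine Fin.lastCases ?_ (fun j => ?_) i <;> simp
    · simp [realize_wk, PAM.l_eq, -Term.realize_relabel]
  | @bex n a φ _ ih =>
    intro m t ht
    have key : ∀ i, DT (m + 1) ((Fin.snoc (α := fun _ => ∀ M : PAM, (Fin (m + 1) → M) → M)
        (fun (i : Fin n) (M : PAM) (v : Fin (m + 1) → M) => t i M (fun j => v j.castSucc)) (fun M v => v (Fin.last m))) i) := by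
      intro i
      refine Fin.lastCases ?_ (fun j => ?_) i
      · simpa using DT.var _
      · simpa using (ht j).wk
    have ih := ih key
    refine (D0.bex (R := fun M v x => φ.Realize default (Fin.snoc (fun i => t i M v) x : Fin (n + 1) → M))
      (DT.substT a ht) (ih.congr (fun M v => ?_))).congr (fun M v => ?_)
    · refine iff_of_eq (congrArg _ ?_)
      funext i
      refine Fin.lastCases ?_ (fun j => ?_) i <;> simp
    · simp [realize_wk, PAM.l_eq, -Term.realize_relabel]

theorem D0.subst {n m : ℕ} {R} (h : D0 n R) {t : Fin n → ∀ M : PAM, (Fin m → M) → M}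
    (ht : ∀ i, DT m (t i)) : D0 m (fun M v => R M (fun i => t i M v)) := by
  obtain ⟨φ, h', h⟩ := h
  exact (delta0_subst h' ht).congr (fun M v => h M _)

theorem D0.wk {n} {R} (h : D0 n R) : D0 (n + 1) (fun M v => R M (fun i => v i.castSucc)) :=
  h.subst (t := fun i M v => v i.castSucc) (fun i => .var _)

theorem sat_syn (k : ℕ) : ∀ {n : ℕ} {G : ∀ M : PAM, (Fin n → M) → Prop} {e s}, D0 n G → DT n e → DT n s →
    SG (k + 1) n (fun M v => G M v ∧ SgE (k + 1) M (e M v) (s M v)) ∧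
    PG (k + 1) n (fun M v => G M v ∧ PgE (k + 1) M (e M v) (s M v)) := by
  induction k with
  | zero =>
    intro n G e s hG he hs
    constructor
    · refine SG.congr (A := fun M v => ∃ z u m b, G M v ∧ Just u m b ∧ Mem u m b (Fc (e M v) (pr (s M v) z) 1)) ?_ ?_
      · exact .ex (.ex (.ex (.ex (.d0 (.and hG.wk.wk.wk.wk (.and (.just (.var _) (.var _) (.var _))
          (.mem (.var _) (.var _) (.var _) (.Fc he.wk.wk.wk.wk (.pr hs.wk.wk.wk.wk (.var _)) .one))))))))
      · intro M v
        simp only [SgE, PgE, EvS]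
        simp only [exists_and_left]
    · refine PG.congr (A := fun M v => ∀ z u m b, G M v ∧ ¬ (Just u m b ∧ Mem u m b (Fc (e M v) (pr (s M v) z) 0))) ?_ ?_
      · exact .all (.all (.all (.all (.d0 (.and hG.wk.wk.wk.wk (.not (.and (.just (.var _) (.var _) (.var _))
          (.mem (.var _) (.var _) (.var _) (.Fc he.wk.wk.wk.wk (.pr hs.wk.wk.wk.wk (.var _)) .zero)))))))))
      · intro M v
        simp only [SgE, PgE, EvS, not_exists]
        simp only [forall_and, forall_const]
  | succ k ih =>
    intro n G e s hG he hs
    constructor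
    · refine SG.congr (A := fun M v => ∃ z, G M v ∧ PgE (k + 1) M (e M v) (pr (s M v) z)) ?_ ?_
      · exact .ex (.pi (ih hG.wk he.wk (.pr hs.wk (.var _))).2)
      · intro M v
        rw [SgE]
        simp only [exists_and_left]
    · refine PG.congr (A := fun M v => ∀ z, G M v ∧ SgE (k + 1) M (e M v) (pr (s M v) z)) ?_ ?_
      · exact .all (.sig (ih hG.wk he.wk (.pr hs.wk (.var _))).1)
      · intro M v
        rw [PgE]
        simp only [forall_and, forall_const]

theorem sat_syn_not (k : ℕ) : ∀ {n : ℕ} {e s}, DT n e → DT n s →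
    PG (k + 1) n (fun M v => ¬ SgE (k + 1) M (e M v) (s M v)) ∧
    SG (k + 1) n (fun M v => ¬ PgE (k + 1) M (e M v) (s M v)) := by
  induction k with
  | zero =>
    intro n e s he hs
    constructor
    · refine PG.congr (A := fun M v => ∀ z u m b, ¬ (Just u m b ∧ Mem u m b (Fc (e M v) (pr (s M v) z) 1))) ?_ ?_
      · exact .all (.all (.all (.all (.d0 (.not (.and (.just (.var _) (.var _) (.var _))
          (.mem (.var _) (.var _) (.var _) (.Fc he.wk.wk.wk.wk (.pr hs.wk.wk.wk.wk (.var _)) .one))))))))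
      · intro M v
        simp only [SgE, PgE, EvS, not_exists]
    · refine SG.congr (A := fun M v => ∃ z u m b, (Just u m b ∧ Mem u m b (Fc (e M v) (pr (s M v) z) 0))) ?_ ?_
      · exact .ex (.ex (.ex (.ex (.d0 (.and (.just (.var _) (.var _) (.var _))
          (.mem (.var _) (.var _) (.var _) (.Fc he.wk.wk.wk.wk (.pr hs.wk.wk.wk.wk (.var _)) .zero)))))))
      · intro M v
        simp only [SgE, PgE, EvS, not_forall, not_not]
  | succ k ih =>
    intro n e s he hs
    constructor
    · refine PG.congr (A := fun M v => ∀ z, ¬ PgE (k + 1) M (e M v) (pr (s M v) z)) ?_ ?_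
      · exact .all (.sig (ih he.wk (.pr hs.wk (.var _))).2)
      · intro M v
        rw [SgE, not_exists]
    · refine SG.congr (A := fun M v => ∃ z, ¬ SgE (k + 1) M (e M v) (pr (s M v) z)) ?_ ?_
      · exact .ex (.pi (ih he.wk (.pr hs.wk (.var _))).1)
      · intro M v
        rw [PgE, not_forall]

/-! ### Σ₁ relations over the natural numbers -/
def TN (n : ℕ) (t : (Fin n → ℕ) → ℕ) : Prop := ∃ t', DT n t' ∧ ∀ v : Fin n → ℕ, t' NN v = t v
def N0 (n : ℕ) (R : (Fin n → ℕ) → Prop) : Prop := ∃ R', D0 n R' ∧ ∀ v : Fin n → ℕ, R' NN v ↔ R v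

theorem TN.var {n} (i : Fin n) : TN n (fun v => v i) := ⟨_, .var i, fun _ => rfl⟩
theorem TN.zero {n} : TN n (fun _ => 0) := ⟨_, .zero, fun _ => rfl⟩
theorem TN.one {n} : TN n (fun _ => 1) := ⟨_, .one, fun _ => rfl⟩
theorem TN.add {n} {t u} (h : TN n t) (k : TN n u) : TN n (fun v => t v + u v) := by
  obtain ⟨t', h, e⟩ := h
  obtain ⟨u', k, e'⟩ := k
  exact ⟨_, h.add k, fun v => congrArg₂ (fun x y : ℕ => x + y) (e v) (e' v)⟩
theorem TN.mul {n} {t u} (h : TN n t) (k : TN n u) : TN n (fun v => t v * u v) := by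
  obtain ⟨t', h, e⟩ := h
  obtain ⟨u', k, e'⟩ := k
  exact ⟨_, h.mul k, fun v => congrArg₂ (fun x y : ℕ => x * y) (e v) (e' v)⟩
theorem TN.wk {n} {t} (h : TN n t) : TN (n + 1) (fun v => t (fun i => v i.castSucc)) := by
  obtain ⟨t', h, e⟩ := h
  exact ⟨_, h.wk, fun v => e _⟩
theorem N0.congr {n} {A B} (h : N0 n A) (e : ∀ v, A v ↔ B v) : N0 n B := by
  obtain ⟨R, h, k⟩ := h; exact ⟨R, h, fun v => (k v).trans (e v)⟩
theorem N0.imp {n} {A B} (h : N0 n A) (k : N0 n B) : N0 n (fun v => A v → B v) := by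
  obtain ⟨R, h, e⟩ := h; obtain ⟨S, k, e'⟩ := k
  exact ⟨_, h.imp k, fun v => by rw [e, e']⟩
theorem N0.and {n} {A B} (h : N0 n A) (k : N0 n B) : N0 n (fun v => A v ∧ B v) := by
  obtain ⟨R, h, e⟩ := h; obtain ⟨S, k, e'⟩ := k
  exact ⟨_, h.and k, fun v => by rw [e, e']⟩
theorem N0.or {n} {A B} (h : N0 n A) (k : N0 n B) : N0 n (fun v => A v ∨ B v) := by
  obtain ⟨R, h, e⟩ := h; obtain ⟨S, k, e'⟩ := k
  exact ⟨_, h.or k, fun v => by rw [e, e']⟩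
theorem N0.not {n} {A} (h : N0 n A) : N0 n (fun v => ¬ A v) := by
  obtain ⟨R, h, e⟩ := h
  exact ⟨_, h.not, fun v => by rw [e]⟩
theorem N0.eq {n} {t u} (h : TN n t) (k : TN n u) : N0 n (fun v => t v = u v) := by
  obtain ⟨R, h, e⟩ := h; obtain ⟨S, k, e'⟩ := k
  exact ⟨_, D0.eq h k, fun v => by rw [e, e']⟩
theorem N0.le {n} {t u} (h : TN n t) (k : TN n u) : N0 n (fun v => t v ≤ u v) := by
  obtain ⟨R, h, e⟩ := h; obtain ⟨S, k, e'⟩ := k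
  exact ⟨_, D0.le h k, fun v => by rw [e, e']; exact NN_l _ _⟩
theorem N0.lt {n} {t u} (h : TN n t) (k : TN n u) : N0 n (fun v => t v < u v) :=
  (N0.le k h).not.congr (fun _ => not_le)
theorem N0.ball {n} {t} {R : (Fin n → ℕ) → ℕ → Prop} (ht : TN n t)
    (h : N0 (n + 1) (fun v => R (fun i => v i.castSucc) (v (Fin.last n)))) :
    N0 n (fun v => ∀ x ≤ t v, R v x) := by
  obtain ⟨t', ht, e⟩ := ht
  obtain ⟨R', h, e'⟩ := h
  refine ⟨_, D0.ball (R := fun M v x => R' M (Fin.snoc v x)) ht (h.congr fun M v => ?_), fun v => ?_⟩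
  · refine iff_of_eq (congrArg _ ?_)
    funext i
    refine Fin.lastCases ?_ (fun j => ?_) i <;> simp
  · simp only [e, e', Fin.snoc_castSucc, Fin.snoc_last]
    exact Iff.rfl
theorem N0.bex {n} {t} {R : (Fin n → ℕ) → ℕ → Prop} (ht : TN n t)
    (h : N0 (n + 1) (fun v => R (fun i => v i.castSucc) (v (Fin.last n)))) :
    N0 n (fun v => ∃ x ≤ t v, R v x) :=
  (N0.ball (R := fun v x => ¬ R v x) ht h.not).not.congr (fun v => by push Not; rfl)
theorem N0.subst {n m : ℕ} {R} (h : N0 n R) {t : Fin n → (Fin m → ℕ) → ℕ}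
    (ht : ∀ i, TN m (t i)) : N0 m (fun v => R (fun i => t i v)) := by
  obtain ⟨R', h, e⟩ := h
  choose t' ht' e' using ht
  refine ⟨_, h.subst ht', fun v => ?_⟩
  simp only [e']
  exact e _

def S1 (n : ℕ) (R : (Fin n → ℕ) → Prop) : Prop :=
  ∃ R' : (Fin n → ℕ) → ℕ → Prop, N0 (n + 1) (fun v => R' (fun i => v i.castSucc) (v (Fin.last n))) ∧
    (∀ v w w', w ≤ w' → R' v w → R' v w') ∧ ∀ v, R v ↔ ∃ w, R' v w

theorem S1.congr {n} {A B} (h : S1 n A) (e : ∀ v, A v ↔ B v) : S1 n B := by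
  obtain ⟨R, h, h', k⟩ := h; exact ⟨R, h, h', fun v => (e v).symm.trans (k v)⟩

theorem S1.n0 {n R} (h : N0 n R) : S1 n R :=
  ⟨fun v _ => R v, h.subst (t := fun i v => v i.castSucc) (fun i => .var _), fun _ _ _ _ h => h, by simp⟩
theorem S1.and {n} {A B} (h : S1 n A) (k : S1 n B) : S1 n (fun v => A v ∧ B v) := by
  obtain ⟨R, h, m, e⟩ := h; obtain ⟨S, k, m', e'⟩ := k
  refine ⟨fun v w => R v w ∧ S v w, h.and k, fun v w w' l h => ⟨m v w w' l h.1, m' v w w' l h.2⟩, fun v => ?_⟩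
  beta_reduce
  rw [e, e']
  constructor
  · rintro ⟨⟨a, ha⟩, b, hb⟩
    exact ⟨max a b, m _ _ _ (le_max_left _ _) ha, m' _ _ _ (le_max_right _ _) hb⟩
  · rintro ⟨a, h, h'⟩; exact ⟨⟨a, h⟩, a, h'⟩
theorem S1.subst {n m : ℕ} {R} (h : S1 n R) {t : Fin n → (Fin m → ℕ) → ℕ}
    (ht : ∀ i, TN m (t i)) : S1 m (fun v => R (fun i => t i v)) := by
  obtain ⟨R', h, l, e⟩ := h
  refine ⟨fun v w => R' (fun i => t i v) w, ?_, fun v w w' => l _ w w', fun v => e _⟩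
  have := h.subst (m := m + 1) (t := Fin.snoc (α := fun _ => (Fin (m + 1) → ℕ) → ℕ)
    (fun i v => t i (fun j => v j.castSucc)) (fun v => v (Fin.last m))) ?_
  · simpa using this
  · intro i
    refine Fin.lastCases ?_ (fun j => ?_) i
    · simpa using TN.var _
    · simpa using (ht j).wk
theorem S1.ex {n} {R : (Fin n → ℕ) → ℕ → Prop}
    (h : S1 (n + 1) (fun v => R (fun i => v i.castSucc) (v (Fin.last n)))) :
    S1 n (fun v => ∃ x, R v x) := by
  obtain ⟨R', h, l, e⟩ := h
  refine ⟨fun v w => ∃ x ≤ w, R' (Fin.snoc v x) w, ?_, ?_, fun v => ?_⟩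
  · refine N0.bex (R := fun v x => R' (Fin.snoc (fun i : Fin n => v i.castSucc) x) (v (Fin.last n))) (.var _) ?_
    have := h.subst (m := n + 1 + 1) (t := Fin.snoc (α := fun _ => (Fin (n + 2) → ℕ) → ℕ)
      (Fin.snoc (α := fun _ => (Fin (n + 2) → ℕ) → ℕ) (fun i v => v i.castSucc.castSucc) (fun v => v (Fin.last (n + 1))))
       (fun v => v (Fin.last n).castSucc)) ?_
    · refine this.congr (fun v => ?_)
      simp only [Fin.snoc_castSucc, Fin.snoc_last]
      refine iff_of_eq (congrFun (congrArg _ ?_) _)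
      funext i
      refine Fin.lastCases ?_ (fun j => ?_) i <;> simp
    · intro i
      refine Fin.lastCases ?_ (fun j => Fin.lastCases ?_ (fun j => ?_) j) i
      · simpa using TN.var _
      · simpa using TN.var _
      · simpa using TN.var _
  · rintro v w w' hw ⟨x, hx, h⟩; exact ⟨x, hx.trans hw, l _ _ _ hw h⟩
  · have e := fun x => e (Fin.snoc v x)
    simp only [Fin.snoc_castSucc, Fin.snoc_last] at e
    constructor
    · rintro ⟨x, hx⟩
      obtain ⟨w, hw⟩ := (e x).1 hx
      exact ⟨max x w, x, le_max_left _ _, l _ _ _ (le_max_right _ _) hw⟩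
    · rintro ⟨w, x, _, h⟩; exact ⟨x, (e x).2 ⟨w, h⟩⟩
theorem S1.ball {n} {t} {R : (Fin n → ℕ) → ℕ → Prop} (ht : TN n t)
    (h : S1 (n + 1) (fun v => R (fun i => v i.castSucc) (v (Fin.last n)))) :
    S1 n (fun v => ∀ x < t v, R v x) := by
  obtain ⟨R', h, l, e⟩ := h
  refine ⟨fun v w => ∀ x ≤ t v, x < t v → R' (Fin.snoc v x) w, ?_, ?_, fun v => ?_⟩
  · refine N0.ball (R := fun v x => x < t (fun i : Fin n => v i.castSucc) → R' (Fin.snoc (fun i : Fin n => v i.castSucc) x) (v (Fin.last n))) ht.wk (.imp (.lt (.var _) ht.wk.wk) ?_)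
    have := h.subst (m := n + 1 + 1) (t := Fin.snoc (α := fun _ => (Fin (n + 2) → ℕ) → ℕ)
      (Fin.snoc (α := fun _ => (Fin (n + 2) → ℕ) → ℕ) (fun i v => v i.castSucc.castSucc) (fun v => v (Fin.last (n + 1))))
       (fun v => v (Fin.last n).castSucc)) ?_
    · refine this.congr (fun v => ?_)
      simp only [Fin.snoc_castSucc, Fin.snoc_last]
      refine iff_of_eq (congrFun (congrArg _ ?_) _)
      funext i
      refine Fin.lastCases ?_ (fun j => ?_) i <;> simp
    · intro i
      refine Fin.lastCases ?_ (fun j => Fin.lastCases ?_ (fun j => ?_) j) i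
      · simpa using TN.var _
      · simpa using TN.var _
      · simpa using TN.var _
  · intro v w w' hw h x hx hx'; exact l _ _ _ hw (h x hx hx')
  · have e := fun x => e (Fin.snoc v x)
    simp only [Fin.snoc_castSucc, Fin.snoc_last] at e
    constructor
    · intro h
      have : ∀ b ≤ t v, ∃ w, ∀ x < b, R' (Fin.snoc v x) w := by
        intro b
        induction b with
        | zero => intro _; exact ⟨0, fun x hx => absurd hx (by omega)⟩
        | succ b ih =>
          intro hb
          obtain ⟨w, hw⟩ := ih (by omega)
          obtain ⟨w', hw'⟩ := (e b).1 (h b (by omega))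
          refine ⟨max w w', fun x hx => ?_⟩
          rcases Nat.lt_succ_iff_lt_or_eq.1 hx with hx | rfl
          · exact l _ _ _ (le_max_left _ _) (hw x hx)
          · exact l _ _ _ (le_max_right _ _) hw'
      obtain ⟨w, hw⟩ := this _ le_rfl
      exact ⟨w, fun x _ hx => hw x hx⟩
    · rintro ⟨w, hw⟩ x hx; exact (e x).2 ⟨w, hw x hx.le hx⟩

theorem N0.pair {n} {a b c} (ha : TN n a) (hb : TN n b) (hc : TN n c) :
    N0 n (fun v => c v = Nat.pair (a v) (b v)) := by
  refine (N0.or (.and (.lt ha hb) (.eq hc (.add (.mul hb hb) ha)))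
    (.and (.not (.lt ha hb)) (.eq hc (.add (.add (.mul ha ha) ha) hb)))).congr (fun v => ?_)
  unfold Nat.pair
  split_ifs with h <;> simp [h]

theorem N0.beta {n} {c i y} (hc : TN n c) (hi : TN n i) (hy : TN n y) :
    N0 n (fun v => y v = Nat.beta (c v) (i v)) := by
  refine N0.congr (A := fun v => ∃ a ≤ c v, ∃ b ≤ c v, c v = Nat.pair a b ∧ ∃ q ≤ a,
    a = ((i v + 1) * b + 1) * q + y v ∧ y v < (i v + 1) * b + 1) ?_ (fun v => ?_)
  · exact .bex hc (.bex hc.wk (.and (.pair (.var _) (.var _) hc.wk.wk) (.bex (.var _)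
      (.and (.eq (.var _) (.add (.mul (.add (.mul (.add hi.wk.wk.wk .one) (.var _)) .one) (.var _)) hy.wk.wk.wk))
        (.lt hy.wk.wk.wk (.add (.mul (.add hi.wk.wk.wk .one) (.var _)) .one))))))
  · unfold Nat.beta
    constructor
    · rintro ⟨a, _, b, _, h, q, _, h', h''⟩
      simp only [h, Nat.unpair_pair, h']
      rw [Nat.mul_add_mod, Nat.mod_eq_of_lt h'']
    · intro h
      refine ⟨_, Nat.unpair_left_le _, _, Nat.unpair_right_le _, (Nat.pair_unpair _).symm, _,
        Nat.div_le_self _ ((i v + 1) * (Nat.unpair (c v)).2 + 1), ?_, ?_⟩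
      · rw [h]; exact (Nat.div_add_mod _ _).symm
      · rw [h]; exact Nat.mod_lt _ (by omega)

def GS (f : ℕ →. ℕ) : Prop := S1 2 (fun v => v 1 ∈ f (v 0))

theorem GS.app {f} (h : GS f) {n} {t u} (ht : TN n t) (hu : TN n u) : S1 n (fun v => u v ∈ f (t v)) :=
  S1.subst (n := 2) (t := ![t, u]) h (by intro i; fin_cases i; exact ht; exact hu)

theorem partrec_GS {f : ℕ →. ℕ} (hf : Nat.Partrec f) : GS f := by
  induction hf with
  | zero => exact (S1.n0 (N0.eq (.var 1) .zero)).congr (fun v => by simp [pure, PFun.pure])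
  | succ => exact (S1.n0 (N0.eq (.var 1) (.add (.var 0) .one))).congr (fun v => by simp)
  | left =>
    refine (S1.ex (R := fun v b => v 0 = Nat.pair (v 1) b) (.n0 (.pair (.var _) (.var _) (.var _)))).congr (fun v => ?_)
    simp only [PFun.coe_val, Part.mem_some_iff]
    constructor
    · rintro ⟨b, h⟩; rw [h]; simp
    · intro h; exact ⟨_, by rw [h]; exact (Nat.pair_unpair _).symm⟩
  | right =>
    refine (S1.ex (R := fun v b => v 0 = Nat.pair b (v 1)) (.n0 (.pair (.var _) (.var _) (.var _)))).congr (fun v => ?_)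
    simp only [PFun.coe_val, Part.mem_some_iff]
    constructor
    · rintro ⟨b, h⟩; rw [h]; simp
    · intro h; exact ⟨_, by rw [h]; exact (Nat.pair_unpair _).symm⟩
  | @pair f g _ _ hf hg =>
    refine (S1.ex (R := fun v a => ∃ b, a ∈ f (v 0) ∧ b ∈ g (v 0) ∧ v 1 = Nat.pair a b)
      (.ex (.and (hf.app (.var _) (.var _)) (.and (hg.app (.var _) (.var _)) (.n0 (.pair (.var _) (.var _) (.var _))))))).congr (fun v => ?_)
    simp [Seq.seq]
    constructor
    · rintro ⟨a, h, b, h', h''⟩; exact ⟨a, h, b, h', h''.symm⟩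
    · rintro ⟨a, h, b, h', h''⟩; exact ⟨a, h, b, h', h''.symm⟩
  | @comp f g _ _ hf hg =>
    refine (S1.ex (R := fun v a => a ∈ g (v 0) ∧ v 1 ∈ f a)
      (.and (hg.app (.var _) (.var _)) (hf.app (.var _) (.var _)))).congr (fun v => ?_)
    exact Part.mem_bind_iff.symm
  | @prec f g _ _ hf hg =>
    refine S1.congr (A := fun v => ∃ a, ∃ n, ∃ c, v 0 = Nat.pair a n ∧ v 1 = Nat.beta c n ∧
      (∃ y, y = Nat.beta c 0 ∧ y ∈ f a) ∧ ∀ i < n, ∃ y, y = Nat.beta c i ∧ ∃ y', y' = Nat.beta c (i + 1) ∧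
        ∃ z, z = Nat.pair i y ∧ ∃ z', z' = Nat.pair a z ∧ y' ∈ g z') ?_ (fun v => ?_)
    · exact .ex (.ex (.ex (.and (.n0 (.pair (.var _) (.var _) (.var _))) (.and (.n0 (.beta (.var _) (.var _) (.var _)))
        (.and (.ex (.and (.n0 (.beta (.var _) .zero (.var _))) (hf.app (.var _) (.var _))))
          (.ball (.var _) (.ex (.and (.n0 (.beta (.var _) (.var _) (.var _))) (.ex (.and (.n0 (.beta (.var _) (.add (.var _) .one) (.var _)))
            (.ex (.and (.n0 (.pair (.var _) (.var _) (.var _))) (.ex (.and (.n0 (.pair (.var _) (.var _) (.var _)))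
              (hg.app (.var _) (.var _))))))))))))))))
    · let F : ℕ → ℕ → Part ℕ := fun a n => Nat.rec (f a) (fun y IH => IH.bind fun i => g (Nat.pair a (Nat.pair y i))) n
      have hF : ∀ a n, F a (n + 1) = (F a n).bind fun i => g (Nat.pair a (Nat.pair n i)) := fun _ _ => rfl
      change _ ↔ v 1 ∈ F (v 0).unpair.1 (v 0).unpair.2
      constructor
      · rintro ⟨a, n, c, h0, h1, ⟨y, rfl, h2⟩, h3⟩
        rw [h0, h1]; simp only [Nat.unpair_pair]
        have : ∀ i ≤ n, Nat.beta c i ∈ F a i := by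
          intro i
          induction i with
          | zero => intro _; exact h2
          | succ i ih =>
            intro hi
            obtain ⟨_, rfl, _, rfl, _, rfl, _, rfl, h⟩ := h3 i (by omega)
            rw [hF, Part.mem_bind_iff]
            exact ⟨_, ih (by omega), h⟩
        exact this n le_rfl
      · intro h
        have : ∀ a n y, y ∈ F a n → ∃ s : ℕ → ℕ, s n = y ∧ s 0 ∈ f a ∧
            ∀ i < n, s (i + 1) ∈ g (Nat.pair a (Nat.pair i (s i))) := by
          intro a n
          induction n with
          | zero => intro y hy; exact ⟨fun _ => y, rfl, hy, by simp⟩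
          | succ n ih =>
            intro y hy
            rw [hF, Part.mem_bind_iff] at hy
            obtain ⟨i, hi, hy⟩ := hy
            obtain ⟨s, h1, h2, h3⟩ := ih i hi
            refine ⟨fun j => if j ≤ n then s j else y, by simp, by simpa using h2, ?_⟩
            intro j hj
            rcases Nat.lt_succ_iff_lt_or_eq.1 hj with hj | rfl
            · simp only [show j + 1 ≤ n by omega, show j ≤ n by omega, if_true]; exact h3 j hj
            · simp [h1, hy]
        obtain ⟨s, h1, h2, h3⟩ := this _ _ _ h
        generalize ha : (Nat.unpair (v 0)).1 = a at *
        generalize hn : (Nat.unpair (v 0)).2 = n at *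
        let c := Nat.unbeta ((List.range (n + 1)).map s)
        have hc : ∀ i ≤ n, Nat.beta c i = s i := by
          intro i hi
          have := Nat.beta_unbeta_coe ((List.range (n + 1)).map s) ⟨i, by simp; omega⟩
          simpa using this
        refine ⟨a, n, c, ?_, ?_, ⟨_, rfl, ?_⟩, ?_⟩
        · rw [← ha, ← hn]; exact (Nat.pair_unpair _).symm
        · rw [hc n le_rfl, h1]
        · rw [hc 0 (by omega)]; exact h2
        · intro i hi
          refine ⟨_, rfl, _, rfl, _, rfl, _, rfl, ?_⟩
          rw [hc i (by omega), hc (i + 1) (by omega)]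
          exact h3 i hi
  | @rfind f _ hf =>
    refine S1.congr (A := fun v => (∃ z, z = Nat.pair (v 0) (v 1) ∧ ∃ y, y = 0 ∧ y ∈ f z) ∧ ∀ m < v 1, ∃ z, z = Nat.pair (v 0) m ∧
      ∃ y, y ∈ f z ∧ ¬ y = 0) ?_ (fun v => ?_)
    · exact .and (.ex (.and (.n0 (.pair (.var _) (.var _) (.var _))) (.ex (.and (.n0 (.eq (.var _) .zero)) (hf.app (.var _) (.var _))))))
        (.ball (.var _) (.ex (.and (.n0 (.pair (.var _) (.var _) (.var _))) (.ex (.and (hf.app (.var _) (.var _)) (.n0 (.not (.eq (.var _) .zero))))))))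
    · refine Iff.trans ?_ Nat.mem_rfind.symm
      simp

/-- a Δ₀ matrix for the halting relation -/
theorem exists_K : ∃ K : ∀ M : PAM, (Fin 3 → M) → Prop, D0 3 K ∧ ∀ c e : ℕ,
    ((∃ w : ℕ, K NN ![c, e, w]) ↔ (Nat.Partrec.Code.eval (Denumerable.ofNat Nat.Partrec.Code c) (Nat.pair c e)).Dom) := by
  have h0 : Nat.Partrec (fun c => Nat.Partrec.Code.eval (Denumerable.ofNat Nat.Partrec.Code c.unpair.1) c) := by
    have : Partrec (fun c : ℕ => Nat.Partrec.Code.eval (Denumerable.ofNat Nat.Partrec.Code c.unpair.1) c) :=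
      Nat.Partrec.Code.eval_part.comp ((Computable.ofNat _).comp (Computable.fst.comp Computable.unpair)) Computable.id
    exact Partrec.nat_iff.1 this
  have h1 := partrec_GS h0
  have h2 : S1 2 (fun v => ∃ y, ∃ z, z = Nat.pair (v 0) (v 1) ∧
      y ∈ Nat.Partrec.Code.eval (Denumerable.ofNat Nat.Partrec.Code z.unpair.1) z) :=
    .ex (.ex (.and (.n0 (.pair (.var _) (.var _) (.var _))) (h1.app (.var _) (.var _))))
  obtain ⟨R', ⟨K, hK, e⟩, _, h3⟩ := h2
  refine ⟨K, hK, fun c n => ?_⟩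
  have h3 := h3 ![c, n]
  simp only [Matrix.cons_val_zero, Matrix.cons_val_one] at h3
  have : (∃ w : ℕ, K NN ![c, n, w]) ↔ ∃ w, R' ![c, n] w := by
    refine exists_congr (fun w => ?_)
    refine (e ![c, n, w]).trans ?_
    refine iff_of_eq (congrFun (congrArg _ ?_) _)
    funext i; fin_cases i <;> rfl
  rw [this, ← h3, Part.dom_iff_mem]
  simp

/-! ### Semidecidability of unsatisfiability of primitive recursive sets of clauses -/
abbrev Cnf := List (List (ℕ × Bool))

def SatC (val : ℕ → Bool) (F : Cnf) : Prop := ∀ C ∈ F, ∃ l ∈ C, val l.1 = l.2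

theorem cnf_compact (F : ℕ → Cnf) (h : ∀ B : ℕ, ∃ val : ℕ → Bool, ∀ x < B, ∀ C ∈ F x,
    (∀ l ∈ C, l.1 < B) → ∃ l ∈ C, val l.1 = l.2) : ∃ val, ∀ x, SatC val (F x) := by
  let K : ℕ → Set (ℕ → Bool) := fun B => {val | ∀ x < B, ∀ C ∈ F x,
    (∀ l ∈ C, l.1 < B) → ∃ l ∈ C, val l.1 = l.2}
  have hc : ∀ B, IsClosed (K B) := by
    intro B
    have : K B = ⋂ (x : ℕ) (_ : x < B) (C : List (ℕ × Bool)) (_ : C ∈ F x) (_ : ∀ l ∈ C, l.1 < B),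
        ⋃ l ∈ {l | l ∈ C}, {val : ℕ → Bool | val l.1 = l.2} := by
      ext val; simp [K]
    rw [this]
    refine isClosed_iInter fun x => isClosed_iInter fun _ => isClosed_iInter fun C =>
      isClosed_iInter fun _ => isClosed_iInter fun _ => ?_
    refine Set.Finite.isClosed_biUnion (List.finite_toSet C) (fun l _ => ?_)
    exact isClosed_eq (continuous_apply _) continuous_const
  have := IsCompact.nonempty_iInter_of_sequence_nonempty_isCompact_isClosed K ?_ h
    (hc 0).isCompact hc
  · obtain ⟨val, hv⟩ := this
    rw [Set.mem_iInter] at hv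
    refine ⟨val, fun x C hC => ?_⟩
    obtain ⟨B, hB⟩ : ∃ B, ∀ l ∈ C, l.1 < B := by
      clear hC
      induction C with
      | nil => exact ⟨0, by simp⟩
      | cons a C ih =>
        obtain ⟨B, hB⟩ := ih
        refine ⟨max B (a.1 + 1), fun l hl => ?_⟩
        rcases List.mem_cons.1 hl with rfl | hl
        · omega
        · have := hB l hl; omega
    exact hv (max B (x + 1)) x (by omega) C hC (fun l hl => by have := hB l hl; omega)
  · intro B val hv x hx C hC hl
    exact hv x (by omega) C hC (fun l h => by have := hl l h; omega)

theorem cnf_stage (F : ℕ → Cnf) : (¬ ∃ val, ∀ x, SatC val (F x)) ↔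
    ∃ B, ∀ b < 2 ^ B, ∃ x < B, ∃ C ∈ F x, ∀ l ∈ C, l.1 < B ∧ ¬ (b.testBit l.1 = l.2) := by
  constructor
  · intro h
    by_contra hn
    push Not at hn
    apply h
    apply cnf_compact
    intro B
    obtain ⟨b, _, hb⟩ := hn B
    refine ⟨fun i => b.testBit i, fun x hx C hC hl => ?_⟩
    obtain ⟨l, hl', h⟩ := hb x hx C hC
    exact ⟨l, hl', h (hl l hl')⟩
  · rintro ⟨B, hB⟩ ⟨val, hv⟩
    obtain ⟨x, _, C, hC, hl⟩ := hB (Nat.ofBits (fun i : Fin B => val i)) (Nat.ofBits_lt_two_pow _)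
    obtain ⟨l, hl', h⟩ := hv x C hC
    obtain ⟨h1, h2⟩ := hl l hl'
    rw [Nat.testBit_ofBits_lt _ _ h1] at h2
    exact h2 h

theorem prim_pow2 : Primrec (fun n : ℕ => 2 ^ n) := by
  have : Primrec (Nat.rec (motive := fun _ => ℕ) 1 (fun _ r => r * 2)) :=
    Primrec.nat_rec₁ 1 (Primrec.nat_mul.comp Primrec.snd (Primrec.const 2))
  refine this.of_eq (fun n => ?_)
  induction n with
  | zero => rfl
  | succ n ih => rw [pow_succ, ← ih]

theorem prim_testBit : Primrec₂ Nat.testBit := by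
  have : PrimrecRel (fun b i : ℕ => b / 2 ^ i % 2 = 1) :=
    Primrec.eq.comp (Primrec.nat_mod.comp (Primrec.nat_div.comp Primrec.fst (prim_pow2.comp Primrec.snd))
      (Primrec.const 2)) (Primrec.const 1)
  refine this.decide.of_eq (fun b i => ?_)
  rw [Nat.testBit_eq_decide_div_mod_eq]

theorem prim_exists_lt {β : Type} [Primcodable β] {R : ℕ → β → Prop} (hf : PrimrecRel R) :
    PrimrecRel fun n y => ∃ x < n, R x y :=
  (hf.exists_mem_list.comp (Primrec.list_range.comp Primrec.fst) Primrec.snd).of_eq (by simp)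

theorem prim_forall_lt {β : Type} [Primcodable β] {R : ℕ → β → Prop} (hf : PrimrecRel R) :
    PrimrecRel fun n y => ∀ x < n, R x y :=
  (hf.forall_mem_list.comp (Primrec.list_range.comp Primrec.fst) Primrec.snd).of_eq (by simp)

theorem re_cnf {P : Type} [Primcodable P] (F : P → ℕ → Cnf) (h : Primrec₂ F) :
    REPred (fun p => ¬ ∃ val, ∀ x, SatC val (F p x)) := by
  have h1 : PrimrecRel (fun (l : ℕ × Bool) (y : ℕ × ℕ) => l.1 < y.2 ∧ ¬ (y.1.testBit l.1 = l.2)) := by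
    refine PrimrecPred.and ?_ (PrimrecPred.not ?_)
    · exact Primrec.nat_lt.comp (Primrec.fst.comp Primrec.fst) (Primrec.snd.comp Primrec.snd)
    · exact Primrec.eq.comp (prim_testBit.comp (Primrec.fst.comp Primrec.snd) (Primrec.fst.comp Primrec.fst))
        (Primrec.snd.comp Primrec.fst)
  have h2 := h1.forall_mem_list.exists_mem_list
  have h3 : PrimrecRel (fun (x : ℕ) (y : (ℕ × ℕ) × P) => ∃ C ∈ F y.2 x, ∀ l ∈ C, l.1 < y.1.2 ∧ ¬ (y.1.1.testBit l.1 = l.2)) :=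
    h2.comp (h.comp (Primrec.snd.comp Primrec.snd) Primrec.fst) (Primrec.fst.comp Primrec.snd)
  have h4 := prim_exists_lt h3
  have h5 : PrimrecRel (fun (b : ℕ) (y : ℕ × P) => ∃ x < y.1, ∃ C ∈ F y.2 x, ∀ l ∈ C, l.1 < y.1 ∧ ¬ (b.testBit l.1 = l.2)) :=
    h4.comp (Primrec.fst.comp Primrec.snd)
      (Primrec.pair (Primrec.pair Primrec.fst (Primrec.fst.comp Primrec.snd)) (Primrec.snd.comp Primrec.snd))
  have h6 := prim_forall_lt h5
  have h7 : PrimrecRel (fun (p : P) (B : ℕ) => ∀ b < 2 ^ B, ∃ x < B, ∃ C ∈ F p x, ∀ l ∈ C, l.1 < B ∧ ¬ (b.testBit l.1 = l.2)) :=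
    h6.comp (prim_pow2.comp Primrec.snd) (Primrec.pair Primrec.snd Primrec.fst)
  have h8 := Partrec.rfind (h7.decide.to_comp.partrec₂)
  refine h8.dom_re.of_eq (fun p => ?_)
  rw [cnf_stage]
  simp [Nat.rfind_dom]

section
open Encodable

/-! ### Codes of terms and formulas -/
section codes
abbrev FS := (Σ k, LA.Term (Empty ⊕ Fin k)) ⊕ ((Σ n, LA.Relations n) ⊕ ℕ)
abbrev TS (n : ℕ) := (Empty ⊕ Fin n) ⊕ (Σ i, LA.Functions i)
def tcode {n} (t : LA.Term (Empty ⊕ Fin n)) : List ℕ := t.listEncode.map encode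
def fcode {n} (φ : LA.BoundedFormula Empty n) : List ℕ := φ.listEncode.map (encode : FS → ℕ)

theorem encode_map {α} [Encodable α] (l : List α) : encode (l.map encode) = encode l := by
  induction l with
  | nil => rfl
  | cons a l ih => simp [ih]

theorem gnum_eq (φ : Snt) : gnum φ = encode (fcode φ) := (encode_map (α := FS) _).symm

theorem fcode_inj {n} {φ ψ : LA.BoundedFormula Empty n} (h : fcode φ = fcode ψ) : φ = ψ := by
  have := List.map_injective_iff.2 encode_injective h
  have h2 := BoundedFormula.encoding.encode_injective (a₁ := ⟨n, φ⟩) (a₂ := ⟨n, ψ⟩) this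
  simpa using h2

def tsym (n : ℕ) (l : List ℕ) : ℕ := 2 * Nat.pair n (encode l)

theorem tsym_eq {n} (t : LA.Term (Empty ⊕ Fin n)) : encode (Sum.inl ⟨n, t⟩ : FS) = tsym n (tcode t) := by
  rw [encode_inl, encode_sigma_val, tsym, tcode, encode_map]
  rfl

theorem tcode_var {n} (i : Fin n) : tcode (vT i) = [2 * (2 * (i : ℕ) + 1)] := rfl
theorem tcode_zero {n} : tcode (zeroT : LA.Term (Empty ⊕ Fin n)) = [1] := rfl
theorem tcode_succ {n} (t : LA.Term (Empty ⊕ Fin n)) : tcode (succT t) = 5 :: tcode t := by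
  simp only [tcode, succT, Functions.apply₁, Term.listEncode, List.map_cons]
  congr 1
  simp [List.finRange_succ]
theorem tcode_add {n} (t u : LA.Term (Empty ⊕ Fin n)) : tcode (addT t u) = 13 :: (tcode t ++ tcode u) := by
  simp only [tcode, addT, Functions.apply₂, Term.listEncode, List.map_cons]
  congr 1
  simp [List.finRange_succ]
theorem tcode_mul {n} (t u : LA.Term (Empty ⊕ Fin n)) : tcode (mulT t u) = 15 :: (tcode t ++ tcode u) := by
  simp only [tcode, mulT, Functions.apply₂, Term.listEncode, List.map_cons]
  congr 1
  simp [List.finRange_succ]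
theorem fcode_bot {n} : fcode (⊥ : LA.BoundedFormula Empty n) = [2 * (2 * (n + 2) + 1) + 1] := rfl
theorem fcode_eq {n} (t u : LA.Term (Empty ⊕ Fin n)) :
    fcode (t =' u) = [tsym n (tcode t), tsym n (tcode u)] := by
  rw [← tsym_eq, ← tsym_eq]; rfl
theorem fcode_le {n} (t u : LA.Term (Empty ⊕ Fin n)) :
    fcode (leF t u) = [25, 2 * (2 * n + 1) + 1, tsym n (tcode t), tsym n (tcode u)] := by
  rw [← tsym_eq, ← tsym_eq]
  rfl
theorem fcode_imp {n} (φ ψ : LA.BoundedFormula Empty n) :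
    fcode (φ ⟹ ψ) = 3 :: (fcode φ ++ fcode ψ) := by
  simp only [fcode, BoundedFormula.listEncode, List.map_append, List.map_cons]
  rfl
theorem fcode_all {n} (φ : LA.BoundedFormula Empty (n + 1)) :
    fcode (∀' φ) = 7 :: fcode φ := by
  simp only [fcode, BoundedFormula.listEncode, List.map_cons]
  rfl

theorem fml_ind {P : ∀ n, LA.BoundedFormula Empty n → Prop} (h1 : ∀ n, P n ⊥) (h2 : ∀ n t u, P n (t =' u))
    (h3 : ∀ n t u, P n (leF t u)) (h4 : ∀ n φ ψ, P n φ → P n ψ → P n (φ ⟹ ψ))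
    (h5 : ∀ n φ, P (n + 1) φ → P n (∀' φ)) : ∀ {n} (φ), P n φ := by
  intro n φ
  induction φ with
  | falsum => exact h1 _
  | equal t u => exact h2 _ t u
  | @rel n l R ts =>
    match l, R, ts with
    | 2, R, ts =>
      have e : (BoundedFormula.rel R ts : LA.BoundedFormula Empty n) = leF (ts 0) (ts 1) := by
        simp only [leF, Relations.boundedFormula₂, Relations.boundedFormula]; congr 1
        funext i; fin_cases i <;> rfl
      rw [e]; exact h3 _ _ _
  | imp _ _ ih1 ih2 => exact h4 _ _ _ ih1 ih2
  | all _ ih => exact h5 _ _ ih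
end codes

/-! ### Operations of arbitrary structures -/
section ops
variable (M : Type) [LA.Structure M]
def oZ : M := Structure.funMap (show LA.Functions 0 from Unit.unit) ![]
variable {M}
def oS (x : M) : M := Structure.funMap (show LA.Functions 1 from Unit.unit) ![x]
def oA (x y : M) : M := Structure.funMap (show LA.Functions 2 from false) ![x, y]
def oM (x y : M) : M := Structure.funMap (show LA.Functions 2 from true) ![x, y]
def oL (x y : M) : Prop := Structure.RelMap (show LA.Relations 2 from Unit.unit) ![x, y]
variable (M)
def numv : ℕ → M
  | 0 => oZ M
  | n + 1 => oS (numv n)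
variable {M} {n : ℕ} (w : Empty ⊕ Fin n → M)
theorem oreal_var (i : Fin n) : (vT i).realize w = w (Sum.inr i) := rfl
theorem oreal_zero : (zeroT : LA.Term (Empty ⊕ Fin n)).realize w = oZ M := by
  refine (Term.realize_constants).trans ?_
  exact congrArg (Structure.funMap _) (Subsingleton.elim _ _)
theorem oreal_succ (t : LA.Term (Empty ⊕ Fin n)) : (succT t).realize w = oS (t.realize w) :=
  Term.realize_functions_apply₁
theorem oreal_add (t u : LA.Term (Empty ⊕ Fin n)) : (addT t u).realize w = oA (t.realize w) (u.realize w) :=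
  Term.realize_functions_apply₂
theorem oreal_mul (t u : LA.Term (Empty ⊕ Fin n)) : (mulT t u).realize w = oM (t.realize w) (u.realize w) :=
  Term.realize_functions_apply₂
theorem oreal_le (v : Empty → M) (xs : Fin n → M) (t u : LA.Term (Empty ⊕ Fin n)) :
    (leF t u).Realize v xs ↔ oL (t.realize (Sum.elim v xs)) (u.realize (Sum.elim v xs)) :=
  BoundedFormula.realize_rel₂
end ops

end

section
open Encodable

/-! ### The clauses -/
def eS (a : ℕ) : ℕ := 4 * a + 1
def eA (a b : ℕ) : ℕ := 4 * Nat.pair a b + 2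
def eM (a b : ℕ) : ℕ := 4 * Nat.pair a b + 3
def eW (l s : List ℕ) : ℕ := 4 * encode (l, s) + 4
def eN : ℕ → ℕ
  | 0 => 0
  | n + 1 => eS (eN n)

def atm (k : ℕ) (l s : List ℕ) (a : ℕ) : ℕ := encode (k, l, s, a)
def aT (l s : List ℕ) (a : ℕ) : ℕ := atm 0 l s a
def aP (l s : List ℕ) : ℕ := atm 1 l s 0
def aN (l s : List ℕ) : ℕ := atm 2 l s 0
def aE (a b : ℕ) : ℕ := atm 3 [] [a] b
def aL (a b : ℕ) : ℕ := atm 4 [] [a] b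

abbrev Ix := (List ℕ × List ℕ × List ℕ) × (ℕ × ℕ × ℕ × ℕ)
abbrev Qx := (ℕ × ℕ) × Ix
abbrev Qx.l (q : Qx) : List ℕ := q.2.1.1
abbrev Qx.m (q : Qx) : List ℕ := q.2.1.2.1
abbrev Qx.s (q : Qx) : List ℕ := q.2.1.2.2
abbrev Qx.a (q : Qx) : ℕ := q.2.2.1
abbrev Qx.b (q : Qx) : ℕ := q.2.2.2.1
abbrev Qx.c (q : Qx) : ℕ := q.2.2.2.2.1
abbrev Qx.d (q : Qx) : ℕ := q.2.2.2.2.2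

abbrev Clz := Qx → List ℕ × List ℕ

def cVar : Clz := fun q => ([], [aT [2 * (2 * q.l.length + 1)] (q.l ++ q.a :: q.m) q.a])
def cZero : Clz := fun q => ([], [aT [1] q.s 0])
def cSucc : Clz := fun q => ([aT q.l q.s q.a], [aT (5 :: q.l) q.s (eS q.a)])
def cAdd : Clz := fun q => ([aT q.l q.s q.a, aT q.m q.s q.b], [aT (13 :: (q.l ++ q.m)) q.s (eA q.a q.b)])
def cMul : Clz := fun q => ([aT q.l q.s q.a, aT q.m q.s q.b], [aT (15 :: (q.l ++ q.m)) q.s (eM q.a q.b)])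
def cEqP : Clz := fun q => ([aT q.l q.s q.a, aT q.m q.s q.b, aE q.a q.b],
  [aP [tsym q.s.length q.l, tsym q.s.length q.m] q.s])
def cEqN : Clz := fun q => ([aT q.l q.s q.a, aT q.m q.s q.b],
  [aE q.a q.b, aN [tsym q.s.length q.l, tsym q.s.length q.m] q.s])
def cLeP : Clz := fun q => ([aT q.l q.s q.a, aT q.m q.s q.b, aL q.a q.b],
  [aP [25, 2 * (2 * q.s.length + 1) + 1, tsym q.s.length q.l, tsym q.s.length q.m] q.s])
def cLeN : Clz := fun q => ([aT q.l q.s q.a, aT q.m q.s q.b],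
  [aL q.a q.b, aN [25, 2 * (2 * q.s.length + 1) + 1, tsym q.s.length q.l, tsym q.s.length q.m] q.s])
def cBot : Clz := fun q => ([], [aN [2 * (2 * (q.s.length + 2) + 1) + 1] q.s])
def cImp1 : Clz := fun q => ([aP q.l q.s, aN q.m q.s], [aN (3 :: (q.l ++ q.m)) q.s])
def cImp2 : Clz := fun q => ([aN q.l q.s, aP q.m q.s], [aP (3 :: (q.l ++ q.m)) q.s])
def cImp3 : Clz := fun q => ([aN q.l q.s, aN q.m q.s], [aP (3 :: (q.l ++ q.m)) q.s])
def cImp4 : Clz := fun q => ([aP q.l q.s, aP q.m q.s], [aP (3 :: (q.l ++ q.m)) q.s])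
def cAllN : Clz := fun q => ([aN q.l (q.s ++ [q.a])], [aN (7 :: q.l) q.s])
def cAllP : Clz := fun q => ([aP q.l (q.s ++ [eW q.l q.s])], [aP (7 :: q.l) q.s])
def cCon : Clz := fun q => ([aP q.l q.s, aN q.l q.s], [])
def cRefl : Clz := fun q => ([], [aE q.a q.a])
def cSymm : Clz := fun q => ([aE q.a q.b], [aE q.b q.a])
def cTrans : Clz := fun q => ([aE q.a q.b, aE q.b q.c], [aE q.a q.c])
def cES : Clz := fun q => ([aE q.a q.b], [aE (eS q.a) (eS q.b)])
def cEA : Clz := fun q => ([aE q.a q.b, aE q.c q.d], [aE (eA q.a q.c) (eA q.b q.d)])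
def cEM : Clz := fun q => ([aE q.a q.b, aE q.c q.d], [aE (eM q.a q.c) (eM q.b q.d)])
def cEL : Clz := fun q => ([aE q.a q.b, aE q.c q.d, aL q.a q.c], [aL q.b q.d])
def cAx (g : ℕ → List ℕ) : Clz := fun q => ([], [aP (g q.a) [] ])
def cTh (θ : List ℕ) : Clz := fun q => ([], [aP θ [eN q.1.1, eN q.1.2] ])

def cAll (g : ℕ → List ℕ) (θ : List ℕ) : List Clz :=
  [cVar, cZero, cSucc, cAdd, cMul, cEqP, cEqN, cLeP, cLeN, cBot, cImp1, cImp2, cImp3, cImp4, cAllN, cAllP,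
   cCon, cRefl, cSymm, cTrans, cES, cEA, cEM, cEL, cAx g, cTh θ]

section prim
open Primrec
theorem pl : Primrec Qx.l := Primrec.fst.comp (Primrec.fst.comp Primrec.snd)
theorem pm : Primrec Qx.m := Primrec.fst.comp (Primrec.snd.comp (Primrec.fst.comp Primrec.snd))
theorem ps : Primrec Qx.s := Primrec.snd.comp (Primrec.snd.comp (Primrec.fst.comp Primrec.snd))
theorem pa : Primrec Qx.a := Primrec.fst.comp (Primrec.snd.comp Primrec.snd)
theorem pb : Primrec Qx.b := Primrec.fst.comp (Primrec.snd.comp (Primrec.snd.comp Primrec.snd))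
theorem pc : Primrec Qx.c := Primrec.fst.comp (Primrec.snd.comp (Primrec.snd.comp (Primrec.snd.comp Primrec.snd)))
theorem pd : Primrec Qx.d := Primrec.snd.comp (Primrec.snd.comp (Primrec.snd.comp (Primrec.snd.comp Primrec.snd)))

variable {α : Type} [Primcodable α] {a b : α → ℕ} {l m s : α → List ℕ}
theorem p_atm (k : ℕ) (hl : Primrec l) (hs : Primrec s) (ha : Primrec a) : Primrec (fun q => atm k (l q) (s q) (a q)) :=
  Primrec.encode.comp (pair (const k) (pair hl (pair hs ha)))
theorem p_cons (ha : Primrec a) (hl : Primrec l) : Primrec (fun q => a q :: l q) := list_cons.comp ha hl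
theorem p_1 (ha : Primrec a) : Primrec (fun q => [a q]) := p_cons ha (const [])
theorem p_app (hl : Primrec l) (hm : Primrec m) : Primrec (fun q => l q ++ m q) := list_append.comp hl hm
theorem p_lin (n k : ℕ) (ha : Primrec a) : Primrec (fun q => n * a q + k) :=
  nat_add.comp (nat_mul.comp (const n) ha) (const k)
theorem p_aT (hl : Primrec l) (hs : Primrec s) (ha : Primrec a) : Primrec (fun q => aT (l q) (s q) (a q)) := p_atm 0 hl hs ha
theorem p_aP (hl : Primrec l) (hs : Primrec s) : Primrec (fun q => aP (l q) (s q)) := p_atm 1 hl hs (const 0)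
theorem p_aN (hl : Primrec l) (hs : Primrec s) : Primrec (fun q => aN (l q) (s q)) := p_atm 2 hl hs (const 0)
theorem p_aE (ha : Primrec a) (hb : Primrec b) : Primrec (fun q => aE (a q) (b q)) := p_atm 3 (const []) (p_1 ha) hb
theorem p_aL (ha : Primrec a) (hb : Primrec b) : Primrec (fun q => aL (a q) (b q)) := p_atm 4 (const []) (p_1 ha) hb
theorem p_eS (ha : Primrec a) : Primrec (fun q => eS (a q)) := p_lin 4 1 ha
theorem p_eA (ha : Primrec a) (hb : Primrec b) : Primrec (fun q => eA (a q) (b q)) := p_lin 4 2 (Primrec₂.natPair.comp ha hb)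
theorem p_eM (ha : Primrec a) (hb : Primrec b) : Primrec (fun q => eM (a q) (b q)) := p_lin 4 3 (Primrec₂.natPair.comp ha hb)
theorem p_eW (hl : Primrec l) (hm : Primrec m) : Primrec (fun q => eW (l q) (m q)) := p_lin 4 4 (Primrec.encode.comp (pair hl hm))
theorem p_eN (ha : Primrec a) : Primrec (fun q => eN (a q)) := by
  have : Primrec (Nat.rec (motive := fun _ => ℕ) 0 (fun _ r => eS r)) := nat_rec₁ 0 (p_eS Primrec.snd)
  refine (this.of_eq (g := eN) (fun n => ?_)).comp ha
  induction n with
  | zero => rfl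
  | succ n ih => simp only [eN, ← ih]
theorem p_tsym (ha : Primrec a) (hl : Primrec l) : Primrec (fun q => tsym (a q) (l q)) :=
  nat_mul.comp (const 2) (Primrec₂.natPair.comp ha (Primrec.encode.comp hl))

theorem p_len (hl : Primrec l) : Primrec (fun q => (l q).length) := list_length.comp hl

set_option maxHeartbeats 1000000 in
theorem p_all {g : ℕ → List ℕ} (hg : Primrec g) (θ : List ℕ) : ∀ f ∈ cAll g θ, Primrec f := by
  have tl : Primrec (fun q : Qx => aT q.l q.s q.a) := p_aT pl ps pa
  have tm : Primrec (fun q : Qx => aT q.m q.s q.b) := p_aT pm ps pb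
  have Pl : Primrec (fun q : Qx => aP q.l q.s) := p_aP pl ps
  have Pm : Primrec (fun q : Qx => aP q.m q.s) := p_aP pm ps
  have Nl : Primrec (fun q : Qx => aN q.l q.s) := p_aN pl ps
  have Nm : Primrec (fun q : Qx => aN q.m q.s) := p_aN pm ps
  have Eab : Primrec (fun q : Qx => aE q.a q.b) := p_aE pa pb
  have Ecd : Primrec (fun q : Qx => aE q.c q.d) := p_aE pc pd
  have sl : Primrec (fun q : Qx => tsym q.s.length q.l) := p_tsym (p_len ps) pl
  have sm : Primrec (fun q : Qx => tsym q.s.length q.m) := p_tsym (p_len ps) pm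
  have app : Primrec (fun q : Qx => q.l ++ q.m) := p_app pl pm
  have eqc := p_cons sl (p_1 sm)
  have lec : Primrec (fun q : Qx => [25, 2 * (2 * q.s.length + 1) + 1, tsym q.s.length q.l, tsym q.s.length q.m]) :=
    p_cons (const 25) (p_cons (p_lin 2 1 (p_lin 2 1 (p_len ps))) eqc)
  have n0 : Primrec (fun _ : Qx => ([] : List ℕ)) := const []
  have h1 : Primrec cVar := pair n0 (p_1 (p_aT (p_1 (nat_mul.comp (const 2) (p_lin 2 1 (p_len pl)))) (p_app pl (p_cons pa pm)) pa))
  have h2 : Primrec cZero := pair n0 (p_1 (p_aT (const [1]) ps (const 0)))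
  have h3 : Primrec cSucc := pair (p_1 tl) (p_1 (p_aT (p_cons (const 5) pl) ps (p_eS pa)))
  have h4 : Primrec cAdd := pair (p_cons tl (p_1 tm)) (p_1 (p_aT (p_cons (const 13) app) ps (p_eA pa pb)))
  have h5 : Primrec cMul := pair (p_cons tl (p_1 tm)) (p_1 (p_aT (p_cons (const 15) app) ps (p_eM pa pb)))
  have h6 : Primrec cEqP := pair (p_cons tl (p_cons tm (p_1 Eab))) (p_1 (p_aP eqc ps))
  have h7 : Primrec cEqN := pair (p_cons tl (p_1 tm)) (p_cons Eab (p_1 (p_aN eqc ps)))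
  have h8 : Primrec cLeP := pair (p_cons tl (p_cons tm (p_1 (p_aL pa pb)))) (p_1 (p_aP lec ps))
  have h9 : Primrec cLeN := pair (p_cons tl (p_1 tm)) (p_cons (p_aL pa pb) (p_1 (p_aN lec ps)))
  have h10 : Primrec cBot := pair n0 (p_1 (p_aN (p_1 (p_lin 2 1 (p_lin 2 1 (nat_add.comp (p_len ps) (const 2))))) ps))
  have i1 : Primrec (fun q : Qx => aN (3 :: (q.l ++ q.m)) q.s) := p_aN (p_cons (const 3) app) ps
  have i2 : Primrec (fun q : Qx => aP (3 :: (q.l ++ q.m)) q.s) := p_aP (p_cons (const 3) app) ps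
  have h11 : Primrec cImp1 := pair (p_cons Pl (p_1 Nm)) (p_1 i1)
  have h12 : Primrec cImp2 := pair (p_cons Nl (p_1 Pm)) (p_1 i2)
  have h13 : Primrec cImp3 := pair (p_cons Nl (p_1 Nm)) (p_1 i2)
  have h14 : Primrec cImp4 := pair (p_cons Pl (p_1 Pm)) (p_1 i2)
  have h15 : Primrec cAllN := pair (p_1 (p_aN pl (p_app ps (p_1 pa)))) (p_1 (p_aN (p_cons (const 7) pl) ps))
  have h16 : Primrec cAllP := pair (p_1 (p_aP pl (p_app ps (p_1 (p_eW pl ps))))) (p_1 (p_aP (p_cons (const 7) pl) ps))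
  have h17 : Primrec cCon := pair (p_cons Pl (p_1 Nl)) n0
  have h18 : Primrec cRefl := pair n0 (p_1 (p_aE pa pa))
  have h19 : Primrec cSymm := pair (p_1 Eab) (p_1 (p_aE pb pa))
  have h20 : Primrec cTrans := pair (p_cons Eab (p_1 (p_aE pb pc))) (p_1 (p_aE pa pc))
  have h21 : Primrec cES := pair (p_1 Eab) (p_1 (p_aE (p_eS pa) (p_eS pb)))
  have h22 : Primrec cEA := pair (p_cons Eab (p_1 Ecd)) (p_1 (p_aE (p_eA pa pc) (p_eA pb pd)))
  have h23 : Primrec cEM := pair (p_cons Eab (p_1 Ecd)) (p_1 (p_aE (p_eM pa pc) (p_eM pb pd)))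
  have h24 : Primrec cEL := pair (p_cons Eab (p_cons Ecd (p_1 (p_aL pa pc)))) (p_1 (p_aL pb pd))
  have h25 : Primrec (cAx g) := pair n0 (p_1 (p_aP (hg.comp pa) (const [])))
  have h26 : Primrec (cTh θ) := pair n0 (p_1 (p_aP (const θ)
    (p_cons (p_eN (Primrec.fst.comp Primrec.fst)) (p_1 (p_eN (Primrec.snd.comp Primrec.fst))))))
  intro f hf
  simp only [cAll, List.mem_cons, List.not_mem_nil, or_false] at hf
  rcases hf with rfl | rfl | rfl | rfl | rfl | rfl | rfl | rfl | rfl | rfl | rfl | rfl | rfl | rfl | rfl | rfl |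
    rfl | rfl | rfl | rfl | rfl | rfl | rfl | rfl | rfl | rfl
  exacts [h1, h2, h3, h4, h5, h6, h7, h8, h9, h10, h11, h12, h13, h14, h15, h16, h17, h18, h19, h20, h21, h22, h23, h24, h25, h26]

end prim

/-- satisfaction of a clause -/
def SatL (val : ℕ → Bool) (C : List ℕ × List ℕ) : Prop :=
  (∀ x ∈ C.1, val x = true) → ∃ x ∈ C.2, val x = true

def mkC (C : List ℕ × List ℕ) : List (ℕ × Bool) :=
  C.2.map (fun x => (x, true)) ++ C.1.map (fun x => (x, false))

theorem prim_mkC : Primrec mkC := by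
  refine Primrec.list_append.comp (Primrec.list_map Primrec.snd ?_) (Primrec.list_map Primrec.fst ?_)
  · exact Primrec.pair Primrec.snd (Primrec.const true)
  · exact Primrec.pair Primrec.snd (Primrec.const false)

theorem sat_mkC (val : ℕ → Bool) (C) : (∃ l ∈ mkC C, val l.1 = l.2) ↔ SatL val C := by
  unfold SatL mkC
  constructor
  · rintro ⟨l, hl, h⟩ h'
    rcases List.mem_append.1 hl with hl | hl <;> obtain ⟨x, hx, rfl⟩ := List.mem_map.1 hl
    · exact ⟨x, hx, h⟩
    · have := h' x hx; simp_all
  · intro h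
    by_cases h' : ∀ x ∈ C.1, val x = true
    · obtain ⟨x, hx, hv⟩ := h h'
      exact ⟨(x, true), List.mem_append_left _ (List.mem_map.2 ⟨x, hx, rfl⟩), hv⟩
    · push Not at h'
      obtain ⟨x, hx, hv⟩ := h'
      exact ⟨(x, false), List.mem_append_right _ (List.mem_map.2 ⟨x, hx, rfl⟩), by simpa using hv⟩

theorem prim_list_fun {α β : Type} [Primcodable α] [Primcodable β] (L : List (α → β)) (h : ∀ f ∈ L, Primrec f) :
    Primrec (fun q => L.map (fun f => f q)) := by
  induction L with
  | nil => exact Primrec.const []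
  | cons f L ih =>
    exact Primrec.list_cons.comp (h f (by simp)) (ih (fun g hg => h g (by simp [hg])))

theorem re_clauses (L : List Clz) (h : ∀ f ∈ L, Primrec f) :
    REPred (fun p : ℕ × ℕ => ¬ ∃ val : ℕ → Bool, ∀ f ∈ L, ∀ y : Ix, SatL val (f (p, y))) := by
  have h1 : Primrec₂ (fun (p : ℕ × ℕ) (x : ℕ) => (L.map (fun f => f (p, Denumerable.ofNat Ix x))).map mkC) :=
    Primrec.list_map ((prim_list_fun L h).comp (Primrec.pair Primrec.fst ((Primrec.ofNat Ix).comp Primrec.snd)))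
      (prim_mkC.comp Primrec.snd)
  refine (re_cnf _ h1).of_eq (fun p => not_congr (exists_congr fun val => ?_))
  constructor
  · intro H f hf y
    have := H (encode y) (mkC (f (p, y))) (by
      rw [Denumerable.ofNat_encode]
      exact List.mem_map.2 ⟨_, List.mem_map.2 ⟨f, hf, rfl⟩, rfl⟩)
    exact (sat_mkC _ _).1 this
  · intro H x C hC
    obtain ⟨_, hC', rfl⟩ := List.mem_map.1 hC
    obtain ⟨f, hf, rfl⟩ := List.mem_map.1 hC'
    exact (sat_mkC _ _).2 (H f hf _)

end

section
open Encodable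

/-! ### Soundness of the clauses -/
section sound
variable {M : Type} [LA.Structure M]

def TVs (l : List ℕ) (s : List M) (x : M) : Prop :=
  ∃ (n : ℕ) (u : Fin n → M) (t : LA.Term (Empty ⊕ Fin n)), List.ofFn u = s ∧ tcode t = l ∧
    t.realize (Sum.elim default u) = x
def XPs (l : List ℕ) (s : List M) : Prop :=
  ∃ (n : ℕ) (u : Fin n → M) (φ : LA.BoundedFormula Empty n), List.ofFn u = s ∧ fcode φ = l ∧ φ.Realize default u
def XNs (l : List ℕ) (s : List M) : Prop :=
  ∃ (n : ℕ) (u : Fin n → M) (φ : LA.BoundedFormula Empty n), List.ofFn u = s ∧ fcode φ = l ∧ ¬ φ.Realize default u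

theorem TVs_iff {l n} {u : Fin n → M} {x : M} : TVs l (List.ofFn u) x ↔
    ∃ t : LA.Term (Empty ⊕ Fin n), tcode t = l ∧ t.realize (Sum.elim default u) = x := by
  constructor
  · rintro ⟨n', u', t, h, h', h''⟩
    obtain ⟨rfl, h⟩ := Sigma.mk.inj_iff.1 (List.ofFn_inj'.1 h)
    obtain rfl := eq_of_heq h
    exact ⟨t, h', h''⟩
  · rintro ⟨t, h, h'⟩; exact ⟨n, u, t, rfl, h, h'⟩
theorem XPs_iff {l n} {u : Fin n → M} : XPs l (List.ofFn u) ↔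
    ∃ φ : LA.BoundedFormula Empty n, fcode φ = l ∧ φ.Realize default u := by
  constructor
  · rintro ⟨n', u', t, h, h', h''⟩
    obtain ⟨rfl, h⟩ := Sigma.mk.inj_iff.1 (List.ofFn_inj'.1 h)
    obtain rfl := eq_of_heq h
    exact ⟨t, h', h''⟩
  · rintro ⟨t, h, h'⟩; exact ⟨n, u, t, rfl, h, h'⟩
theorem XNs_iff {l n} {u : Fin n → M} : XNs l (List.ofFn u) ↔
    ∃ φ : LA.BoundedFormula Empty n, fcode φ = l ∧ ¬ φ.Realize default u := by
  constructor
  · rintro ⟨n', u', t, h, h', h''⟩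
    obtain ⟨rfl, h⟩ := Sigma.mk.inj_iff.1 (List.ofFn_inj'.1 h)
    obtain rfl := eq_of_heq h
    exact ⟨t, h', h''⟩
  · rintro ⟨t, h, h'⟩; exact ⟨n, u, t, rfl, h, h'⟩

theorem ofFn_snoc' {α : Type} {n} (u : Fin n → α) (x : α) :
    List.ofFn (Fin.snoc (α := fun _ => α) u x) = List.ofFn u ++ [x] := by
  rw [List.ofFn_succ']; simp
theorem exists_ofFn {α : Type} (s : List α) : ∃ (n : ℕ) (u : Fin n → α), s = List.ofFn u :=
  ⟨_, _, (List.ofFn_get s).symm⟩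

theorem TVs.var (s s' : List M) (x : M) : TVs [2 * (2 * s.length + 1)] (s ++ x :: s') x := by
  have hl : s.length < (s ++ x :: s').length := by simp
  refine ⟨_, _, vT ⟨s.length, hl⟩, List.ofFn_get _, tcode_var _, ?_⟩
  rw [oreal_var]
  simp
variable {l m : List ℕ} {s : List M} {x y : M}
theorem TVs.zero : TVs [1] s (oZ M) := by
  obtain ⟨n, u, rfl⟩ := exists_ofFn s
  exact TVs_iff.2 ⟨zeroT, tcode_zero, oreal_zero _⟩
theorem TVs.succ (h : TVs l s x) : TVs (5 :: l) s (oS x) := by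
  obtain ⟨n, u, rfl⟩ := exists_ofFn s
  obtain ⟨t, rfl, rfl⟩ := TVs_iff.1 h
  exact TVs_iff.2 ⟨succT t, tcode_succ _, oreal_succ _ _⟩
theorem TVs.add (h : TVs l s x) (k : TVs m s y) : TVs (13 :: (l ++ m)) s (oA x y) := by
  obtain ⟨n, u, rfl⟩ := exists_ofFn s
  obtain ⟨t, rfl, rfl⟩ := TVs_iff.1 h
  obtain ⟨t', rfl, rfl⟩ := TVs_iff.1 k
  exact TVs_iff.2 ⟨addT t t', tcode_add _ _, oreal_add _ _ _⟩
theorem TVs.mul (h : TVs l s x) (k : TVs m s y) : TVs (15 :: (l ++ m)) s (oM x y) := by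
  obtain ⟨n, u, rfl⟩ := exists_ofFn s
  obtain ⟨t, rfl, rfl⟩ := TVs_iff.1 h
  obtain ⟨t', rfl, rfl⟩ := TVs_iff.1 k
  exact TVs_iff.2 ⟨mulT t t', tcode_mul _ _, oreal_mul _ _ _⟩
theorem X_eq (h : TVs l s x) (k : TVs m s y) : (x = y → XPs [tsym s.length l, tsym s.length m] s) ∧
    (¬ x = y → XNs [tsym s.length l, tsym s.length m] s) := by
  obtain ⟨n, u, rfl⟩ := exists_ofFn s
  obtain ⟨t, rfl, rfl⟩ := TVs_iff.1 h
  obtain ⟨t', rfl, rfl⟩ := TVs_iff.1 k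
  rw [List.length_ofFn, XPs_iff, XNs_iff]
  exact ⟨fun h => ⟨t =' t', fcode_eq _ _, by rwa [BoundedFormula.realize_bdEqual]⟩,
    fun h => ⟨t =' t', fcode_eq _ _, by rwa [BoundedFormula.realize_bdEqual]⟩⟩
theorem X_le (h : TVs l s x) (k : TVs m s y) :
    (oL x y → XPs [25, 2 * (2 * s.length + 1) + 1, tsym s.length l, tsym s.length m] s) ∧
    (¬ oL x y → XNs [25, 2 * (2 * s.length + 1) + 1, tsym s.length l, tsym s.length m] s) := by
  obtain ⟨n, u, rfl⟩ := exists_ofFn s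
  obtain ⟨t, rfl, rfl⟩ := TVs_iff.1 h
  obtain ⟨t', rfl, rfl⟩ := TVs_iff.1 k
  rw [List.length_ofFn, XPs_iff, XNs_iff]
  exact ⟨fun h => ⟨leF t t', fcode_le _ _, by rwa [oreal_le]⟩,
    fun h => ⟨leF t t', fcode_le _ _, by rwa [oreal_le]⟩⟩
theorem X_bot : XNs [2 * (2 * (s.length + 2) + 1) + 1] s := by
  obtain ⟨n, u, rfl⟩ := exists_ofFn s
  rw [List.length_ofFn, XNs_iff]
  exact ⟨⊥, fcode_bot, fun h => h⟩
theorem X_imp1 (h : XPs l s) (k : XNs m s) : XNs (3 :: (l ++ m)) s := by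
  obtain ⟨n, u, rfl⟩ := exists_ofFn s
  obtain ⟨φ, rfl, hh⟩ := XPs_iff.1 h
  obtain ⟨ψ, rfl, kk⟩ := XNs_iff.1 k
  exact XNs_iff.2 ⟨φ ⟹ ψ, fcode_imp _ _, fun h' => kk (h' hh)⟩
theorem X_imp2 (h : XNs l s) (k : XPs m s) : XPs (3 :: (l ++ m)) s := by
  obtain ⟨n, u, rfl⟩ := exists_ofFn s
  obtain ⟨φ, rfl, hh⟩ := XNs_iff.1 h
  obtain ⟨ψ, rfl, kk⟩ := XPs_iff.1 k
  exact XPs_iff.2 ⟨φ ⟹ ψ, fcode_imp _ _, fun _ => kk⟩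
theorem X_imp3 (h : XNs l s) (k : XNs m s) : XPs (3 :: (l ++ m)) s := by
  obtain ⟨n, u, rfl⟩ := exists_ofFn s
  obtain ⟨φ, rfl, hh⟩ := XNs_iff.1 h
  obtain ⟨ψ, rfl, kk⟩ := XNs_iff.1 k
  exact XPs_iff.2 ⟨φ ⟹ ψ, fcode_imp _ _, fun h' => absurd h' hh⟩
theorem X_imp4 (h : XPs l s) (k : XPs m s) : XPs (3 :: (l ++ m)) s := by
  obtain ⟨n, u, rfl⟩ := exists_ofFn s
  obtain ⟨φ, rfl, hh⟩ := XPs_iff.1 h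
  obtain ⟨ψ, rfl, kk⟩ := XPs_iff.1 k
  exact XPs_iff.2 ⟨φ ⟹ ψ, fcode_imp _ _, fun _ => kk⟩
theorem X_allN (h : XNs l (s ++ [x])) : XNs (7 :: l) s := by
  obtain ⟨n, u, rfl⟩ := exists_ofFn s
  rw [← ofFn_snoc', XNs_iff] at h
  obtain ⟨φ, rfl, h⟩ := h
  exact XNs_iff.2 ⟨∀' φ, fcode_all _, fun h' => h (h' x)⟩
theorem X_con (h : XPs l s) (k : XNs l s) : False := by
  obtain ⟨n, u, rfl⟩ := exists_ofFn s
  obtain ⟨φ, rfl, hh⟩ := XPs_iff.1 h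
  obtain ⟨ψ, e, kk⟩ := XNs_iff.1 k
  rw [fcode_inj e] at kk
  exact kk hh

/-- chosen counterexample -/
theorem exists_wit : ∃ wit : List ℕ → List M → M, ∀ l (s : List M), XPs l (s ++ [wit l s]) → XPs (7 :: l) s := by
  have : ∀ l (s : List M), ∃ w, XPs l (s ++ [w]) → XPs (7 :: l) s := by
    intro l s
    by_cases h : ∃ w, ¬ XPs l (s ++ [w])
    · obtain ⟨w, h⟩ := h
      exact ⟨w, fun h' => absurd h' h⟩
    · push Not at h
      refine ⟨oZ M, fun _ => ?_⟩
      obtain ⟨n, u, rfl⟩ := exists_ofFn s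
      have h' : ∀ w, ∃ φ : LA.BoundedFormula Empty (n + 1), fcode φ = l ∧ φ.Realize default (Fin.snoc u w) := by
        intro w
        have := h w
        rwa [← ofFn_snoc', XPs_iff] at this
      obtain ⟨φ, rfl, _⟩ := h' (oZ M)
      refine XPs_iff.2 ⟨∀' φ, fcode_all _, fun w => ?_⟩
      obtain ⟨ψ, e, h⟩ := h' w
      rwa [fcode_inj e] at h
  choose wit h using this
  exact ⟨wit, h⟩

def stepE (wit : List ℕ → List M → M) (n : ℕ) (g : ℕ → M) : M :=
  match n % 4 with
  | 1 => oS (g (n / 4))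
  | 2 => oA (g (n / 4).unpair.1) (g (n / 4).unpair.2)
  | 3 => oM (g (n / 4).unpair.1) (g (n / 4).unpair.2)
  | _ => if n = 0 then oZ M else
      wit (Denumerable.ofNat (List ℕ × List ℕ) (n / 4 - 1)).1 ((Denumerable.ofNat (List ℕ × List ℕ) (n / 4 - 1)).2.map g)

def stg (wit : List ℕ → List M → M) : ℕ → ℕ → M
  | 0 => fun _ => oZ M
  | n + 1 => fun m => if m = n then stepE wit n (stg wit n) else stg wit n m

theorem stg_lt (wit : List ℕ → List M → M) {n m} (h : m < n) : stg wit n m = stepE wit m (stg wit m) := by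
  induction n with
  | zero => omega
  | succ n ih =>
    by_cases e : m = n
    · subst e; simp [stg]
    · simp only [stg, e, if_false]; exact ih (by omega)

theorem mem_le_encode {x : ℕ} {s : List ℕ} (h : x ∈ s) : x < encode s := by
  induction s with
  | nil => simp at h
  | cons a s ih =>
    rw [encode_list_cons]
    rcases List.mem_cons.1 h with rfl | h
    · exact Nat.lt_succ_of_le (Nat.left_le_pair _ _)
    · exact (ih h).trans_le ((Nat.right_le_pair _ _).trans (Nat.le_succ _))

theorem exists_ev (wit : List ℕ → List M → M) : ∃ ev : ℕ → M, ev 0 = oZ M ∧ (∀ a, ev (eS a) = oS (ev a)) ∧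
    (∀ a b, ev (eA a b) = oA (ev a) (ev b)) ∧ (∀ a b, ev (eM a b) = oM (ev a) (ev b)) ∧
    ∀ l s, ev (eW l s) = wit l (s.map ev) := by
  refine ⟨fun n => stepE wit n (stg wit n), ?_, ?_, ?_, ?_, ?_⟩
  · simp [stepE]
  · intro a
    have h1 : eS a % 4 = 1 := by unfold eS; omega
    have h2 : eS a / 4 = a := by unfold eS; omega
    conv_lhs => unfold stepE
    simp only [h1, h2]
    rw [stg_lt wit (by unfold eS; omega)]
  · intro a b
    have h1 : eA a b % 4 = 2 := by unfold eA; omega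
    have h2 : eA a b / 4 = Nat.pair a b := by unfold eA; omega
    have h3 := Nat.left_le_pair a b
    have h4 := Nat.right_le_pair a b
    conv_lhs => unfold stepE
    simp only [h1, h2, Nat.unpair_pair]
    rw [stg_lt wit (by unfold eA; omega), stg_lt wit (by unfold eA; omega)]
  · intro a b
    have h1 : eM a b % 4 = 3 := by unfold eM; omega
    have h2 : eM a b / 4 = Nat.pair a b := by unfold eM; omega
    have h3 := Nat.left_le_pair a b
    have h4 := Nat.right_le_pair a b
    conv_lhs => unfold stepE
    simp only [h1, h2, Nat.unpair_pair]
    rw [stg_lt wit (by unfold eM; omega), stg_lt wit (by unfold eM; omega)]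
  · intro l s
    have h1 : eW l s % 4 = 0 := by unfold eW; omega
    have h2 : eW l s / 4 - 1 = encode (l, s) := by unfold eW; omega
    have h0 : eW l s ≠ 0 := by unfold eW; omega
    conv_lhs => unfold stepE
    simp only [h1, h2, h0, if_false, Denumerable.ofNat_encode]
    congr 1
    refine List.map_congr_left (fun x hx => ?_)
    refine stg_lt wit ?_
    have := mem_le_encode hx
    have h3 : encode s ≤ encode (l, s) := by
      rw [encode_prod_val]; exact Nat.right_le_pair _ _
    unfold eW
    omega

theorem clauses_sound {g : ℕ → List ℕ} (hg : ∀ j, ∃ φ : Snt, g j = fcode φ ∧ M ⊨ φ)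
    {Θ : LA.BoundedFormula Empty 2} {c e : ℕ} (hΘ : Θ.Realize default ![numv M c, numv M e]) :
    ∃ val : ℕ → Bool, ∀ f ∈ cAll g (fcode Θ), ∀ y : Ix, SatL val (f ((c, e), y)) := by
  classical
  obtain ⟨wit, hw⟩ := exists_wit (M := M)
  obtain ⟨ev, e0, eS', eA', eM', eW'⟩ := exists_ev wit
  have eN' : ∀ n, ev (eN n) = numv M n := by
    intro n
    induction n with
    | zero => exact e0
    | succ n ih => rw [eN, eS', ih]; rfl
  let Sem : ℕ × List ℕ × List ℕ × ℕ → Prop := fun p => match p with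
    | (0, l, s, a) => TVs l (s.map ev) (ev a)
    | (1, l, s, _) => XPs l (s.map ev)
    | (2, l, s, _) => XNs l (s.map ev)
    | (3, _, s, b) => s.map ev = [ev b]
    | (4, _, s, b) => ∃ x, s.map ev = [x] ∧ oL x (ev b)
    | _ => False
  let val : ℕ → Bool := fun x => decide (Sem (Denumerable.ofNat _ x))
  have vT' : ∀ l s a, (val (aT l s a) = true) = TVs l (s.map ev) (ev a) := by
    intro l s a; simp [val, aT, atm, Sem]
  have vP : ∀ l s, (val (aP l s) = true) = XPs l (s.map ev) := by
    intro l s; simp [val, aP, atm, Sem]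
  have vN : ∀ l s, (val (aN l s) = true) = XNs l (s.map ev) := by
    intro l s; simp [val, aN, atm, Sem]
  have vE : ∀ a b, (val (aE a b) = true) = (ev a = ev b) := by
    intro a b; simp [val, aE, atm, Sem]
  have vL : ∀ a b, (val (aL a b) = true) = oL (ev a) (ev b) := by
    intro a b; simp [val, aL, atm, Sem]
  refine ⟨val, ?_⟩
  have hlen : ∀ s : List ℕ, s.length = (s.map ev).length := fun s => by simp
  intro f hf y
  simp only [cAll, List.mem_cons, List.not_mem_nil, or_false] at hf
  rcases hf with rfl | rfl | rfl | rfl | rfl | rfl | rfl | rfl | rfl | rfl | rfl | rfl | rfl | rfl | rfl | rfl |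
    rfl | rfl | rfl | rfl | rfl | rfl | rfl | rfl | rfl | rfl <;>
  simp only [SatL, cVar, cZero, cSucc, cAdd, cMul, cEqP, cEqN, cLeP, cLeN, cBot, cImp1, cImp2, cImp3, cImp4, cAllN, cAllP,
   cCon, cRefl, cSymm, cTrans, cES, cEA, cEM, cEL, cAx, cTh, List.mem_cons, List.not_mem_nil, or_false, forall_eq_or_imp,
   forall_eq, exists_eq_or_imp, exists_eq_left, vT', vP, vN, vE, vL, e0, eS', eA', eM', eW', eN', List.map_append,
   List.map_cons, List.map_nil, false_imp_iff, implies_true, false_and, exists_false, forall_true_left]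
  · rw [hlen]; exact TVs.var _ _ _
  · exact TVs.zero
  · exact fun h => h.succ
  · exact fun h => h.1.add h.2
  · exact fun h => h.1.mul h.2
  · rw [hlen]; exact fun h => (X_eq h.1 h.2.1).1 h.2.2
  · rw [hlen]; exact fun h => or_iff_not_imp_left.2 (X_eq h.1 h.2).2
  · rw [hlen]; exact fun h => (X_le h.1 h.2.1).1 h.2.2
  · rw [hlen]; exact fun h => or_iff_not_imp_left.2 (X_le h.1 h.2).2
  · rw [hlen]; exact X_bot
  · exact fun h => X_imp1 h.1 h.2
  · exact fun h => X_imp2 h.1 h.2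
  · exact fun h => X_imp3 h.1 h.2
  · exact fun h => X_imp4 h.1 h.2
  · exact fun h => X_allN h
  · exact fun h => hw _ _ h
  · exact fun h => X_con h.1 h.2
  · exact fun h => h.symm
  · exact fun h => h.1.trans h.2
  · exact fun h => congrArg _ h
  · exact fun h => congrArg₂ _ h.1 h.2
  · exact fun h => congrArg₂ _ h.1 h.2
  · exact fun h => h.1 ▸ h.2.1 ▸ h.2.2
  · obtain ⟨φ, h, h'⟩ := hg y.2.1
    exact ⟨0, default, φ, by simp, h.symm, h'⟩
  · exact ⟨2, _, Θ, by simp, rfl, hΘ⟩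

end sound

end

section
open Encodable

/-! ### Completeness of the clauses -/
theorem clauses_complete {g : ℕ → List ℕ} {Θ : LA.BoundedFormula Empty 2} {c e : ℕ} {val : ℕ → Bool}
    (H : ∀ f ∈ cAll g (fcode Θ), ∀ y : Ix, SatL val (f ((c, e), y))) :
    ∃ (M : Type) (_ : LA.Structure M) (_ : Nonempty M), (∀ φ : Snt, (∃ j, g j = fcode φ) → M ⊨ φ) ∧
      Θ.Realize default ![numv M c, numv M e] := by
  have H' : ∀ f ∈ cAll g (fcode Θ), ∀ l m s a b c' d, SatL val (f ((c, e), (l, m, s), (a, b, c', d))) :=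
    fun f hf l m s a b c d => H f hf _
  clear H
  simp only [cAll, List.forall_mem_cons, List.not_mem_nil, false_imp_iff, implies_true, and_true] at H'
  simp only [SatL, cVar, cZero, cSucc, cAdd, cMul, cEqP, cEqN, cLeP, cLeN, cBot, cImp1, cImp2, cImp3, cImp4, cAllN, cAllP,
   cCon, cRefl, cSymm, cTrans, cES, cEA, cEM, cEL, cAx, cTh, List.mem_cons, List.not_mem_nil, or_false, forall_eq_or_imp,
   forall_eq, exists_eq_or_imp, exists_eq_left, false_imp_iff, implies_true, false_and, exists_false,
   and_imp, Qx.l, Qx.m, Qx.s, Qx.a, Qx.b, Qx.c, Qx.d] at H'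
  simp only [forall_const] at H'
  obtain ⟨hVar, hZero, hSucc, hAdd, hMul, hEqP, hEqN, hLeP, hLeN, hBot, hImp1, hImp2, hImp3, hImp4, hAllN, hAllP,
    hCon, hRefl, hSymm, hTrans, hES, hEA, hEM, hEL, hAx, hTh⟩ := H'
  let S : Setoid ℕ := ⟨fun a b => val (aE a b) = true, ⟨hRefl, fun h => hSymm _ _ h, fun h k => hTrans _ _ _ h k⟩⟩
  let N := Quotient S
  let mk : ℕ → N := Quotient.mk S
  have mk_eq : ∀ a b, mk a = mk b ↔ val (aE a b) = true := fun a b => Quotient.eq (r := S)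
  have mk_surj : ∀ x : N, ∃ a, mk a = x := fun x => Quotient.exists_rep x
  let fS : N → N := Quotient.map eS (fun a b h => hES a b h)
  let fA : N → N → N := Quotient.map₂ eA (fun a b h c d k => hEA a b c d h k)
  let fM : N → N → N := Quotient.map₂ eM (fun a b h c d k => hEM a b c d h k)
  let rL : N → N → Prop := Quotient.lift₂ (fun a b => val (aL a b) = true) (fun a b c d h k =>
    propext ⟨fun hh => hEL a c b d h k hh, fun hh => hEL c a d b (hSymm _ _ h) (hSymm _ _ k) hh⟩)
  let str : LA.Structure N :=
    { funMap := fun {n} => match n with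
        | 0 => fun _ _ => mk 0
        | 1 => fun _ v => fS (v 0)
        | 2 => fun b v => if (show Bool from b) then fM (v 0) (v 1) else fA (v 0) (v 1)
        | (_ + 3) => fun f _ => Empty.elim f
      RelMap := fun {n} => match n with
        | 0 => fun f _ => Empty.elim f
        | 1 => fun f _ => Empty.elim f
        | 2 => fun _ v => rL (v 0) (v 1)
        | (_ + 3) => fun f _ => Empty.elim f }
  have nZ : oZ N = mk 0 := rfl
  have nS : ∀ a, oS (mk a) = mk (eS a) := fun a => rfl
  have nA : ∀ a b, oA (mk a) (mk b) = mk (eA a b) := fun a b => rfl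
  have nM : ∀ a b, oM (mk a) (mk b) = mk (eM a b) := fun a b => rfl
  have nL : ∀ a b, oL (mk a) (mk b) ↔ val (aL a b) = true := fun a b => Iff.rfl
  clear_value str rL fM fA fS
  have term : ∀ {n} (t : LA.Term (Empty ⊕ Fin n)) (v : Fin n → ℕ), ∃ a, val (aT (tcode t) (List.ofFn v) a) = true ∧
      t.realize (Sum.elim (default : Empty → N) (fun i => mk (v i))) = mk a := by
    intro n t v
    refine term_cases (fun t => ∃ a, val (aT (tcode t) (List.ofFn v) a) = true ∧
      t.realize (Sum.elim (default : Empty → N) (fun i => mk (v i))) = mk a) ?_ ?_ ?_ ?_ ?_ t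
    · intro i
      refine ⟨v i, ?_, rfl⟩
      have := hVar ((List.ofFn v).take i) ((List.ofFn v).drop (i + 1)) (v i)
      have h2 : (List.ofFn v).take i ++ v i :: (List.ofFn v).drop (i + 1) = List.ofFn v := by
        have hi : (i : ℕ) < (List.ofFn v).length := by simp
        have := List.drop_eq_getElem_cons hi
        rw [List.getElem_ofFn] at this
        rw [← this, List.take_append_drop]
      rw [h2] at this
      rw [tcode_var]
      simpa [min_eq_left i.2.le] using this
    · exact ⟨0, by rw [tcode_zero]; exact hZero _, by rw [oreal_zero, nZ]⟩
    · rintro t ⟨a, h, k⟩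
      exact ⟨eS a, by rw [tcode_succ]; exact hSucc _ _ _ h, by rw [oreal_succ, k, nS]⟩
    · rintro t u ⟨a, h, k⟩ ⟨b, h', k'⟩
      exact ⟨eA a b, by rw [tcode_add]; exact hAdd _ _ _ _ _ h h', by rw [oreal_add, k, k', nA]⟩
    · rintro t u ⟨a, h, k⟩ ⟨b, h', k'⟩
      exact ⟨eM a b, by rw [tcode_mul]; exact hMul _ _ _ _ _ h h', by rw [oreal_mul, k, k', nM]⟩
  have truth : ∀ {n} (φ : LA.BoundedFormula Empty n) (v : Fin n → ℕ),
      (φ.Realize (default : Empty → N) (fun i => mk (v i)) → val (aP (fcode φ) (List.ofFn v)) = true) ∧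
      (¬ φ.Realize (default : Empty → N) (fun i => mk (v i)) → val (aN (fcode φ) (List.ofFn v)) = true) := by
    intro n φ
    refine fml_ind (P := fun n φ => ∀ v : Fin n → ℕ,
      (φ.Realize (default : Empty → N) (fun i => mk (v i)) → val (aP (fcode φ) (List.ofFn v)) = true) ∧
      (¬ φ.Realize (default : Empty → N) (fun i => mk (v i)) → val (aN (fcode φ) (List.ofFn v)) = true)) ?_ ?_ ?_ ?_ ?_ φ
    · intro n v
      refine ⟨fun h => h.elim, fun _ => ?_⟩
      have := hBot (List.ofFn v)
      rwa [List.length_ofFn] at this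
    · intro n t u v
      obtain ⟨a, h, k⟩ := term t v
      obtain ⟨b, h', k'⟩ := term u v
      rw [BoundedFormula.realize_bdEqual, k, k', mk_eq, fcode_eq]
      have h1 := hEqP _ _ _ _ _ h h'
      have h2 := hEqN _ _ _ _ _ h h'
      rw [List.length_ofFn] at h1 h2
      exact ⟨h1, fun h => h2.resolve_left h⟩
    · intro n t u v
      obtain ⟨a, h, k⟩ := term t v
      obtain ⟨b, h', k'⟩ := term u v
      rw [oreal_le, k, k', nL, fcode_le]
      have h1 := hLeP _ _ _ _ _ h h'
      have h2 := hLeN _ _ _ _ _ h h'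
      rw [List.length_ofFn] at h1 h2
      exact ⟨h1, fun h => h2.resolve_left h⟩
    · intro n φ ψ h1 h2 v
      rw [BoundedFormula.realize_imp, fcode_imp]
      have h1 := h1 v
      have h2 := h2 v
      constructor
      · intro h
        by_cases k : φ.Realize (default : Empty → N) (fun i => mk (v i))
        · exact hImp4 _ _ _ (h1.1 k) (h2.1 (h k))
        · by_cases k' : ψ.Realize (default : Empty → N) (fun i => mk (v i))
          · exact hImp2 _ _ _ (h1.2 k) (h2.1 k')
          · exact hImp3 _ _ _ (h1.2 k) (h2.2 k')
      · intro h
        rw [Classical.not_imp] at h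
        exact hImp1 _ _ _ (h1.1 h.1) (h2.2 h.2)
    · intro n φ ih v
      have sn : ∀ a, (Fin.snoc (α := fun _ => N) (fun i => mk (v i)) (mk a)) =
          fun i => mk (Fin.snoc (α := fun _ => ℕ) v a i) := by
        intro a
        funext i
        refine Fin.lastCases ?_ (fun i => ?_) i <;> simp
      rw [BoundedFormula.realize_all, fcode_all]
      constructor
      · intro h
        have h := h (mk (eW (fcode φ) (List.ofFn v)))
        rw [sn] at h
        have := (ih _).1 h
        rw [ofFn_snoc'] at this
        exact hAllP _ _ this
      · intro h
        push Not at h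
        obtain ⟨x, h⟩ := h
        obtain ⟨a, rfl⟩ := mk_surj x
        rw [sn] at h
        have := (ih _).2 h
        rw [ofFn_snoc'] at this
        exact hAllN _ _ _ this
  have pos : ∀ {n} (φ : LA.BoundedFormula Empty n) (v : Fin n → ℕ), val (aP (fcode φ) (List.ofFn v)) = true →
      φ.Realize (default : Empty → N) (fun i => mk (v i)) := by
    intro n φ v h
    by_contra k
    exact hCon _ _ h ((truth φ v).2 k)
  have hnum : ∀ n, numv N n = mk (eN n) := by
    intro n
    induction n with
    | zero => exact nZ
    | succ n ih => rw [eN, ← nS, ← ih]; rfl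
  refine ⟨N, str, ⟨mk 0⟩, ?_, ?_⟩
  · rintro φ ⟨j, hj⟩
    have := pos φ default (by rw [← hj]; exact hAx j)
    rw [Sentence.Realize, Formula.Realize]
    convert this
  · have := pos Θ ![eN c, eN e] (by simpa using hTh)
    convert this using 1
    funext i
    rw [hnum, hnum]
    fin_cases i <;> rfl

theorem exists_enum {T : Thy} (hT : CompThy T) : ∃ g : ℕ → List ℕ, Primrec g ∧
    (∀ j, (∃ φ ∈ T, g j = fcode φ) ∨ g j = fcode (⊥ ⟹ ⊥ : Snt)) ∧ ∀ φ ∈ T, ∃ j, g j = fcode φ := by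
  obtain ⟨hd, hc⟩ := hT
  have hc' : Nat.Partrec (fun m : ℕ => (Part.some (if (∃ φ ∈ T, gnum φ = m) then 1 else 0 : ℕ))) := by
    have : Computable (fun m : ℕ => (if (∃ φ ∈ T, gnum φ = m) then 1 else 0 : ℕ)) := by
      refine (Computable.cond hc (Computable.const 1) (Computable.const 0)).of_eq (fun m => ?_)
      by_cases h : ∃ φ ∈ T, gnum φ = m <;> simp [h]
    exact Partrec.nat_iff.1 this
  obtain ⟨ct, hct⟩ := Nat.Partrec.Code.exists_code.1 hc'
  let g : ℕ → List ℕ := fun j => if Nat.Partrec.Code.evaln j.unpair.1 ct j.unpair.2 = some 1 then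
    Denumerable.ofNat (List ℕ) j.unpair.2 else fcode (⊥ ⟹ ⊥ : Snt)
  refine ⟨g, ?_, ?_, ?_⟩
  · refine Primrec.ite ?_ ((Primrec.ofNat _).comp (Primrec.snd.comp Primrec.unpair)) (Primrec.const _)
    refine Primrec.eq.comp (Nat.Partrec.Code.primrec_evaln.comp (Primrec.pair (Primrec.pair
      (Primrec.fst.comp Primrec.unpair) (Primrec.const ct)) (Primrec.snd.comp Primrec.unpair))) (Primrec.const _)
  · intro j
    by_cases h : Nat.Partrec.Code.evaln j.unpair.1 ct j.unpair.2 = some 1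
    · left
      have := Nat.Partrec.Code.evaln_sound h
      rw [hct] at this
      by_cases k : ∃ φ ∈ T, gnum φ = j.unpair.2
      · obtain ⟨φ, h1, h2⟩ := k
        refine ⟨φ, h1, ?_⟩
        simp only [g, h, if_true]
        rw [← h2, gnum_eq, Denumerable.ofNat_encode]
      · simp [k] at this
    · right; simp [g, h]
  · intro φ hφ
    have : 1 ∈ ct.eval (gnum φ) := by
      rw [hct]
      have k : ∃ ψ ∈ T, gnum ψ = gnum φ := ⟨φ, hφ, rfl⟩
      simp [k]
    obtain ⟨k, hk⟩ := Nat.Partrec.Code.evaln_complete.1 this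
    refine ⟨Nat.pair k (gnum φ), ?_⟩
    have hk' : Nat.Partrec.Code.evaln k ct (gnum φ) = some 1 := hk
    simp only [g, Nat.unpair_pair, hk', if_true]
    rw [gnum_eq, Denumerable.ofNat_encode]

theorem re_unsat {T : Thy} (hT : CompThy T) (Θ : LA.BoundedFormula Empty 2) :
    REPred fun p : ℕ × ℕ => ∀ (M : Type) [LA.Structure M] [Nonempty M], M ⊨ T →
      ¬ Θ.Realize default ![numv M p.1, numv M p.2] := by
  obtain ⟨g, hg, h1, h2⟩ := exists_enum hT
  refine (re_clauses (cAll g (fcode Θ)) (p_all hg _)).of_eq (fun p => ?_)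
  constructor
  · intro h M _ _ hM hΘ
    refine h (clauses_sound (M := M) (fun j => ?_) hΘ)
    rcases h1 j with ⟨φ, h3, h4⟩ | h4
    · exact ⟨φ, h4, hM.realize_of_mem φ h3⟩
    · exact ⟨_, h4, fun h => h⟩
  · rintro h ⟨val, hv⟩
    obtain ⟨M, i1, i2, h3, h4⟩ := clauses_complete (c := p.1) (e := p.2) hv
    exact h M ⟨fun φ hφ => h3 φ (h2 φ hφ)⟩ h4

end

/-! ### Provability and models -/
theorem prv_iff {T : Thy} (hT : ExtPA T) {φ : Snt} : Prv T φ ↔ ∀ M : PAM, M ⊨ T → M ⊨ φ := by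
  constructor
  · intro h M hM
    exact (Theory.models_sentence_iff.1 h) (Theory.ModelType.of T M)
  · intro h
    refine Theory.models_sentence_iff.2 (fun M => ?_)
    have hM : (M : Type) ⊨ PAAx := ⟨fun ψ hψ => (Theory.models_sentence_iff.1 (hT ψ hψ)) M⟩
    exact h ⟨M, hM⟩ M.is_model

theorem prv_mem {T : Thy} {φ : Snt} (h : φ ∈ T) : Prv T φ := Theory.models_sentence_of_mem h

theorem prv_mono {T U : Thy} (h : T ⊆ U) {φ : Snt} (k : Prv T φ) : Prv U φ := by
  refine Theory.models_sentence_iff.2 (fun M => ?_)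
  have hM : (M : Type) ⊨ T := M.is_model.mono h
  exact (Theory.models_sentence_iff.1 k) (Theory.ModelType.of T M)

theorem ExtPA.mono {T U : Thy} (h : T ⊆ U) (k : ExtPA T) : ExtPA U := fun φ hφ => prv_mono h (k φ hφ)

theorem con_iff {T : Thy} (hT : ExtPA T) : Con T ↔ ∃ M : PAM, M ⊨ T := by
  rw [Con, prv_iff hT]
  push Not
  exact ⟨fun ⟨M, h, _⟩ => ⟨M, h⟩, fun ⟨M, h⟩ => ⟨M, h, fun h => h⟩⟩

theorem mod_add {T : Thy} {φ : Snt} {M : PAM} : M ⊨ add T φ ↔ M ⊨ φ ∧ M ⊨ T := by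
  constructor
  · intro h
    exact ⟨h.realize_of_mem φ (Set.mem_insert _ _), h.mono (Set.subset_insert _ _)⟩
  · rintro ⟨h, k⟩
    refine ⟨fun ψ hψ => ?_⟩
    rcases hψ with rfl | hψ
    · exact h
    · exact k.realize_of_mem ψ hψ

theorem mod_sub {V T : Thy} (h : SubThy V T) (hT : ExtPA T) {M : PAM} (hM : M ⊨ T) : M ⊨ V :=
  ⟨fun ψ hψ => (prv_iff hT).1 (h.2 ψ (prv_mem hψ)) M hM⟩

theorem real0 {M : PAM} {φ : Snt} (v : Fin 0 → M) : M ⊨ φ ↔ BoundedFormula.Realize φ default v := by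
  rw [Sentence.Realize, Formula.Realize, Subsingleton.elim v default]

theorem numv_eq (M : PAM) (n : ℕ) : numv M n = (n : M) := by
  induction n with
  | zero => rw [Nat.cast_zero]; rfl
  | succ n ih => rw [Nat.cast_succ, ← PAM.s_eq, ← ih]; rfl

/-! ### The fixed point -/
section fix
variable (K : ∀ M : PAM, (Fin 3 → M) → Prop) (k : ℕ)

def Ph (M : PAM) (c : M) : Prop :=
  ∃ e w : M, (K M ![c, e + 1, w] ∧ ∀ z ≤ e + w, ¬ K M ![c, 0, z]) ∧ SgE (k + 1) M e 0

variable {K k}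
theorem D0.k3 (hK : D0 3 K) {n} {a b c : ∀ M : PAM, (Fin n → M) → M} (ha : DT n a) (hb : DT n b) (hc : DT n c) :
    D0 n (fun M v => K M ![a M v, b M v, c M v]) := by
  refine (hK.subst (t := ![a, b, c]) (fun i => ?_)).congr (fun M v => ?_)
  · fin_cases i <;> assumption
  · have : (fun i => (![a, b, c] : Fin 3 → ∀ M : PAM, (Fin n → M) → M) i M v) = ![a M v, b M v, c M v] := by
      funext i; fin_cases i <;> rfl
    rw [this]

theorem Ph_SG (hK : D0 3 K) {n} {t : ∀ M : PAM, (Fin n → M) → M} (ht : DT n t) :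
    SG (k + 1) n (fun M v => Ph K k M (t M v)) := by
  refine SG.ex (R := fun M v e => ∃ w, (K M ![t M v, e + 1, w] ∧ ∀ z ≤ e + w, ¬ K M ![t M v, 0, z]) ∧
    SgE (k + 1) M e 0) ?_
  refine SG.ex (n := n + 1) (R := fun M v w => (K M ![t M (fun i => v i.castSucc), v (Fin.last n) + 1, w] ∧
    ∀ z ≤ v (Fin.last n) + w, ¬ K M ![t M (fun i => v i.castSucc), 0, z]) ∧ SgE (k + 1) M (v (Fin.last n)) 0) ?_
  refine (sat_syn k (D0.and ?_ ?_) (.var _) .zero).1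
  · exact hK.k3 ht.wk.wk (.add (.var _) .one) (.var _)
  · refine D0.ball (R := fun M v z => ¬ K M ![t M (fun i => v i.castSucc.castSucc), 0, z]) (.add (.var _) (.var _)) ?_
    exact (hK.k3 ht.wk.wk.wk .zero (.var _)).not

theorem k3_abs (hK : D0 3 K) (M : PAM) (a b c : ℕ) : K M ![(a : M), (b : M), (c : M)] ↔ K NN ![a, b, c] := by
  rw [← hK.abs M ![a, b, c] ]
  have : (fun i => ((![a, b, c] i : ℕ) : M)) = ![(a : M), (b : M), (c : M)] := by
    funext i; fin_cases i <;> rfl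
  rw [this]

theorem Ph_intro (hK : D0 3 K) {c e w : ℕ} (h1 : K NN ![c, e + 1, w])
    (h2 : ∀ z ≤ e + w, ¬ K NN ![c, 0, z]) (M : PAM) (h : SgE (k + 1) M (e : M) 0) : Ph K k M (c : M) := by
  refine ⟨e, w, ⟨?_, fun z hz => ?_⟩, h⟩
  · have := (k3_abs hK M c (e + 1) w).2 h1
    rwa [Nat.cast_succ] at this
  · rw [← Nat.cast_add] at hz
    obtain ⟨z', hz', rfl⟩ := PAM.std _ _ hz
    have := h2 z' hz'
    rwa [← k3_abs hK M, Nat.cast_zero] at this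

theorem assert_dom {α : Type} (p : Prop) (x : α) : (Part.assert p (fun _ => Part.some x)).Dom ↔ p :=
  ⟨fun h => h.1, fun h => ⟨h, trivial⟩⟩

theorem re_or {α} [Primcodable α] {p q : α → Prop} (hp : REPred p) (hq : REPred q) : REPred (fun a => p a ∨ q a) := by
  obtain ⟨k, hk, h⟩ := Partrec.merge' hp hq
  refine hk.dom_re.of_eq (fun a => ?_)
  rw [(h a).2]
  exact or_congr (assert_dom _ _) (assert_dom _ _)

theorem exists_fix {T U : Thy} (hT : CompThy T) (hU : CompThy U) (pT : ExtPA T) (pU : ExtPA U) (k : ℕ) :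
    ∃ K : ∀ M : PAM, (Fin 3 → M) → Prop, D0 3 K ∧ ∃ c : ℕ,
      ((∃ w : ℕ, K NN ![c, 0, w]) ↔ (∀ M : PAM, M ⊨ T → Ph K k M c) ∨ (∀ M : PAM, M ⊨ U → Ph K k M c)) ∧
      ∀ e : ℕ, ((∃ w : ℕ, K NN ![c, e + 1, w]) ↔
        (∀ M : PAM, M ⊨ T → ¬ (Ph K k M c ∧ SgE (k + 1) M e 0)) ∨
        (∀ M : PAM, M ⊨ U → ¬ (Ph K k M c ∧ SgE (k + 1) M e 0))) := by
  obtain ⟨K, hK, hK'⟩ := exists_K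
  obtain ⟨Φ, _, hΦ⟩ := Ph_SG (k := k) hK (DT.var (n := 2) 0)
  obtain ⟨Ψ, _, hΨ⟩ := Ph_SG (k := k) hK (DT.var (n := 3) 0)
  obtain ⟨Sg, _, hSg⟩ := (sat_syn k (D0.eq (DT.var (n := 3) 1) (.add (.var 2) .one)) (DT.var (n := 3) 2) .zero).1
  obtain ⟨Z, _, hZ⟩ := D0.eq (DT.var (n := 2) 1) .zero
  let Θ : LA.BoundedFormula Empty 2 := (Z ⊓ ∼Φ) ⊔ ∃' (Sg ⊓ Ψ)
  have hΘ : ∀ (M : PAM) (v : Fin 2 → M), Θ.Realize default v ↔ (v 1 = 0 ∧ ¬ Ph K k M (v 0)) ∨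
      ∃ x, (v 1 = x + 1 ∧ SgE (k + 1) M x 0) ∧ Ph K k M (v 0) := by
    intro M v
    simp only [Θ, BoundedFormula.realize_sup, BoundedFormula.realize_inf, BoundedFormula.realize_not,
      BoundedFormula.realize_ex, hZ, hΦ, hΨ, hSg]
    rfl
  have hmod : ∀ {T : Thy}, ExtPA T → ∀ c e : ℕ, (∀ (M : Type) [LA.Structure M] [Nonempty M], M ⊨ T →
      ¬ Θ.Realize default ![numv M c, numv M e]) ↔ ∀ M : PAM, M ⊨ T → ¬ Θ.Realize default ![(c : M), (e : M)] := by
    intro T pT c e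
    constructor
    · intro h M hM
      rw [← numv_eq, ← numv_eq]
      exact h M hM
    · intro h M _ _ hM
      have hM' : M ⊨ PAAx := ⟨fun ψ hψ => (Theory.models_sentence_iff.1 (pT ψ hψ)) (Theory.ModelType.of T M)⟩
      have := h ⟨M, hM'⟩ hM
      rwa [← numv_eq, ← numv_eq] at this
  have hP := re_or (re_unsat hT Θ) (re_unsat hU Θ)
  have hP2 : Nat.Partrec (fun n : ℕ => Part.assert (((∀ (M : Type) [LA.Structure M] [Nonempty M], M ⊨ T →
      ¬ Θ.Realize default ![numv M n.unpair.1, numv M n.unpair.2]) ∨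
      (∀ (M : Type) [LA.Structure M] [Nonempty M], M ⊨ U →
      ¬ Θ.Realize default ![numv M n.unpair.1, numv M n.unpair.2]))) (fun _ => Part.some 0)) := by
    refine Partrec.nat_iff.1 ?_
    refine ((hP.comp Computable.unpair).map (Computable.const 0).to₂).of_eq (fun n => ?_)
    ext x
    simp
    exact fun _ => eq_comm
  obtain ⟨cd, hcd⟩ := Nat.Partrec.Code.exists_code.1 hP2
  let c := Encodable.encode cd
  have hdom : ∀ c e : ℕ, (cd.eval (Nat.pair c e)).Dom ↔ (∀ (M : Type) [LA.Structure M] [Nonempty M], M ⊨ T →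
      ¬ Θ.Realize default ![numv M c, numv M e]) ∨ (∀ (M : Type) [LA.Structure M] [Nonempty M], M ⊨ U →
      ¬ Θ.Realize default ![numv M c, numv M e]) := by
    intro c e
    rw [hcd]
    refine (assert_dom _ _).trans ?_
    simp only [Nat.unpair_pair]
  have hc : ∀ e : ℕ, (∃ w : ℕ, K NN ![c, e, w]) ↔ (∀ M : PAM, M ⊨ T → ¬ Θ.Realize default ![(c : M), (e : M)]) ∨
      ∀ M : PAM, M ⊨ U → ¬ Θ.Realize default ![(c : M), (e : M)] := by
    intro e
    rw [hK', Denumerable.ofNat_encode, ← hmod pT, ← hmod pU]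
    exact hdom c e
  refine ⟨K, hK, c, ?_, fun e => ?_⟩
  · rw [hc 0]
    simp only [hΘ]
    have : ∀ M : PAM, (¬((![(c : M), ((0 : ℕ) : M)] 1 = 0 ∧ ¬Ph K k M (![(c : M), ((0 : ℕ) : M)] 0)) ∨
        ∃ x, (![(c : M), ((0 : ℕ) : M)] 1 = x + 1 ∧ SgE (k + 1) M x 0) ∧ Ph K k M (![(c : M), ((0 : ℕ) : M)] 0))) ↔
        Ph K k M c := by
      intro M
      rw [not_iff_comm]
      simp only [Matrix.cons_val_zero, Matrix.cons_val_one, Nat.cast_zero]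
      constructor
      · exact fun h => Or.inl ⟨trivial, h⟩
      · rintro (⟨_, h⟩ | ⟨x, ⟨h, h'⟩, h''⟩)
        · exact h
        · exact absurd h.symm (by positivity)
    simp only [this]
  · rw [hc (e + 1)]
    simp only [hΘ]
    have : ∀ M : PAM, (¬((![(c : M), ((e + 1 : ℕ) : M)] 1 = 0 ∧ ¬Ph K k M (![(c : M), ((e + 1 : ℕ) : M)] 0)) ∨
        ∃ x, (![(c : M), ((e + 1 : ℕ) : M)] 1 = x + 1 ∧ SgE (k + 1) M x 0) ∧ Ph K k M (![(c : M), ((e + 1 : ℕ) : M)] 0))) ↔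
        ¬ (Ph K k M c ∧ SgE (k + 1) M e 0) := by
      intro M
      rw [not_iff_not]
      simp only [Matrix.cons_val_zero, Matrix.cons_val_one, Nat.cast_succ]
      constructor
      · rintro (⟨h, _⟩ | ⟨x, ⟨h, h'⟩, h''⟩)
        · exact absurd h (by positivity)
        · obtain rfl := add_right_cancel h
          exact ⟨h'', h'⟩
      · rintro ⟨h, h'⟩
        exact Or.inr ⟨_, ⟨rfl, h'⟩, h⟩
    simp only [this]

theorem unprov (hK : D0 3 K) {T U : Thy} (pT : ExtPA T) (pU : ExtPA U) {c : ℕ}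
    (h0 : (∀ M : PAM, M ⊨ T → Ph K k M c) → ∃ w : ℕ, K NN ![c, 0, w])
    (h1 : ∀ e : ℕ, (∃ w : ℕ, K NN ![c, e + 1, w]) →
        (∀ M : PAM, M ⊨ T → ¬ (Ph K k M c ∧ SgE (k + 1) M e 0)) ∨
        (∀ M : PAM, M ⊨ U → ¬ (Ph K k M c ∧ SgE (k + 1) M e 0)))
    (hc : Con (T ∪ ThIn (PiS (k + 1)) U)) : ¬ ∀ M : PAM, M ⊨ T → Ph K k M c := by
  intro hp
  obtain ⟨p, hp'⟩ := h0 hp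
  obtain ⟨M, hM⟩ := (con_iff (pT.mono Set.subset_union_left)).1 hc
  have hMT : M ⊨ T := hM.mono Set.subset_union_left
  obtain ⟨e, w, ⟨h2, h3⟩, h4⟩ := hp M hMT
  have hlt : e + w < (p : M) := by
    by_contra h
    rw [not_lt] at h
    have := (k3_abs hK M c 0 p).2 hp'
    rw [Nat.cast_zero] at this
    exact h3 _ h this
  obtain ⟨e, _, rfl⟩ := PAM.std _ _ ((le_self_add).trans hlt.le)
  obtain ⟨w, _, rfl⟩ := PAM.std _ _ ((le_add_self).trans hlt.le)
  have h2' : K NN ![c, e + 1, w] := by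
    rw [← k3_abs hK M, Nat.cast_succ]; exact h2
  have h3' : ∀ z ≤ e + w, ¬ K NN ![c, 0, z] := by
    intro z hz
    rw [← k3_abs hK M, Nat.cast_zero]
    refine h3 _ ?_
    rw [← Nat.cast_add]
    exact Nat.cast_le.2 hz
  rcases h1 e ⟨w, h2'⟩ with h | h
  · exact h M hMT ⟨hp M hMT, h4⟩
  · obtain ⟨χ, hχ, hχ'⟩ := (sat_syn_not k (DT.num (n := 0) e) .zero).1
    have hU : Prv U χ := by
      refine (prv_iff pU).2 (fun N hN => ?_)
      rw [real0 default, hχ']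
      exact fun hs => h N hN ⟨Ph_intro hK h2' h3' N hs, hs⟩
    have := hM.realize_of_mem χ (Or.inr ⟨hχ, hU⟩)
    rw [real0 default, hχ'] at this
    exact this h4

theorem hcons (hK : D0 3 K) {T : Thy} (pT : ExtPA T) {c : ℕ} (h0 : ¬ ∃ w : ℕ, K NN ![c, 0, w])
    (h1 : ∀ e : ℕ, (∀ M : PAM, M ⊨ T → ¬ (Ph K k M c ∧ SgE (k + 1) M e 0)) → ∃ w : ℕ, K NN ![c, e + 1, w])
    {φ : Snt} (hφ : ∀ M : PAM, M ⊨ φ ↔ Ph K k M c) : HConsIn (PiS (k + 1)) T φ := by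
  intro V hV π hπ hp
  obtain ⟨A, hA, hA'⟩ := pi_rep hπ
  obtain ⟨e, he⟩ := hA.not
  have hs : ∀ M : PAM, SgE (k + 1) M (e : M) 0 ↔ ¬ M ⊨ π := by
    intro M
    rw [real0 default, hA' M, (sat_not _ _ _ _).2, (sgE_iff he (k + 1) M 0).1]
    rfl
  have hp := (prv_iff (hV.1.mono (Set.subset_insert φ V))).1 hp
  have hp' : ∀ M : PAM, M ⊨ V → ¬ (Ph K k M c ∧ SgE (k + 1) M e 0) := by
    rintro M hM ⟨h2, h3⟩
    exact (hs M).1 h3 (hp M (mod_add.2 ⟨(hφ M).2 h2, hM⟩))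
  obtain ⟨w, hw⟩ := h1 e (fun M hM => hp' M (mod_sub hV pT hM))
  refine (prv_iff hV.1).2 (fun M hM => ?_)
  by_contra hn
  have := (hs M).2 hn
  exact hp' M hM ⟨Ph_intro hK hw (fun z _ h => h0 ⟨z, h⟩) M this, this⟩

theorem one_two {T U : Thy} (hT : GoodThy T) (hU : GoodThy U) (h : Cpair (k + 1) T U) :
    ∃ φ ∈ SigmaS (k + 1), HConsIn (PiS (k + 1)) T φ ∧ HConsIn (PiS (k + 1)) U φ ∧ φ ∉ Th T ∪ Th U := by
  obtain ⟨K, hK, c, h0, h1⟩ := exists_fix hT.1 hU.1 hT.2.2 hU.2.2 k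
  obtain ⟨φ, hφ, hφ'⟩ := Ph_SG (k := k) hK (DT.num (n := 0) c)
  have hr : ∀ M : PAM, M ⊨ φ ↔ Ph K k M c := fun M => by rw [real0 default, hφ']
  have n1 := unprov hK hT.2.2 hU.2.2 (fun h => h0.2 (.inl h)) (fun e => (h1 e).1) h.1
  have n2 := unprov hK hU.2.2 hT.2.2 (fun h => h0.2 (.inr h)) (fun e h => ((h1 e).1 h).symm) h.2
  have h0' : ¬ ∃ w : ℕ, K NN ![c, 0, w] := fun h => (h0.1 h).elim n1 n2
  refine ⟨φ, hφ, hcons hK hT.2.2 h0' (fun e h => (h1 e).2 (.inl h)) hr,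
    hcons hK hU.2.2 h0' (fun e h => (h1 e).2 (.inr h)) hr, ?_⟩
  rintro (h | h)
  · exact n1 (fun M hM => (hr M).1 ((prv_iff hT.2.2).1 h M hM))
  · exact n2 (fun M hM => (hr M).1 ((prv_iff hU.2.2).1 h M hM))
end fix

theorem four_one {Γ : Set Snt} {T U : Thy} (hT : ExtPA T) (hU : ExtPA U) {φ : Snt} (h : HConsIn Γ U φ)
    (hn : ¬ Prv T φ) : Con (T ∪ ThIn Γ U) := by
  rw [prv_iff hT] at hn
  push Not at hn
  obtain ⟨M, hM, hn⟩ := hn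
  refine (con_iff (hT.mono Set.subset_union_left)).2 ⟨M, ⟨fun π hπ => ?_⟩⟩
  rcases hπ with hπ | ⟨h1, h2⟩
  · exact hM.realize_of_mem π hπ
  · have hV : ExtPA (add PAAx (φ ⟹ π)) := fun ψ hψ => prv_mem (Set.mem_insert_of_mem _ hψ)
    have hsub : SubThy (add PAAx (φ ⟹ π)) U := by
      refine ⟨hV, fun ψ hψ => (prv_iff hU).2 (fun N hN => (prv_iff hV).1 hψ N (mod_add.2 ⟨?_, N.mod⟩))⟩
      intro _
      exact (prv_iff hU).1 h2 N hN
    have := h _ hsub π h1 ((prv_iff (hV.mono (Set.subset_insert _ _))).2 (fun N hN => by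
      obtain ⟨h3, h4⟩ := mod_add.1 hN
      exact (mod_add.1 h4).1 h3))
    exact (prv_iff hV).1 this M (mod_add.2 ⟨fun h => absurd h hn, M.mod⟩)

/-- Theorem 4.3: characterization of simultaneous (non-trivial/exact) hereditary
`Π_n`-conservativity via `C_n`-pairs. -/
theorem stmt_1 (T U : Thy) (hT : GoodThy T) (hU : GoodThy U) (n : ℕ) (hn : 1 ≤ n) :
    List.TFAE
      [Cpair n T U,
       ∃ φ ∈ SigmaS n, HConsIn (PiS n) T φ ∧ HConsIn (PiS n) U φ ∧ φ ∉ Th T ∪ Th U,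
       ∃ φ ψ : Snt, (HConsIn (PiS n) T φ ∧ HConsIn (PiS n) U φ) ∧ ψ ∈ SigmaS n ∧
         Prv (add PAAx φ) ψ ∧ ¬ Prv T ψ ∧ ¬ Prv U ψ,
       ∃ φ : Snt, HConsIn (PiS n) T φ ∧ HConsIn (PiS n) U φ ∧ φ ∉ Th T ∪ Th U] := by
  obtain ⟨k, rfl⟩ : ∃ k, n = k + 1 := ⟨n - 1, by omega⟩
  have hPA : ∀ φ, ExtPA (add PAAx φ) := fun φ ψ hψ => prv_mem (Set.mem_insert_of_mem _ hψ)
  tfae_have 1 → 2 := one_two hT hU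
  tfae_have 2 → 3 := by
    rintro ⟨φ, h1, h2, h3, h4⟩
    exact ⟨φ, φ, ⟨h2, h3⟩, h1, prv_mem (Set.mem_insert _ _), fun h => h4 (.inl h), fun h => h4 (.inr h)⟩
  tfae_have 3 → 4 := by
    rintro ⟨φ, ψ, ⟨h1, h2⟩, _, h3, h4, h5⟩
    have key : ∀ {T : Thy}, ExtPA T → Prv T φ → Prv T ψ := fun hT h =>
      (prv_iff hT).2 (fun M hM => (prv_iff (hPA φ)).1 h3 M (mod_add.2 ⟨(prv_iff hT).1 h M hM, M.mod⟩))
    refine ⟨φ, h1, h2, ?_⟩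
    rintro (h | h)
    · exact h4 (key hT.2.2 h)
    · exact h5 (key hU.2.2 h)
  tfae_have 4 → 1 := by
    rintro ⟨φ, h1, h2, h3⟩
    exact ⟨four_one hT.2.2 hU.2.2 h2 (fun h => h3 (.inl h)), four_one hU.2.2 hT.2.2 h1 (fun h => h3 (.inr h))⟩
  tfae_finish

end Guaspari
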